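/- Let N ≥ 2 be an integer, q ∈ (1, ∞), σ ∈ (0, π/2), ρ₊ > 0, ρ₋ > 0, and c > 0. There exists a constant C = C(N, q, σ, ρ₊, ρ₋, c) > 0 with the following property. Let λ ∈ ℂ with λ ≠ 0 and |arg λ| < π − σ, let ρ_a ∈ {ρ₊, ρ₋}, set A(ξ') = √(ρ_a λ + ‖ξ'‖²) (principal square root), and let ℓ : ℝ^{N−1} → ℂ be smooth on ℝ^{N−1} ∖ {0} with ‖D^n ℓ(ξ')‖ ≤ c (|λ|^{1/2} + ‖ξ'‖)^{−1−n} for all ξ' ≠ 0 and all 0 ≤ n ≤ N + 1. Then for every Schwartz function f ∈ 𝓢(ℝ^N; ℂ), the function L f defined for x = (x', x_N) with x_N > 0 by L f(x) = (2π)^{−(N−1)} ∫_{ℝ^{N−1}} e^{i x'·ξ'} ℓ(ξ') e^{−A(ξ') x_N} f̂(ξ', 0) dξ', where f̂(ξ', 0) = ∫_{ℝ^{N−1}} e^{−i z'·ξ'} f(z', 0) dz', satisfies, for each sign ς ∈ {+1, −1}, |λ| ‖L f‖_{L^q(ℝ^N_+)} + |λ|^{1/2} ‖∇ L f‖_{L^q(ℝ^N_+)}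 + ‖D² L f‖_{L^q(ℝ^N_+)} ≤ C ( |λ|^{1/2} ‖f‖_{L^q(ℝ^N_ς)} + ‖∇f‖_{L^q(ℝ^N_ς)} ), with C independent of λ, ℓ, and f. -/

import Mathlib

open Real MeasureTheory
open scoped RealInnerProductSpace

/-- The `L^p` norm (real exponent `p`) of `f` with respect to the measure `μ`. -/
noncomputable def LqNorm {α : Type*} [MeasurableSpace α] {E : Type*} [NormedAddCommGroup E]
    (μ : Measure α) (p : ℝ) (f : α → E) : ℝ :=
  (∫ x, ‖f x‖ ^ p ∂μ) ^ (1 / p)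

/-- Jensen's inequality for a weighted lower integral. -/
theorem lintegral_mul_rpow_le {α : Type*} [MeasurableSpace α] (μ : Measure α) {q : ℝ}
    (hq : 1 < q) {K G : α → ENNReal} (hK : AEMeasurable K μ) (hG : AEMeasurable G μ) :
    (∫⁻ a, K a * G a ∂μ) ^ q ≤ (∫⁻ a, K a ∂μ) ^ (q - 1) * ∫⁻ a, K a * G a ^ q ∂μ := by
  have hpq : (q / (q - 1)).HolderConjugate q := by
    have := (Real.HolderConjugate.conjExponent hq).symm
    simpa [Real.conjExponent] using this
  have q0 : 0 < q := by linarith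
  have hs : 1 / (q / (q - 1)) + 1 / q = 1 := by
    have := hpq.inv_add_inv_eq_one
    simpa [one_div] using this
  have hp0 : 0 < q / (q - 1) := hpq.pos
  have key := ENNReal.lintegral_mul_le_Lp_mul_Lq μ hpq
    (f := fun a => K a ^ (1 / (q / (q - 1)))) (g := fun a => K a ^ (1 / q) * G a)
    (hK.pow_const _) ((hK.pow_const _).mul hG)
  have e1 : ∀ a, ((fun a => K a ^ (1 / (q / (q - 1)))) * (fun a => K a ^ (1 / q) * G a)) a
      = K a * G a := by
    intro a
    simp only [Pi.mul_apply]
    rw [← mul_assoc, ← ENNReal.rpow_add_of_nonneg _ _ (by positivity) (by positivity), hs,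
      ENNReal.rpow_one]
  have e2 : ∀ a, (K a ^ (1 / (q / (q - 1)))) ^ (q / (q - 1)) = K a := by
    intro a
    rw [← ENNReal.rpow_mul, one_div_mul_cancel hp0.ne', ENNReal.rpow_one]
  have e3 : ∀ a, (K a ^ (1 / q) * G a) ^ q = K a * G a ^ q := by
    intro a
    rw [ENNReal.mul_rpow_of_nonneg _ _ q0.le, ← ENNReal.rpow_mul, one_div_mul_cancel q0.ne',
      ENNReal.rpow_one]
  simp only [e1, e2, e3] at key
  calc (∫⁻ a, K a * G a ∂μ) ^ q
      ≤ ((∫⁻ a, K a ∂μ) ^ (1 / (q / (q - 1))) * (∫⁻ a, K a * G a ^ q ∂μ) ^ (1 / q)) ^ q :=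
        ENNReal.rpow_le_rpow key q0.le
    _ = _ := by
        rw [ENNReal.mul_rpow_of_nonneg _ _ q0.le, ← ENNReal.rpow_mul, ← ENNReal.rpow_mul,
          one_div_mul_cancel q0.ne', ENNReal.rpow_one]
        congr 2
        field_simp

/-- Young's inequality `L¹ * L^q → L^q`, for lower integrals. -/
theorem lintegral_conv_rpow_le {G : Type*} [MeasurableSpace G] [AddCommGroup G]
    [MeasurableAdd₂ G] [MeasurableNeg G] (μ : Measure G) [μ.IsAddLeftInvariant]
    [μ.IsNegInvariant] [SFinite μ] {q : ℝ} (hq : 1 < q)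
    {k h : G → ENNReal} (hk : Measurable k) (hh : Measurable h) :
    ∫⁻ x, (∫⁻ z, k (x - z) * h z ∂μ) ^ q ∂μ ≤ (∫⁻ x, k x ∂μ) ^ q * ∫⁻ z, h z ^ q ∂μ := by
  have hsub : Measurable fun p : G × G => k (p.1 - p.2) := by
    simp only [sub_eq_add_neg]
    fun_prop
  have h1 : ∀ x, ∫⁻ z, k (x - z) ∂μ = ∫⁻ z, k z ∂μ := fun x => lintegral_sub_left_eq_self k x
  have h2 : ∀ z, ∫⁻ x, k (x - z) ∂μ = ∫⁻ z, k z ∂μ := fun z => lintegral_sub_right_eq_self k z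
  have hG : AEMeasurable h μ := hh.aemeasurable
  calc ∫⁻ x, (∫⁻ z, k (x - z) * h z ∂μ) ^ q ∂μ
      ≤ ∫⁻ x, (∫⁻ z, k z ∂μ) ^ (q - 1) * ∫⁻ z, k (x - z) * h z ^ q ∂μ ∂μ := by
        refine lintegral_mono fun x => ?_
        have hx : Measurable fun z => k (x - z) := hsub.comp measurable_prodMk_left
        have := lintegral_mul_rpow_le μ hq hx.aemeasurable hG
        rwa [h1] at this
    _ = (∫⁻ z, k z ∂μ) ^ (q - 1) * ∫⁻ z, ∫⁻ x, k (x - z) * h z ^ q ∂μ ∂μ := by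
        rw [lintegral_const_mul, lintegral_lintegral_swap]
        · fun_prop
        · exact Measurable.lintegral_prod_right
            (f := fun x z => k (x - z) * h z ^ q) (hsub.mul ((hh.comp measurable_snd).pow_const q))
    _ = (∫⁻ z, k z ∂μ) ^ (q - 1) * ((∫⁻ z, k z ∂μ) * ∫⁻ z, h z ^ q ∂μ) := by
        congr 1
        rw [← lintegral_const_mul _ (by fun_prop)]
        refine lintegral_congr fun z => ?_
        have hz : Measurable fun x => k (x - z) := hsub.comp measurable_prodMk_right
        rw [lintegral_mul_const _ hz, h2]
    _ = _ := by
        rw [← mul_assoc]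
        congr 1
        nth_rewrite 2 [← ENNReal.rpow_one (∫⁻ z, k z ∂μ)]
        rw [← ENNReal.rpow_add_of_nonneg _ _ (by linarith) zero_le_one]
        simp

/-- The kernel `1 / (x + y)` maps `y ^ (-a)` to a multiple of `x ^ (-a)` when `0 < a < 1`. -/
theorem lintegral_rpow_div_add_le {a : ℝ} (ha0 : 0 < a) (ha1 : a < 1) {x : ℝ} (hx : 0 < x) :
    ∫⁻ y in Set.Ioi 0, ENNReal.ofReal (y ^ (-a) / (x + y)) ≤
      ENNReal.ofReal ((1 / (1 - a) + 1 / a) * x ^ (-a)) := by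
  have hsplit : Set.Ioi (0:ℝ) = Set.Ioc 0 x ∪ Set.Ioi x := (Set.Ioc_union_Ioi_eq_Ioi hx.le).symm
  have e1 : ∫⁻ y in Set.Ioc 0 x, ENNReal.ofReal (y ^ (-a) / (x + y)) ≤
      ENNReal.ofReal (1 / (1 - a) * x ^ (-a)) := by
    have hi : IntervalIntegrable (fun y : ℝ => y ^ (-a) * x⁻¹) volume 0 x :=
      (intervalIntegral.intervalIntegrable_rpow' (by linarith)).mul_const _
    have hi' : IntegrableOn (fun y : ℝ => y ^ (-a) * x⁻¹) (Set.Ioc 0 x) :=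
      (intervalIntegrable_iff_integrableOn_Ioc_of_le hx.le).1 hi
    calc _ ≤ ∫⁻ y in Set.Ioc 0 x, ENNReal.ofReal (y ^ (-a) * x⁻¹) := by
          refine setLIntegral_mono' measurableSet_Ioc fun y hy => ?_
          refine ENNReal.ofReal_le_ofReal ?_
          rw [div_eq_mul_inv]
          have : 0 < y := hy.1
          gcongr
          linarith
      _ = ENNReal.ofReal (∫ y in Set.Ioc 0 x, y ^ (-a) * x⁻¹) := by
          rw [ofReal_integral_eq_lintegral_ofReal hi']
          refine (ae_restrict_mem measurableSet_Ioc).mono fun y hy => ?_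
          have : 0 < y := hy.1
          positivity
      _ ≤ _ := by
          refine ENNReal.ofReal_le_ofReal ?_
          rw [← intervalIntegral.integral_of_le hx.le, intervalIntegral.integral_mul_const,
            integral_rpow (Or.inl (by linarith)), Real.zero_rpow (by linarith),
            Real.rpow_add hx, Real.rpow_one]
          apply le_of_eq
          have : -a + 1 = 1 - a := by ring
          rw [this]
          have : 1 - a ≠ 0 := by linarith
          field_simp
          ring
  have e2 : ∫⁻ y in Set.Ioi x, ENNReal.ofReal (y ^ (-a) / (x + y)) ≤
      ENNReal.ofReal (1 / a * x ^ (-a)) := by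
    have hi' : IntegrableOn (fun y : ℝ => y ^ (-a - 1)) (Set.Ioi x) :=
      integrableOn_Ioi_rpow_of_lt (by linarith) hx
    calc _ ≤ ∫⁻ y in Set.Ioi x, ENNReal.ofReal (y ^ (-a - 1)) := by
          refine setLIntegral_mono' measurableSet_Ioi fun y hy => ?_
          refine ENNReal.ofReal_le_ofReal ?_
          have : 0 < y := hx.trans hy
          rw [Real.rpow_sub this, Real.rpow_one]
          gcongr
          linarith
      _ = ENNReal.ofReal (∫ y in Set.Ioi x, y ^ (-a - 1)) := by
          rw [ofReal_integral_eq_lintegral_ofReal hi']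
          refine (ae_restrict_mem measurableSet_Ioi).mono fun y hy => ?_
          have : 0 < y := hx.trans hy
          positivity
      _ ≤ _ := by
          refine ENNReal.ofReal_le_ofReal ?_
          rw [integral_Ioi_rpow_of_lt (by linarith) hx]
          apply le_of_eq
          have : -a - 1 + 1 = -a := by ring
          rw [this]
          field_simp
  rw [hsplit, lintegral_union measurableSet_Ioi (Set.Ioc_disjoint_Ioi le_rfl), add_mul,
    ENNReal.ofReal_add (by have : 0 < 1 - a := by linarith
                           positivity) (by positivity)]
  exact add_le_add e1 e2

/-- Integrating out `r` in the kernel `r ^ n (s + r) ^ (-n-2)`. -/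
theorem lintegral_pow_div_add_pow_le (n : ℕ) {s : ℝ} (hs : 0 < s) :
    ∫⁻ r in Set.Ioi 0, ENNReal.ofReal (r ^ n / (s + r) ^ (n + 2)) ≤ ENNReal.ofReal (1 / s) := by
  have h0 : ∫⁻ r in Set.Ioi (0:ℝ), ENNReal.ofReal ((s + r) ^ (-2:ℝ)) = ENNReal.ofReal (1 / s) := by
    have hi : IntegrableOn (fun r : ℝ => r ^ (-2:ℝ)) (Set.Ioi s) :=
      integrableOn_Ioi_rpow_of_lt (by norm_num) hs
    have h1 := ofReal_integral_eq_lintegral_ofReal hi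
      ((ae_restrict_mem measurableSet_Ioi).mono fun y hy => by
        have : 0 < y := hs.trans hy
        positivity)
    rw [integral_Ioi_rpow_of_lt (by norm_num) hs] at h1
    have h2 : ∫⁻ r in Set.Ioi (0:ℝ), ENNReal.ofReal ((s + r) ^ (-2:ℝ)) =
        ∫⁻ r in Set.Ioi s, ENNReal.ofReal (r ^ (-2:ℝ)) := by
      rw [← lintegral_indicator measurableSet_Ioi, ← lintegral_indicator measurableSet_Ioi,
        ← lintegral_add_left_eq_self ((Set.Ioi s).indicator _) s]
      congr 1
      ext r
      simp [Set.indicator]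
    rw [h2, ← h1]
    congr 1
    rw [show (-2:ℝ) + 1 = -1 by norm_num, Real.rpow_neg_one]
    field_simp
  rw [← h0]
  refine setLIntegral_mono' measurableSet_Ioi fun r hr => ENNReal.ofReal_le_ofReal ?_
  have hr : 0 < r := hr
  rw [Real.rpow_neg (by positivity), Real.rpow_two, pow_add, div_le_iff₀ (by positivity)]
  have : r ^ n ≤ (s + r) ^ n := by gcongr; linarith
  calc r ^ n ≤ (s + r) ^ n := this
    _ = _ := by field_simp

/-- The Schur test for the kernel `r ^ n (x + y + r) ^ (-n-2)` on a half-space. -/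
theorem lintegral_halfSpace_schur {X : Type*} [MeasurableSpace X] (m : Measure X) [SFinite m]
    (n : ℕ) {q : ℝ} (hq : 1 < q) {G : (X × ℝ) × (ℝ × ℝ) → ENNReal} (hG : Measurable G)
    {φ : ℝ → ENNReal} (hφ : Measurable φ)
    (hGφ : ∀ x > 0, ∀ y > 0, ∀ r > 0, ∫⁻ z, G ((z, x), (y, r)) ^ q ∂m ≤ φ y) :
    ∫⁻ p, (∫⁻ w, ENNReal.ofReal (w.2 ^ n / (p.2 + w.1 + w.2) ^ (n + 2)) * G (p, w)
        ∂((volume.restrict (Set.Ioi (0:ℝ))).prod (volume.restrict (Set.Ioi (0:ℝ))))) ^ q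
        ∂(m.prod (volume.restrict (Set.Ioi (0:ℝ)))) ≤
      ENNReal.ofReal (1 / (1 - 1 / q) + q) ^ q * ∫⁻ y in Set.Ioi 0, φ y := by
  set H : Measure ℝ := volume.restrict (Set.Ioi (0:ℝ)) with hH
  set a : ℝ := 1 / q with ha
  have q0 : 0 < q := by linarith
  have ha0 : 0 < a := by positivity
  have ha1 : a < 1 := by rw [ha, div_lt_one q0]; exact hq
  have haq : a * q = 1 := by rw [ha]; field_simp
  set c : ℝ := 1 / (1 - a) + q with hc
  have h1a : 0 < 1 - a := by linarith
  have hc0 : 0 < c := by positivity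
  have hpos : ∀ᵐ y ∂H, 0 < y := ae_restrict_mem measurableSet_Ioi
  set κ : ℝ → ℝ × ℝ → ENNReal := fun x w =>
    ENNReal.ofReal (w.2 ^ n / (x + w.1 + w.2) ^ (n + 2)) with hκ
  have hκm : Measurable fun v : ℝ × (ℝ × ℝ) => κ v.1 v.2 := by
    simp only [hκ]
    fun_prop
  have hκr : ∀ x y, 0 < x → 0 < y → ∫⁻ r, κ x (y, r) ∂H ≤ ENNReal.ofReal (1 / (x + y)) :=
    fun x y hx hy => lintegral_pow_div_add_pow_le n (by positivity)
  change ∫⁻ p, (∫⁻ w, κ p.2 w * G (p, w) ∂(H.prod H)) ^ q ∂(m.prod H) ≤ _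
  clear_value κ
  have hposw : ∀ᵐ w ∂(H.prod H), 0 < w.1 := by
    exact Measure.quasiMeasurePreserving_fst.ae hpos
  have hposw2 : ∀ᵐ w ∂(H.prod H), 0 < w.2 := by
    exact Measure.quasiMeasurePreserving_snd.ae hpos
  have hposp : ∀ᵐ p ∂(m.prod H), 0 < p.2 := by
    exact Measure.quasiMeasurePreserving_snd.ae hpos
  have first : ∀ x > 0, ∫⁻ w, κ x w * ENNReal.ofReal (w.1 ^ (-a)) ∂(H.prod H) ≤
      ENNReal.ofReal (c * x ^ (-a)) := by
    intro x hx
    rw [lintegral_prod _ (by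
      have : Measurable (κ x) := hκm.comp measurable_prodMk_left
      fun_prop)]
    calc _ ≤ ∫⁻ y, ENNReal.ofReal (y ^ (-a) / (x + y)) ∂H := by
          refine lintegral_mono_ae (hpos.mono fun y hy => ?_)
          have hm : Measurable fun r => κ x (y, r) :=
            hκm.comp (measurable_prodMk_left.comp measurable_prodMk_left)
          dsimp only
          rw [lintegral_mul_const _ hm]
          calc _ ≤ ENNReal.ofReal (1 / (x + y)) * ENNReal.ofReal (y ^ (-a)) := by
                gcongr
                exact hκr x y hx hy
            _ = _ := by
                rw [← ENNReal.ofReal_mul (by positivity)]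
                congr 1
                ring
      _ ≤ _ := by
          have := lintegral_rpow_div_add_le ha0 ha1 hx
          rwa [show 1 / a = q by rw [ha]; field_simp] at this
  have second : ∀ y > 0, ∫⁻ x, ∫⁻ r, ENNReal.ofReal (x ^ (-(1 - a))) * κ x (y, r) ∂H ∂H ≤
      ENNReal.ofReal (c * y ^ (-(1 - a))) := by
    intro y hy
    calc _ ≤ ∫⁻ x, ENNReal.ofReal (x ^ (-(1 - a)) / (y + x)) ∂H := by
          refine lintegral_mono_ae (hpos.mono fun x hx => ?_)
          have hm : Measurable fun r => κ x (y, r) :=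
            hκm.comp (measurable_prodMk_left.comp measurable_prodMk_left)
          rw [lintegral_const_mul _ hm]
          calc _ ≤ ENNReal.ofReal (x ^ (-(1 - a))) * ENNReal.ofReal (1 / (x + y)) := by
                gcongr
                exact hκr x y hx hy
            _ = _ := by
                rw [← ENNReal.ofReal_mul (by positivity)]
                congr 1
                rw [add_comm y x]
                ring
      _ ≤ _ := by
          have := lintegral_rpow_div_add_le h1a (by linarith) hy
          rw [show 1 / (1 - (1 - a)) + 1 / (1 - a) = c by
            rw [hc, ha]; field_simp; ring] at this
          exact this
  calc ∫⁻ p, (∫⁻ w, κ p.2 w * G (p, w) ∂(H.prod H)) ^ q ∂(m.prod H)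
      ≤ ∫⁻ p, ENNReal.ofReal (c * p.2 ^ (-a)) ^ (q - 1) *
          ∫⁻ w, κ p.2 w * ENNReal.ofReal (w.1 ^ (1 - a)) * G (p, w) ^ q ∂(H.prod H)
          ∂(m.prod H) := by
        refine lintegral_mono_ae (hposp.mono fun p hp => ?_)
        have hm : Measurable (κ p.2) := hκm.comp measurable_prodMk_left
        have hg : Measurable fun w => G (p, w) := hG.comp measurable_prodMk_left
        have := lintegral_mul_rpow_le (H.prod H) hq
          (K := fun w => κ p.2 w * ENNReal.ofReal (w.1 ^ (-a)))
          (G := fun w => ENNReal.ofReal (w.1 ^ a) * G (p, w)) (by fun_prop) (by fun_prop)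
        calc _ = (∫⁻ w, κ p.2 w * ENNReal.ofReal (w.1 ^ (-a)) *
              (ENNReal.ofReal (w.1 ^ a) * G (p, w)) ∂(H.prod H)) ^ q := by
              congr 1
              refine lintegral_congr_ae (hposw.mono fun w hw => ?_)
              simp only
              rw [mul_assoc, ← mul_assoc (ENNReal.ofReal _), ← ENNReal.ofReal_mul (by positivity),
                ← Real.rpow_add hw]
              simp
          _ ≤ _ := this
          _ ≤ _ := by
              refine mul_le_mul' (ENNReal.rpow_le_rpow (first p.2 hp) (by linarith)) (le_of_eq ?_)
              refine lintegral_congr_ae (hposw.mono fun w hw => ?_)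
              simp only
              rw [ENNReal.mul_rpow_of_nonneg _ _ q0.le,
                ENNReal.ofReal_rpow_of_nonneg (by positivity) q0.le, ← Real.rpow_mul hw.le, haq,
                mul_assoc, mul_assoc, ← mul_assoc (ENNReal.ofReal _),
                ← ENNReal.ofReal_mul (by positivity), ← Real.rpow_add hw, neg_add_eq_sub]
    _ = ∫⁻ p, ∫⁻ w, ENNReal.ofReal (c * p.2 ^ (-a)) ^ (q - 1) *
          (κ p.2 w * ENNReal.ofReal (w.1 ^ (1 - a)) * G (p, w) ^ q) ∂(H.prod H)
          ∂(m.prod H) := by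
        refine lintegral_congr fun p => ?_
        have hm : Measurable (κ p.2) := hκm.comp measurable_prodMk_left
        have hg : Measurable fun w => G (p, w) := hG.comp measurable_prodMk_left
        rw [lintegral_const_mul _ (by fun_prop)]
    _ = ∫⁻ w, ∫⁻ p, ENNReal.ofReal (c * p.2 ^ (-a)) ^ (q - 1) *
          (κ p.2 w * ENNReal.ofReal (w.1 ^ (1 - a)) * G (p, w) ^ q) ∂(m.prod H)
          ∂(H.prod H) := by
        refine lintegral_lintegral_swap ?_
        have hm : Measurable fun v : (X × ℝ) × (ℝ × ℝ) => κ v.1.2 v.2 :=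
          hκm.comp (f := fun v : (X × ℝ) × (ℝ × ℝ) => (v.1.2, v.2)) (by fun_prop)
        refine Measurable.aemeasurable ?_
        simp only [Function.uncurry_def]
        fun_prop
    _ ≤ ∫⁻ w, ∫⁻ x, ENNReal.ofReal (c * x ^ (-a)) ^ (q - 1) *
          (κ x w * ENNReal.ofReal (w.1 ^ (1 - a)) * φ w.1) ∂H ∂(H.prod H) := by
        refine lintegral_mono_ae ?_
        filter_upwards [hposw, hposw2] with w hw hw2
        have hm : Measurable fun x => κ x w := hκm.comp measurable_prodMk_right
        have hg : Measurable fun p => G (p, w) := hG.comp measurable_prodMk_right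
        rw [lintegral_prod_symm _ (by fun_prop)]
        refine lintegral_mono_ae (hpos.mono fun x hx => ?_)
        have hg' : Measurable fun z => G ((z, x), w) := hg.comp measurable_prodMk_right
        simp only
        rw [lintegral_const_mul _ (by fun_prop), lintegral_const_mul _ (by fun_prop)]
        gcongr
        exact hGφ x hx w.1 hw w.2 hw2
    _ = ∫⁻ y, ∫⁻ r, ∫⁻ x, ENNReal.ofReal (c * x ^ (-a)) ^ (q - 1) *
          (κ x (y, r) * ENNReal.ofReal (y ^ (1 - a)) * φ y) ∂H ∂H ∂H := by
        rw [lintegral_prod]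
        refine (Measurable.lintegral_prod_right (f := fun w x =>
          ENNReal.ofReal (c * x ^ (-a)) ^ (q - 1) *
          (κ x w * ENNReal.ofReal (w.1 ^ (1 - a)) * φ w.1)) ?_).aemeasurable
        have hm : Measurable fun v : (ℝ × ℝ) × ℝ => κ v.2 v.1 :=
          hκm.comp (f := fun v : (ℝ × ℝ) × ℝ => (v.2, v.1)) (by fun_prop)
        simp only [Function.uncurry_def]
        fun_prop
    _ = ∫⁻ y, ENNReal.ofReal c ^ (q - 1) * (ENNReal.ofReal (y ^ (1 - a)) * φ y) *
          ∫⁻ x, ∫⁻ r, ENNReal.ofReal (x ^ (-(1 - a))) * κ x (y, r) ∂H ∂H ∂H := by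
        refine lintegral_congr fun y => ?_
        rw [lintegral_lintegral_swap]
        · have hm : Measurable fun v : ℝ × ℝ => κ v.1 (y, v.2) :=
            hκm.comp (f := fun v : ℝ × ℝ => (v.1, (y, v.2))) (by fun_prop)
          rw [← lintegral_const_mul]
          · refine lintegral_congr_ae (hpos.mono fun x hx => ?_)
            have hm' : Measurable fun r => κ x (y, r) := hm.comp measurable_prodMk_left
            simp only
            rw [← lintegral_const_mul _ (by fun_prop)]
            refine lintegral_congr fun r => ?_
            rw [ENNReal.ofReal_mul hc0.le, ENNReal.mul_rpow_of_nonneg _ _ (by linarith),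
              ENNReal.ofReal_rpow_of_nonneg (p := q - 1) (x := x ^ (-a)) (by positivity)
                  (by linarith),
              ← Real.rpow_mul hx.le,
              show -a * (q - 1) = -(1 - a) by linarith]
            ring
          · refine Measurable.lintegral_prod_right (f := fun x r =>
              ENNReal.ofReal (x ^ (-(1 - a))) * κ x (y, r)) ?_
            simp only [Function.uncurry_def]
            fun_prop
        · have hm : Measurable fun v : ℝ × ℝ => κ v.2 (y, v.1) :=
            hκm.comp (f := fun v : ℝ × ℝ => (v.2, (y, v.1))) (by fun_prop)
          refine Measurable.aemeasurable ?_
          simp only [Function.uncurry_def]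
          fun_prop
    _ ≤ ∫⁻ y, ENNReal.ofReal c ^ (q - 1) * (ENNReal.ofReal (y ^ (1 - a)) * φ y) *
          ENNReal.ofReal (c * y ^ (-(1 - a))) ∂H := by
        refine lintegral_mono_ae (hpos.mono fun y hy => ?_)
        gcongr
        exact second y hy
    _ = ∫⁻ y, ENNReal.ofReal c ^ q * φ y ∂H := by
        refine lintegral_congr_ae (hpos.mono fun y hy => ?_)
        simp only
        have e1 : ENNReal.ofReal c ^ q = ENNReal.ofReal c ^ (q - 1) * ENNReal.ofReal c := by
          nth_rewrite 3 [← ENNReal.rpow_one (ENNReal.ofReal c)]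
          rw [← ENNReal.rpow_add_of_nonneg _ _ (by linarith) zero_le_one]
          simp
        have e2 : ENNReal.ofReal (y ^ (1 - a)) * ENNReal.ofReal (y ^ (-(1 - a))) = 1 := by
          rw [← ENNReal.ofReal_mul (by positivity), ← Real.rpow_add hy]
          simp
        rw [e1, ENNReal.ofReal_mul hc0.le]
        calc _ = ENNReal.ofReal c ^ (q - 1) * ENNReal.ofReal c * φ y *
              (ENNReal.ofReal (y ^ (1 - a)) * ENNReal.ofReal (y ^ (-(1 - a)))) := by ring
          _ = _ := by rw [e2, mul_one]
    _ = _ := lintegral_const_mul _ hφ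

/-- The pointwise inequality behind M. Riesz' theorem for exponents `1 < q ≤ 2`. -/
theorem exists_abs_im_rpow_le {q : ℝ} (hq : 1 < q) (hq2 : q ≤ 2) :
    ∃ A B : ℝ, 0 ≤ A ∧ 0 ≤ B ∧ ∀ z : ℂ, 0 ≤ z.re →
      |z.im| ^ q ≤ A * z.re ^ q - B * (z ^ (q : ℂ)).re := by
  have q0 : 0 < q := by linarith
  set θ₀ : ℝ := (π / (2 * q) + π / 2) / 2 with hθ₀
  have hlt : π / (2 * q) < π / 2 := by
    apply div_lt_div_of_pos_left pi_pos (by norm_num) (by linarith)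
  have h1 : θ₀ < π / 2 := by rw [hθ₀]; linarith
  have h2 : π / (2 * q) < θ₀ := by rw [hθ₀]; linarith
  have h0 : 0 < θ₀ := lt_trans (by positivity) h2
  have h3 : π / 2 < q * θ₀ := by
    have : q * (π / (2 * q)) = π / 2 := by field_simp
    nlinarith
  have h4 : q * θ₀ < π := by nlinarith
  have hc1 : Real.cos (q * θ₀) < 0 := Real.cos_neg_of_pi_div_two_lt_of_lt h3 (by linarith [pi_pos])
  have hc2 : 0 < Real.cos θ₀ := Real.cos_pos_of_mem_Ioo ⟨by linarith, h1⟩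
  set B : ℝ := 1 / (-Real.cos (q * θ₀)) with hB
  have hB0 : 0 < B := by rw [hB]; apply one_div_pos.2; linarith
  refine ⟨(1 + B) / Real.cos θ₀ ^ q, B, by positivity, hB0.le, fun z hz => ?_⟩
  rw [Complex.cpow_ofReal_re]
  rcases eq_or_ne z 0 with rfl | hz0
  · simp [Real.zero_rpow q0.ne']
  have hr : 0 < ‖z‖ := norm_pos_iff.2 hz0
  have hre : z.re = ‖z‖ * Real.cos |z.arg| := by
    rw [Real.cos_abs, Complex.norm_mul_cos_arg]
  have hcos : Real.cos (z.arg * q) = Real.cos (q * |z.arg|) := by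
    rw [← Real.cos_abs (z.arg * q), abs_mul, abs_of_pos q0, mul_comm]
  have harg : |z.arg| ≤ π / 2 := Complex.abs_arg_le_pi_div_two_iff.2 hz
  have him : |z.im| ^ q ≤ ‖z‖ ^ q := by
    gcongr; exact Complex.abs_im_le_norm z
  rw [hcos]
  set φ := |z.arg| with hφ
  have hφ0 : 0 ≤ φ := abs_nonneg _
  have hcφ : 0 ≤ Real.cos φ := Real.cos_nonneg_of_mem_Icc ⟨by linarith, harg⟩
  rw [hre, Real.mul_rpow hr.le hcφ]
  have hrq : 0 < ‖z‖ ^ q := by positivity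
  have key : 1 ≤ (1 + B) / Real.cos θ₀ ^ q * Real.cos φ ^ q - B * Real.cos (q * φ) := by
    rcases le_total φ θ₀ with h | h
    · have : Real.cos θ₀ ≤ Real.cos φ := Real.cos_le_cos_of_nonneg_of_le_pi hφ0 (by linarith) h
      have h5 : Real.cos θ₀ ^ q ≤ Real.cos φ ^ q := by gcongr
      have h6 : 1 + B ≤ (1 + B) / Real.cos θ₀ ^ q * Real.cos φ ^ q := by
        rw [div_mul_eq_mul_div, le_div_iff₀ (by positivity)]
        gcongr
      have := Real.cos_le_one (q * φ)
      nlinarith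
    · have h5 : Real.cos (q * φ) ≤ Real.cos (q * θ₀) :=
        Real.cos_le_cos_of_nonneg_of_le_pi (by positivity) (by nlinarith) (by gcongr)
      have h6 : 1 = B * (-Real.cos (q * θ₀)) := by
        rw [hB]; field_simp [hc1.ne]
      have h7 : 0 ≤ (1 + B) / Real.cos θ₀ ^ q * Real.cos φ ^ q := by positivity
      nlinarith
  calc |z.im| ^ q ≤ ‖z‖ ^ q * 1 := by simpa using him
    _ ≤ ‖z‖ ^ q * ((1 + B) / Real.cos θ₀ ^ q * Real.cos φ ^ q - B * Real.cos (q * φ)) := by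
      gcongr
    _ = _ := by ring

/-- The Cauchy transform `∫ i h(s) / (z - s) ds`. -/
noncomputable def cauchyTransform (h : ℝ → ℝ) (z : ℂ) : ℂ :=
  ∫ s, (h s : ℂ) * (Complex.I / (z - s))

theorem im_le_norm_sub_ofReal {z : ℂ} {t : ℝ} (ht : t ≤ z.im) (s : ℝ) : t ≤ ‖z - s‖ := by
  have := Complex.abs_im_le_norm (z - s)
  simp at this
  exact ht.trans ((le_abs_self _).trans this)

theorem norm_I_div_sub_le {z : ℂ} {t : ℝ} (ht0 : 0 < t) (ht : t ≤ z.im) (s : ℝ) :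
    ‖Complex.I / (z - s)‖ ≤ 1 / t := by
  rw [norm_div, Complex.norm_I]
  exact one_div_le_one_div_of_le ht0 (im_le_norm_sub_ofReal ht s)

theorem integrable_cauchy {h : ℝ → ℝ} (hh : Integrable h) {z : ℂ} (hz : 0 < z.im) :
    Integrable fun s : ℝ => (h s : ℂ) * (Complex.I / (z - s)) := by
  refine Integrable.mul_bdd (c := 1 / z.im) hh.ofReal ?_ ?_
  · exact (by fun_prop : Measurable fun s : ℝ => Complex.I / (z - s)).aestronglyMeasurable
  · exact Filter.Eventually.of_forall fun s => norm_I_div_sub_le hz le_rfl s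

theorem differentiableAt_cauchyTransform {h : ℝ → ℝ} (hh : Integrable h) {z : ℂ}
    (hz : 0 < z.im) : DifferentiableAt ℂ (cauchyTransform h) z := by
  have hs : {w : ℂ | z.im / 2 < w.im} ∈ nhds z :=
    (isOpen_lt continuous_const Complex.continuous_im).mem_nhds (by simp; linarith)
  refine (hasDerivAt_integral_of_dominated_loc_of_deriv_le (μ := volume)
    (F := fun w (s : ℝ) => (h s : ℂ) * (Complex.I / (w - s)))
    (F' := fun w (s : ℝ) => (h s : ℂ) * (-Complex.I / (w - s) ^ 2))
    (bound := fun s => |h s| * (1 / (z.im / 2) ^ 2)) hs ?_ (integrable_cauchy hh hz) ?_ ?_ ?_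
    ?_).2.differentiableAt
  · filter_upwards [hs] with w hw
    exact (integrable_cauchy hh (lt_trans (by linarith) hw)).aestronglyMeasurable
  · exact hh.ofReal.aestronglyMeasurable.mul
      (by fun_prop : Measurable fun s : ℝ => -Complex.I / (z - s) ^ 2).aestronglyMeasurable
  · refine Filter.Eventually.of_forall fun s w hw => ?_
    rw [norm_mul, norm_div, norm_neg, Complex.norm_I, norm_pow, Complex.norm_real, norm_eq_abs]
    gcongr
    exact im_le_norm_sub_ofReal (le_of_lt hw) s
  · exact hh.abs.mul_const _
  · refine Filter.Eventually.of_forall fun s w hw => ?_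
    have hw0 : w - s ≠ 0 := by
      intro h0
      have := im_le_norm_sub_ofReal (le_of_lt hw) s
      rw [h0, norm_zero] at this
      linarith
    have := (((hasDerivAt_id w).sub_const (s : ℂ)).inv hw0).const_mul Complex.I
    have := this.const_mul (h s : ℂ)
    simp only [div_eq_mul_inv Complex.I]
    exact this.congr_deriv (by simp only [id]; ring)

theorem I_div_eq (x t : ℝ) (ht : 0 < t) :
    Complex.I / ((x : ℂ) + t * Complex.I) =
      ((t / (x ^ 2 + t ^ 2) : ℝ) : ℂ) + ((x / (x ^ 2 + t ^ 2) : ℝ) : ℂ) * Complex.I := by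
  have h1 : (x ^ 2 + t ^ 2 : ℝ) ≠ 0 := by positivity
  have h1' : ((x : ℂ) ^ 2 + (t : ℂ) ^ 2) ≠ 0 := by exact_mod_cast h1
  have h2 : (x : ℂ) + t * Complex.I ≠ 0 := by
    intro h
    have := congrArg Complex.im h
    simp at this
    exact ht.ne' this
  push_cast
  rw [div_eq_iff h2]
  field_simp
  ring_nf
  simp

/-- The majorant `∫ |h(s)| / |x + it - s| ds` of the Cauchy transform. -/
noncomputable def cauchyMajorant (h : ℝ → ℝ) (t x : ℝ) : ℝ :=
  ∫ s, |h s| * ‖Complex.I / ((x : ℂ) + t * Complex.I - s)‖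

theorem integrable_cauchyMajorant {h : ℝ → ℝ} (hh : Integrable h) {t : ℝ} (ht : 0 < t) (x : ℝ) :
    Integrable fun s : ℝ => |h s| * ‖Complex.I / ((x : ℂ) + t * Complex.I - s)‖ := by
  have := (integrable_cauchy hh (z := (x : ℂ) + t * Complex.I) (by simpa using ht)).norm
  simpa only [norm_mul, Complex.norm_real, norm_eq_abs] using this

theorem cauchyMajorant_nonneg (h : ℝ → ℝ) (t x : ℝ) : 0 ≤ cauchyMajorant h t x :=
  integral_nonneg fun s => by positivity

theorem norm_cauchyTransform_le {h : ℝ → ℝ} (hh : Integrable h) {t y : ℝ} (ht : 0 < t)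
    (hty : t ≤ y) (x : ℝ) :
    ‖cauchyTransform h ((x : ℂ) + y * Complex.I)‖ ≤ cauchyMajorant h t x := by
  refine (norm_integral_le_integral_norm _).trans ?_
  refine integral_mono (integrable_cauchy hh (by simpa using ht.trans_le hty)).norm
    (integrable_cauchyMajorant hh ht x) fun s => ?_
  dsimp only
  rw [norm_mul, Complex.norm_real, norm_eq_abs, norm_div, norm_div, Complex.norm_I]
  have h1 : 0 < ‖(x : ℂ) + t * Complex.I - s‖ :=
    ht.trans_le (im_le_norm_sub_ofReal (z := (x : ℂ) + t * Complex.I) (by simp) s)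
  gcongr
  have e : ∀ t : ℝ, (x : ℂ) + t * Complex.I - s = ((x - s : ℝ) : ℂ) + t * Complex.I := by
    intro t; push_cast; ring
  rw [e, e, Complex.norm_add_mul_I, Complex.norm_add_mul_I]
  gcongr

theorem norm_cauchyTransform_le_div {h : ℝ → ℝ} (hh : Integrable h) {t : ℝ} (ht : 0 < t) (x : ℝ) :
    ‖cauchyTransform h ((x : ℂ) + t * Complex.I)‖ ≤ (∫ s, |h s|) * (1 / t) := by
  refine (norm_integral_le_integral_norm _).trans ?_
  rw [← integral_mul_const]
  refine integral_mono (integrable_cauchy hh (by simpa using ht)).norm (hh.abs.mul_const _)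
    fun s => ?_
  dsimp only
  rw [norm_mul, Complex.norm_real, norm_eq_abs]
  gcongr
  exact norm_I_div_sub_le ht (by simp) s

theorem norm_I_div_le (t : ℝ) (ht : 0 < t) (x : ℝ) :
    ‖Complex.I / ((x : ℂ) + t * Complex.I)‖ ≤ (min 1 t / 2)⁻¹ * (1 + ‖x‖)⁻¹ := by
  rw [norm_div, Complex.norm_I, ← mul_inv, one_div]
  have h1 := Complex.abs_re_le_norm ((x : ℂ) + t * Complex.I)
  have h2 := Complex.abs_im_le_norm ((x : ℂ) + t * Complex.I)
  simp only [Complex.add_re, Complex.ofReal_re, Complex.mul_re, Complex.I_re, mul_zero,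
    Complex.ofReal_im, Complex.I_im, mul_one, sub_self, add_zero, Complex.add_im,
    Complex.mul_im, zero_add] at h1 h2
  rw [abs_of_pos ht] at h2
  have hm : 0 < min 1 t := lt_min one_pos ht
  apply inv_anti₀ (by positivity)
  rw [norm_eq_abs]
  have h3 : min 1 t * 1 ≤ t := by simp
  have h4 : min 1 t * |x| ≤ 1 * |x| := by gcongr; exact min_le_left _ _
  nlinarith

theorem tendsto_cauchyMajorant {h : ℝ → ℝ} (hh : Integrable h) {t : ℝ} (ht : 0 < t)
    {l : Filter ℝ} [l.IsCountablyGenerated]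
    (hl : Filter.Tendsto (fun x : ℝ => |x|) l Filter.atTop) :
    Filter.Tendsto (cauchyMajorant h t) l (nhds 0) := by
  have : (0 : ℝ) = ∫ s : ℝ, (0 : ℝ) := by simp
  rw [this]
  unfold cauchyMajorant
  refine tendsto_integral_filter_of_dominated_convergence (fun s => |h s| * (1 / t)) ?_ ?_
    (hh.abs.mul_const _) ?_
  · exact Filter.Eventually.of_forall fun x => (integrable_cauchyMajorant hh ht x).1
  · refine Filter.Eventually.of_forall fun x => Filter.Eventually.of_forall fun s => ?_
    rw [norm_mul, norm_norm, norm_eq_abs, abs_abs]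
    gcongr
    exact norm_I_div_sub_le ht (by simp) s
  · refine Filter.Eventually.of_forall fun s => ?_
    rw [← mul_zero |h s|]
    refine Filter.Tendsto.const_mul _ ?_
    have h1 : Filter.Tendsto (fun x : ℝ => |x| - |s|) l Filter.atTop :=
      Filter.tendsto_atTop_add_const_right _ _ hl
    refine squeeze_zero' (Filter.Eventually.of_forall fun x => norm_nonneg _) ?_
      h1.inv_tendsto_atTop
    filter_upwards [h1.eventually_gt_atTop 0] with x hx
    rw [norm_div, Complex.norm_I, one_div]
    apply inv_anti₀ hx
    have := Complex.abs_re_le_norm ((x : ℂ) + t * Complex.I - s)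
    simp at this
    exact (abs_sub_abs_le_abs_sub x s).trans this

theorem continuous_cauchyTransform {h : ℝ → ℝ} (hh : Integrable h) {t : ℝ} (ht : 0 < t) :
    Continuous fun x : ℝ => cauchyTransform h ((x : ℂ) + t * Complex.I) := by
  rw [continuous_iff_continuousAt]
  intro x
  refine ContinuousAt.comp (g := cauchyTransform h) (f := fun x : ℝ => (x : ℂ) + t * Complex.I) ?_
      (by fun_prop)
  exact (differentiableAt_cauchyTransform hh (by simpa using ht)).continuousAt

theorem integrable_cauchyMajorant_rpow {q : ℝ} (hq : 1 < q) {h : ℝ → ℝ} (hm : Measurable h)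
    (hh : Integrable h) {t : ℝ} (ht : 0 < t) :
    Integrable fun x => cauchyMajorant h t x ^ q := by
  have hmeas : Measurable (cauchyMajorant h t) := by
    refine StronglyMeasurable.measurable ?_
    exact (Measurable.stronglyMeasurable (f := fun p : ℝ × ℝ =>
      |h p.2| * ‖Complex.I / ((p.1 : ℂ) + t * Complex.I - p.2)‖)
      (by fun_prop)).integral_prod_right' (ν := volume)
  refine ⟨(hmeas.pow_const q).aestronglyMeasurable, ?_⟩
  rw [hasFiniteIntegral_iff_enorm]
  have e : ∀ x, ‖cauchyMajorant h t x ^ q‖ₑ =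
      (∫⁻ z, ‖h (x - z)‖ₑ * ‖Complex.I / ((z : ℂ) + t * Complex.I)‖ₑ) ^ q := by
    intro x
    rw [Real.enorm_eq_ofReal (Real.rpow_nonneg (cauchyMajorant_nonneg h t x) q),
      ← ENNReal.ofReal_rpow_of_nonneg (cauchyMajorant_nonneg h t x) (by linarith), cauchyMajorant,
      ofReal_integral_eq_lintegral_ofReal (integrable_cauchyMajorant hh ht x)
        (Filter.Eventually.of_forall fun s => by positivity)]
    congr 1
    rw [← lintegral_sub_left_eq_self _ x]
    refine lintegral_congr fun s => ?_
    rw [ENNReal.ofReal_mul (abs_nonneg _), ofReal_norm, ← norm_eq_abs, ofReal_norm]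
    congr 4
    push_cast
    ring
  simp_rw [e]
  refine (lintegral_conv_rpow_le volume hq (k := fun x => ‖h x‖ₑ)
    (h := fun z : ℝ => ‖Complex.I / ((z : ℂ) + t * Complex.I)‖ₑ) (by fun_prop)
        (by fun_prop)).trans_lt ?_
  have q0 : 0 < q := by linarith
  refine ENNReal.mul_lt_top (ENNReal.rpow_lt_top_of_nonneg q0.le hh.2.ne) ?_
  have hint : Integrable fun x : ℝ => ((min 1 t / 2)⁻¹) ^ q * (1 + ‖x‖) ^ (-q) :=
    (integrable_one_add_norm (by simpa using hq)).const_mul _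
  refine lt_of_le_of_lt (lintegral_mono fun x => ?_) hint.lintegral_lt_top
  have hm0 : 0 < min 1 t := lt_min one_pos ht
  rw [← ofReal_norm, ENNReal.ofReal_rpow_of_nonneg (norm_nonneg _) q0.le]
  apply ENNReal.ofReal_le_ofReal
  refine (Real.rpow_le_rpow (norm_nonneg _) (norm_I_div_le t ht x) q0.le).trans_eq ?_
  rw [Real.mul_rpow (by positivity) (by positivity), Real.inv_rpow (by positivity) q,
    Real.rpow_neg (by positivity), Real.inv_rpow (by positivity) q]

theorem abs_div_sq_add_sq_le {t : ℝ} (ht : 0 < t) (x : ℝ) :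
    |t / (x ^ 2 + t ^ 2)| ≤ 1 / t ∧ |x / (x ^ 2 + t ^ 2)| ≤ 1 / t := by
  have h : 0 < x ^ 2 + t ^ 2 := by positivity
  rw [abs_div, abs_div, abs_of_pos h, abs_of_pos ht]
  constructor <;> rw [div_le_div_iff₀ h ht]
  · nlinarith [sq_nonneg x]
  · nlinarith [sq_nonneg (|x| - t), sq_abs x]

theorem integrable_poisson {h : ℝ → ℝ} (hh : Integrable h) {t : ℝ} (ht : 0 < t) (x : ℝ) :
    Integrable (fun s => t / ((x - s) ^ 2 + t ^ 2) * h s) ∧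
    Integrable (fun s => (x - s) / ((x - s) ^ 2 + t ^ 2) * h s) := by
  constructor
  · refine hh.bdd_mul (c := 1 / t) (Measurable.aestronglyMeasurable (by fun_prop)) ?_
    exact Filter.Eventually.of_forall fun s => (abs_div_sq_add_sq_le ht (x - s)).1
  · refine hh.bdd_mul (c := 1 / t) (Measurable.aestronglyMeasurable (by fun_prop)) ?_
    exact Filter.Eventually.of_forall fun s => (abs_div_sq_add_sq_le ht (x - s)).2

theorem cauchyTransform_eq {h : ℝ → ℝ} (hh : Integrable h) {t : ℝ} (ht : 0 < t) (x : ℝ) :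
    cauchyTransform h ((x : ℂ) + t * Complex.I) =
      ((∫ s, t / ((x - s) ^ 2 + t ^ 2) * h s : ℝ) : ℂ) +
        ((∫ s, (x - s) / ((x - s) ^ 2 + t ^ 2) * h s : ℝ) : ℂ) * Complex.I := by
  obtain ⟨h1, h2⟩ := integrable_poisson hh ht x
  rw [← integral_complex_ofReal, ← integral_complex_ofReal, ← integral_mul_const, ← integral_add]
  · refine integral_congr_ae (Filter.Eventually.of_forall fun s => ?_)
    have := I_div_eq (x - s) t ht
    dsimp only
    rw [show (x : ℂ) + t * Complex.I - s = ((x - s : ℝ) : ℂ) + t * Complex.I by push_cast; ring,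
        this]
    push_cast
    ring
  · exact h1.ofReal
  · exact h2.ofReal.mul_const _

theorem integrable_cauchyTransform_cpow {q : ℝ} (hq : 1 < q) {h : ℝ → ℝ} (hm : Measurable h)
    (hh : Integrable h) (hpos : ∀ z : ℂ, 0 < z.im → 0 < (cauchyTransform h z).re)
    {t : ℝ} (ht : 0 < t) :
    Integrable fun x : ℝ => cauchyTransform h ((x : ℂ) + t * Complex.I) ^ (q : ℂ) := by
  refine (integrable_cauchyMajorant_rpow hq hm hh ht).mono' ?_ ?_
  · refine Continuous.aestronglyMeasurable ?_
    exact (continuous_cauchyTransform hh ht).cpow continuous_const fun x =>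
      Or.inl (hpos _ (by simpa using ht))
  · refine Filter.Eventually.of_forall fun x => ?_
    rw [Complex.norm_cpow_real]
    have := norm_cauchyTransform_le hh ht le_rfl x
    gcongr

theorem integral_cauchyTransform_cpow_eq {q : ℝ} (hq : 1 < q) {h : ℝ → ℝ} (hm : Measurable h)
    (hh : Integrable h) (hpos : ∀ z : ℂ, 0 < z.im → 0 < (cauchyTransform h z).re)
    {t₀ t₁ : ℝ} (ht : 0 < t₀) (ht₁ : t₀ ≤ t₁) :
    ∫ x : ℝ, cauchyTransform h ((x : ℂ) + t₀ * Complex.I) ^ (q : ℂ) =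
      ∫ x : ℝ, cauchyTransform h ((x : ℂ) + t₁ * Complex.I) ^ (q : ℂ) := by
  set f : ℂ → ℂ := fun z => cauchyTransform h z ^ (q : ℂ) with hf
  have q0 : 0 < q := by linarith
  have hrect : ∀ R : ℝ, (∫ x : ℝ in (-R)..R, f ((x : ℂ) + t₀ * Complex.I)) -
      (∫ x : ℝ in (-R)..R, f ((x : ℂ) + t₁ * Complex.I)) =
      Complex.I • (∫ y : ℝ in t₀..t₁, f (((-R : ℝ) : ℂ) + y * Complex.I)) -
      Complex.I • (∫ y : ℝ in t₀..t₁, f ((R : ℂ) + y * Complex.I)) := by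
    intro R
    have := Complex.integral_boundary_rect_eq_zero_of_differentiableOn f ⟨-R, t₀⟩ ⟨R, t₁⟩ ?_
    · simp only at this
      linear_combination this
    · intro z hz
      have hz1 : 0 < z.im := by
        have := hz.2
        simp only [Set.mem_preimage, Set.uIcc_of_le ht₁, Set.mem_Icc] at this
        linarith
      exact ((differentiableAt_cauchyTransform hh hz1).cpow_const
        (Or.inl (hpos z hz1))).differentiableWithinAt
  have hside : ∀ l : Filter ℝ, l.IsCountablyGenerated →
      Filter.Tendsto (fun x : ℝ => |x|) l Filter.atTop →
      Filter.Tendsto (fun R : ℝ => Complex.I • ∫ y : ℝ in t₀..t₁, f ((R : ℂ) + y * Complex.I)) l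
        (nhds 0) := by
    intro l hl1 hl
    rw [← smul_zero Complex.I]
    refine Filter.Tendsto.const_smul ?_ _
    have hlim : Filter.Tendsto (fun R => cauchyMajorant h t₀ R ^ q * |t₁ - t₀|) l (nhds 0) := by
      have := ((tendsto_cauchyMajorant hh ht hl).rpow_const (p := q)
        (Or.inr q0.le)).mul_const (|t₁ - t₀|)
      simpa [Real.zero_rpow q0.ne'] using this
    refine squeeze_zero_norm (fun R => ?_) hlim
    refine intervalIntegral.norm_integral_le_of_norm_le_const fun y hy => ?_
    rw [Set.uIoc_of_le ht₁] at hy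
    rw [hf]
    dsimp only
    rw [Complex.norm_cpow_real]
    have := norm_cauchyTransform_le hh ht hy.1.le R
    gcongr
  have hl1 := intervalIntegral_tendsto_integral (integrable_cauchyTransform_cpow hq hm hh hpos ht)
    Filter.tendsto_neg_atTop_atBot Filter.tendsto_id
  have hl2 := intervalIntegral_tendsto_integral
    (integrable_cauchyTransform_cpow hq hm hh hpos (ht.trans_le ht₁))
    Filter.tendsto_neg_atTop_atBot Filter.tendsto_id
  have hr1 := hside Filter.atTop inferInstance Filter.tendsto_abs_atTop_atTop
  have hr2 := (hside Filter.atBot inferInstance Filter.tendsto_abs_atBot_atTop).comp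
    Filter.tendsto_neg_atTop_atBot
  have h1 := hl1.sub hl2
  have h2 := hr2.sub hr1
  rw [sub_zero] at h2
  refine sub_eq_zero.1 (tendsto_nhds_unique h1 (h2.congr fun R => ?_))
  exact (hrect R).symm

theorem integral_cauchyTransform_cpow {q : ℝ} (hq : 1 < q) {h : ℝ → ℝ} (hm : Measurable h)
    (hh : Integrable h) (hpos : ∀ z : ℂ, 0 < z.im → 0 < (cauchyTransform h z).re)
    {t : ℝ} (ht : 0 < t) :
    ∫ x : ℝ, cauchyTransform h ((x : ℂ) + t * Complex.I) ^ (q : ℂ) = 0 := by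
  have q0 : 0 < q := by linarith
  have hlim : Filter.Tendsto
      (fun y : ℝ => ∫ x : ℝ, cauchyTransform h ((x : ℂ) + y * Complex.I) ^ (q : ℂ))
      Filter.atTop (nhds 0) := by
    rw [show (0 : ℂ) = ∫ x : ℝ, (0 : ℂ) by simp]
    refine tendsto_integral_filter_of_dominated_convergence (fun x => cauchyMajorant h t x ^ q)
      ?_ ?_ (integrable_cauchyMajorant_rpow hq hm hh ht) ?_
    · filter_upwards [Filter.eventually_gt_atTop 0] with y hy
      exact (integrable_cauchyTransform_cpow hq hm hh hpos hy).1
    · filter_upwards [Filter.eventually_ge_atTop t] with y hy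
      refine Filter.Eventually.of_forall fun x => ?_
      rw [Complex.norm_cpow_real]
      have := norm_cauchyTransform_le hh ht hy x
      gcongr
    · refine Filter.Eventually.of_forall fun x => ?_
      rw [tendsto_zero_iff_norm_tendsto_zero]
      have h0 : Filter.Tendsto (fun y : ℝ => ((∫ s, |h s|) * (1 / y)) ^ q) Filter.atTop
          (nhds 0) := by
        have := ((tendsto_inv_atTop_zero (𝕜 := ℝ)).const_mul (∫ s, |h s|)).rpow_const (p := q)
          (Or.inr q0.le)
        simpa [Real.zero_rpow q0.ne'] using this
      refine squeeze_zero' (Filter.Eventually.of_forall fun x => norm_nonneg _) ?_ h0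
      filter_upwards [Filter.eventually_gt_atTop 0] with y hy
      rw [Complex.norm_cpow_real]
      have := norm_cauchyTransform_le_div hh hy x
      gcongr
  refine tendsto_nhds_unique (tendsto_const_nhds.congr' ?_) hlim
  filter_upwards [Filter.eventually_ge_atTop t] with y hy
  exact integral_cauchyTransform_cpow_eq hq hm hh hpos ht hy

theorem integral_poisson {t : ℝ} (ht : 0 < t) : ∫ x : ℝ, t / (x ^ 2 + t ^ 2) = π := by
  have h1 : ∀ x : ℝ, t / (x ^ 2 + t ^ 2) = t⁻¹ * (fun y : ℝ => (1 + y ^ 2)⁻¹) (x / t) := by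
    intro x
    have : x ^ 2 + t ^ 2 ≠ 0 := by positivity
    have h3 : 1 + (x / t) ^ 2 ≠ 0 := by positivity
    dsimp only
    field_simp
    ring
  simp_rw [h1]
  rw [integral_const_mul, Measure.integral_comp_div (fun y : ℝ => (1 + y ^ 2)⁻¹) t,
    integral_univ_inv_one_add_sq, abs_of_pos ht, smul_eq_mul]
  field_simp

theorem lintegral_poisson {t : ℝ} (ht : 0 < t) :
    ∫⁻ x : ℝ, ENNReal.ofReal (t / (x ^ 2 + t ^ 2)) = ENNReal.ofReal π := by
  rw [← integral_poisson ht, ofReal_integral_eq_lintegral_ofReal]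
  · by_contra hc
    have := integral_poisson ht
    rw [integral_undef hc] at this
    exact pi_pos.ne this
  · exact Filter.Eventually.of_forall fun x => by positivity

theorem lintegral_poisson_rpow_le {q : ℝ} (hq : 1 < q) {h : ℝ → ℝ} (hm : Measurable h)
    (hh : Integrable h) (h0 : ∀ s, 0 ≤ h s) {t : ℝ} (ht : 0 < t) :
    ∫⁻ x : ℝ, ENNReal.ofReal ((∫ s, t / ((x - s) ^ 2 + t ^ 2) * h s) ^ q) ≤
      ENNReal.ofReal π ^ q * ∫⁻ s, ‖h s‖ₑ ^ q := by
  have q0 : 0 < q := by linarith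
  refine le_of_eq_of_le ?_ ((lintegral_conv_rpow_le volume hq
    (k := fun x => ENNReal.ofReal (t / (x ^ 2 + t ^ 2))) (h := fun s => ‖h s‖ₑ)
    (by fun_prop) (by fun_prop)).trans_eq ?_)
  · refine lintegral_congr fun x => ?_
    have hn : ∀ s, 0 ≤ t / ((x - s) ^ 2 + t ^ 2) * h s := fun s => mul_nonneg (by positivity) (h0 s)
    rw [← ENNReal.ofReal_rpow_of_nonneg (integral_nonneg hn) q0.le,
      ofReal_integral_eq_lintegral_ofReal (integrable_poisson hh ht x).1
      (Filter.Eventually.of_forall hn)]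
    congr 1
    refine lintegral_congr fun s => ?_
    rw [ENNReal.ofReal_mul (by positivity), Real.enorm_eq_ofReal (h0 s)]
  · rw [lintegral_poisson ht]

theorem exists_hilbert_bound_of_nonneg {q : ℝ} (hq : 1 < q) (hq2 : q ≤ 2) :
    ∃ C : ENNReal, C ≠ ⊤ ∧ ∀ t : ℝ, 0 < t → ∀ h : ℝ → ℝ, Measurable h → Integrable h →
      (∀ s, 0 ≤ h s) →
      ∫⁻ x : ℝ, ‖∫ s, (x - s) / ((x - s) ^ 2 + t ^ 2) * h s‖ₑ ^ q ≤ C * ∫⁻ s, ‖h s‖ₑ ^ q := by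
  obtain ⟨A, B, hA, hB, hAB⟩ := exists_abs_im_rpow_le hq hq2
  have q0 : 0 < q := by linarith
  refine ⟨ENNReal.ofReal A * ENNReal.ofReal π ^ q,
    ENNReal.mul_ne_top ENNReal.ofReal_ne_top (ENNReal.rpow_ne_top_of_nonneg q0.le
      ENNReal.ofReal_ne_top), fun t ht h hm hh h0 => ?_⟩
  by_cases hz : h =ᵐ[volume] 0
  · have : ∀ x : ℝ, ∫ s, (x - s) / ((x - s) ^ 2 + t ^ 2) * h s = 0 := by
      intro x
      refine integral_eq_zero_of_ae ?_
      filter_upwards [hz] with s hs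
      simp [hs]
    simp [this, q0]
  have hpos : ∀ z : ℂ, 0 < z.im → 0 < (cauchyTransform h z).re := by
    intro z hz'
    have e : z = (z.re : ℂ) + z.im * Complex.I := (Complex.re_add_im z).symm
    rw [e, cauchyTransform_eq hh hz']
    simp only [Complex.add_re, Complex.ofReal_re, Complex.mul_re, Complex.I_re, mul_zero,
      Complex.ofReal_im, Complex.I_im, mul_one, sub_self, add_zero]
    rw [integral_pos_iff_support_of_nonneg (fun s => mul_nonneg (by positivity) (h0 s))
      (integrable_poisson hh hz' z.re).1]
    have hs : (Function.support fun s => z.im / ((z.re - s) ^ 2 + z.im ^ 2) * h s) =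
        Function.support h := by
      ext s
      have : z.im / ((z.re - s) ^ 2 + z.im ^ 2) ≠ 0 := by positivity
      simp only [Function.mem_support, ne_eq, mul_eq_zero, this, false_or]
    rw [hs, pos_iff_ne_zero]
    intro h1
    apply hz
    exact (ae_iff (p := fun s => h s = 0)).2 h1
  set U : ℝ → ℝ := fun x => ∫ s, t / ((x - s) ^ 2 + t ^ 2) * h s with hU
  set V : ℝ → ℝ := fun x => ∫ s, (x - s) / ((x - s) ^ 2 + t ^ 2) * h s with hV
  set F : ℝ → ℂ := fun x => cauchyTransform h ((x : ℂ) + t * Complex.I) with hF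
  have hFU : ∀ x, (F x).re = U x := fun x => by
    rw [hF]; dsimp only; rw [cauchyTransform_eq hh ht]; simp [hU]
  have hFV : ∀ x, (F x).im = V x := fun x => by
    rw [hF]; dsimp only; rw [cauchyTransform_eq hh ht]; simp [hV]
  have hU0 : ∀ x, 0 < U x := fun x => by
    rw [← hFU]; exact hpos _ (by simpa using ht)
  have hFint := integrable_cauchyTransform_cpow hq hm hh hpos ht
  have hUint : Integrable fun x => U x ^ q := by
    refine (integrable_cauchyMajorant_rpow hq hm hh ht).mono' ?_ ?_
    · have : Continuous U := by
        have h1 : U = fun x => (F x).re := funext fun x => (hFU x).symm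
        rw [h1]
        exact Complex.continuous_re.comp (continuous_cauchyTransform hh ht)
      exact (this.measurable.pow_const q).aestronglyMeasurable
    · refine Filter.Eventually.of_forall fun x => ?_
      rw [norm_of_nonneg (Real.rpow_nonneg (hU0 x).le q)]
      refine Real.rpow_le_rpow (hU0 x).le ?_ q0.le
      rw [← hFU]
      exact (Complex.re_le_norm _).trans (norm_cauchyTransform_le hh ht le_rfl x)
  have hre : Integrable fun x => ((F x) ^ (q : ℂ)).re := hFint.re
  have hre0 : ∫ x, ((F x) ^ (q : ℂ)).re = 0 := by
    have := integral_re hFint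
    simp only [RCLike.re_eq_complex_re] at this
    rw [hF, this, integral_cauchyTransform_cpow hq hm hh hpos ht]
    simp
  have hpt : ∀ x, |V x| ^ q ≤ A * U x ^ q - B * ((F x) ^ (q : ℂ)).re := fun x => by
    have := hAB (F x) (by rw [hFU]; exact (hU0 x).le)
    rwa [hFU, hFV] at this
  calc ∫⁻ x : ℝ, ‖V x‖ₑ ^ q
      ≤ ∫⁻ x : ℝ, ENNReal.ofReal (A * U x ^ q - B * ((F x) ^ (q : ℂ)).re) := by
        refine lintegral_mono fun x => ?_
        rw [← ofReal_norm, norm_eq_abs, ENNReal.ofReal_rpow_of_nonneg (abs_nonneg _) q0.le]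
        exact ENNReal.ofReal_le_ofReal (hpt x)
    _ = ENNReal.ofReal (∫ x, (A * U x ^ q - B * ((F x) ^ (q : ℂ)).re)) := by
        rw [ofReal_integral_eq_lintegral_ofReal]
        · exact (hUint.const_mul _).sub (hre.const_mul _)
        · exact Filter.Eventually.of_forall fun x =>
            (Real.rpow_nonneg (abs_nonneg _) _).trans (hpt x)
    _ = ENNReal.ofReal A * ∫⁻ x, ENNReal.ofReal (U x ^ q) := by
        rw [integral_sub (hUint.const_mul _) (hre.const_mul _), integral_const_mul,
          integral_const_mul, hre0, mul_zero, sub_zero, ENNReal.ofReal_mul hA,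
          ofReal_integral_eq_lintegral_ofReal hUint
          (Filter.Eventually.of_forall fun x => Real.rpow_nonneg (hU0 x).le q)]
    _ ≤ ENNReal.ofReal A * (ENNReal.ofReal π ^ q * ∫⁻ s, ‖h s‖ₑ ^ q) := by
        gcongr
        exact lintegral_poisson_rpow_le hq hm hh h0 ht
    _ = _ := by rw [mul_assoc]

/-- The truncated Hilbert transform `h ↦ ∫ (x - s) / ((x - s)² + t²) h(s) ds`. -/
noncomputable def conjPoisson (t : ℝ) (h : ℝ → ℂ) (x : ℝ) : ℂ :=
  ∫ s, (((x - s) / ((x - s) ^ 2 + t ^ 2) : ℝ) : ℂ) * h s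

theorem integrable_conjPoisson {h : ℝ → ℂ} (hh : Integrable h) {t : ℝ} (ht : 0 < t) (x : ℝ) :
    Integrable fun s => (((x - s) / ((x - s) ^ 2 + t ^ 2) : ℝ) : ℂ) * h s := by
  refine hh.bdd_mul (c := 1 / t) (Measurable.aestronglyMeasurable (by fun_prop)) ?_
  refine Filter.Eventually.of_forall fun s => ?_
  rw [Complex.norm_real]
  exact (abs_div_sq_add_sq_le ht (x - s)).2

theorem exists_conjPoisson_bound_of_le_two {q : ℝ} (hq : 1 < q) (hq2 : q ≤ 2) :
    ∃ C : ENNReal, C ≠ ⊤ ∧ ∀ t : ℝ, 0 < t → ∀ h : ℝ → ℂ, Measurable h → Integrable h →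
      ∫⁻ x : ℝ, ‖conjPoisson t h x‖ₑ ^ q ≤ C * ∫⁻ s, ‖h s‖ₑ ^ q := by
  obtain ⟨C, hC, hb⟩ := exists_hilbert_bound_of_nonneg hq hq2
  have q0 : 0 < q := by linarith
  have two : (2 : ENNReal) ^ (q - 1) ≠ ⊤ := ENNReal.rpow_ne_top_of_nonneg (by linarith) (by simp)
  refine ⟨(2 ^ (q - 1) * 2 ^ (q - 1)) * (4 * C), by finiteness, fun t ht h hm hh => ?_⟩
  set a : Fin 4 → ℝ → ℝ := ![fun s => max (h s).re 0, fun s => max (-(h s).re) 0,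
    fun s => max (h s).im 0, fun s => max (-(h s).im) 0] with ha
  set W : Fin 4 → ℝ → ℝ := fun i x => ∫ s, (x - s) / ((x - s) ^ 2 + t ^ 2) * a i s with hW
  have am : ∀ i, Measurable (a i) := by
    intro i; fin_cases i <;> simp [ha] <;> fun_prop
  have a0 : ∀ i s, 0 ≤ a i s := by
    intro i s; fin_cases i <;> simp [ha]
  have ale : ∀ i s, a i s ≤ ‖h s‖ := by
    intro i s
    have h1 := Complex.abs_re_le_norm (h s)
    have h2 := Complex.abs_im_le_norm (h s)
    rw [abs_le] at h1 h2
    fin_cases i <;> simp [ha] <;> linarith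
  have aint : ∀ i, Integrable (a i) := fun i =>
    hh.norm.mono' (am i).aestronglyMeasurable (Filter.Eventually.of_forall fun s => by
      rw [norm_of_nonneg (a0 i s)]; exact ale i s)
  have key : ∀ i, ∫⁻ x, ‖W i x‖ₑ ^ q ≤ C * ∫⁻ s, ‖h s‖ₑ ^ q := by
    intro i
    refine (hb t ht (a i) (am i) (aint i) (a0 i)).trans ?_
    gcongr with s
    rw [Real.enorm_eq_ofReal (a0 i s), ← ofReal_norm]
    exact ENNReal.ofReal_le_ofReal (ale i s)
  have hdec : ∀ x, conjPoisson t h x =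
      ((W 0 x : ℂ) - W 1 x) + (Complex.I * W 2 x - Complex.I * W 3 x) := by
    intro x
    have hi := fun i => (integrable_poisson (aint i) ht x).2.ofReal (𝕜 := ℂ)
    simp only [RCLike.ofReal_eq_complex_ofReal] at hi
    simp only [hW]
    have g1 : Integrable fun s => (((x - s) / ((x - s) ^ 2 + t ^ 2) * a 0 s : ℝ) : ℂ) -
        (((x - s) / ((x - s) ^ 2 + t ^ 2) * a 1 s : ℝ) : ℂ) := (hi 0).sub (hi 1)
    have g2 : Integrable fun s => Complex.I * (((x - s) / ((x - s) ^ 2 + t ^ 2) * a 2 s : ℝ) : ℂ) -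
        Complex.I * (((x - s) / ((x - s) ^ 2 + t ^ 2) * a 3 s : ℝ) : ℂ) :=
      ((hi 2).const_mul _).sub ((hi 3).const_mul _)
    rw [← integral_complex_ofReal, ← integral_complex_ofReal, ← integral_complex_ofReal,
      ← integral_complex_ofReal, ← integral_const_mul, ← integral_const_mul,
      ← integral_sub (hi 0) (hi 1), ← integral_sub ((hi 2).const_mul _) ((hi 3).const_mul _),
      ← integral_add g1 g2]
    refine integral_congr_ae (Filter.Eventually.of_forall fun s => ?_)
    dsimp only
    have h1 : h s = ((a 0 s : ℂ) - a 1 s) + (Complex.I * a 2 s - Complex.I * a 3 s) := by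
      have m : ∀ r : ℝ, max r 0 - max (-r) 0 = r := by
        intro r; rcases le_total r 0 with h | h <;> simp [h]
      apply Complex.ext
      · simp [ha, m]
      · simp [ha, m]
    conv_lhs => rw [h1]
    push_cast
    ring
  have hWm : ∀ i, Measurable (W i) := by
    intro i
    refine StronglyMeasurable.measurable ?_
    have := am i
    exact (Measurable.stronglyMeasurable (f := fun p : ℝ × ℝ =>
      (p.1 - p.2) / ((p.1 - p.2) ^ 2 + t ^ 2) * a i p.2) (by fun_prop)).integral_prod_right'
      (ν := volume)
  have hpt : ∀ x, ‖conjPoisson t h x‖ₑ ^ q ≤ (2 ^ (q - 1) * 2 ^ (q - 1)) *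
      (‖W 0 x‖ₑ ^ q + ‖W 1 x‖ₑ ^ q + (‖W 2 x‖ₑ ^ q + ‖W 3 x‖ₑ ^ q)) := by
    intro x
    rw [hdec]
    have h1 : ‖((W 0 x : ℂ) - W 1 x) + (Complex.I * W 2 x - Complex.I * W 3 x)‖ₑ ≤
        (‖W 0 x‖ₑ + ‖W 1 x‖ₑ) + (‖W 2 x‖ₑ + ‖W 3 x‖ₑ) := by
      refine (enorm_add_le _ _).trans (add_le_add ((enorm_sub_le).trans_eq ?_)
        ((enorm_sub_le).trans_eq ?_))
      · simp [← ofReal_norm]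
      · simp [← ofReal_norm]
    refine (ENNReal.rpow_le_rpow h1 q0.le).trans ?_
    refine (ENNReal.rpow_add_le_mul_rpow_add_rpow _ _ hq.le).trans ?_
    rw [mul_assoc, mul_add (2 ^ (q - 1)) (‖W 0 x‖ₑ ^ q + _)]
    exact mul_le_mul_right (add_le_add (ENNReal.rpow_add_le_mul_rpow_add_rpow _ _ hq.le)
      (ENNReal.rpow_add_le_mul_rpow_add_rpow _ _ hq.le)) _
  refine (lintegral_mono hpt).trans ?_
  rw [lintegral_const_mul _ (by fun_prop), lintegral_add_left (by fun_prop),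
    lintegral_add_left (by fun_prop), lintegral_add_left (by fun_prop)]
  rw [mul_assoc (_ * _)]
  gcongr
  exact (add_le_add (add_le_add (key 0) (key 1)) (add_le_add (key 2) (key 3))).trans_eq (by ring)

theorem measurable_conjPoisson {h : ℝ → ℂ} (hm : Measurable h) (t : ℝ) :
    Measurable (conjPoisson t h) := by
  refine StronglyMeasurable.measurable ?_
  exact (Measurable.stronglyMeasurable (f := fun p : ℝ × ℝ =>
      (((p.1 - p.2) / ((p.1 - p.2) ^ 2 + t ^ 2) : ℝ) : ℂ) * h p.2)
          (by fun_prop)).integral_prod_right'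
      (ν := volume)

theorem norm_conjPoisson_le {h : ℝ → ℂ} (hh : Integrable h) {t : ℝ} (ht : 0 < t) (x : ℝ) :
    ‖conjPoisson t h x‖ ≤ cauchyMajorant (fun s => ‖h s‖) t x := by
  refine (norm_integral_le_integral_norm _).trans ?_
  refine integral_mono (integrable_conjPoisson hh ht x).norm
    (integrable_cauchyMajorant hh.norm ht x) fun s => ?_
  dsimp only
  rw [norm_mul, mul_comm, abs_norm]
  gcongr
  rw [show (x : ℂ) + t * Complex.I - s = ((x - s : ℝ) : ℂ) + t * Complex.I by push_cast; ring,
    I_div_eq _ t ht, Complex.norm_real, norm_eq_abs]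
  refine le_trans (le_of_eq ?_) (Complex.abs_im_le_norm _)
  rw [Complex.add_im, Complex.im_ofReal_mul, Complex.ofReal_im, Complex.I_im, mul_one, zero_add]

theorem lintegral_conjPoisson_rpow_lt_top {q : ℝ} (hq : 1 < q) {h : ℝ → ℂ} (hm : Measurable h)
    (hh : Integrable h) {t : ℝ} (ht : 0 < t) : ∫⁻ x, ‖conjPoisson t h x‖ₑ ^ q < ⊤ := by
  refine lt_of_le_of_lt (lintegral_mono fun x => ?_)
    (integrable_cauchyMajorant_rpow hq hm.norm hh.norm ht).lintegral_lt_top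
  have q0 : 0 < q := by linarith
  rw [← ofReal_norm, ENNReal.ofReal_rpow_of_nonneg (norm_nonneg _) q0.le]
  apply ENNReal.ofReal_le_ofReal
  have := norm_conjPoisson_le hh ht x
  gcongr

theorem exists_conjPoisson_bound {q : ℝ} (hq : 1 < q) :
    ∃ C : ENNReal, C ≠ ⊤ ∧ ∀ t : ℝ, 0 < t → ∀ h : ℝ → ℂ, Measurable h → Integrable h →
      ∫⁻ x : ℝ, ‖conjPoisson t h x‖ₑ ^ q ≤ C * ∫⁻ s, ‖h s‖ₑ ^ q := by
  rcases le_total q 2 with hq2 | hq2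
  · exact exists_conjPoisson_bound_of_le_two hq hq2
  rcases hq2.eq_or_lt with rfl | hq2
  · exact exists_conjPoisson_bound_of_le_two hq le_rfl
  have q0 : 0 < q := by linarith
  set p := q / (q - 1) with hp
  have hpq : q.HolderConjugate p := Real.HolderConjugate.conjExponent hq
  have hp1 : 1 < p := hpq.symm.lt
  have p0 : 0 < p := by linarith
  have hp2 : p ≤ 2 := by rw [hp, div_le_iff₀ (by linarith)]; linarith
  have hqp : (q - 1) * p = q := by rw [hp]; field_simp [show q - 1 ≠ 0 by linarith]
  obtain ⟨C, hC, hb⟩ := exists_conjPoisson_bound_of_le_two hp1 hp2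
  refine ⟨C ^ (q - 1), ENNReal.rpow_ne_top_of_nonneg (by linarith) hC, fun t ht h hm hh => ?_⟩
  set u := conjPoisson t h with hu
  have um : Measurable u := measurable_conjPoisson hm t
  set S := ∫⁻ x, ‖u x‖ₑ ^ q with hS
  have hSt : S ≠ ⊤ := (lintegral_conjPoisson_rpow_lt_top hq hm hh ht).ne
  rcases eq_or_ne S 0 with hS0 | hS0
  · rw [hS0]; exact zero_le
  set g : ℝ → ℂ := fun x => ((‖u x‖ ^ (q - 2) : ℝ) : ℂ) * (starRingEnd ℂ) (u x) with hg
  have gm : Measurable g := by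
    have : Measurable fun x => ‖u x‖ ^ (q - 2) := um.norm.pow_const _
    exact (Complex.measurable_ofReal.comp this).mul
      (Complex.continuous_conj.measurable.comp um)
  have hgn : ∀ x, ‖g x‖ = ‖u x‖ ^ (q - 1) := by
    intro x
    simp only [hg, norm_mul, Complex.norm_real, RCLike.norm_conj,
      norm_of_nonneg (Real.rpow_nonneg (norm_nonneg (u x)) (q - 2))]
    rcases eq_or_ne ‖u x‖ 0 with h0 | h0
    · rw [h0, mul_zero, Real.zero_rpow (by linarith)]
    · rw [← Real.rpow_add_one h0]; ring_nf
  have hgne : ∀ x, ‖g x‖ₑ = ‖u x‖ₑ ^ (q - 1) := by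
    intro x
    rw [← ofReal_norm, hgn, ← ofReal_norm, ENNReal.ofReal_rpow_of_nonneg (norm_nonneg _)
        (by linarith)]
  have gint : Integrable g := by
    refine ⟨gm.aestronglyMeasurable, ?_⟩
    rw [hasFiniteIntegral_iff_enorm]
    simp_rw [hgne]
    exact lintegral_conjPoisson_rpow_lt_top (by linarith) hm hh ht
  have hug : ∀ x, u x * g x = ((‖u x‖ ^ q : ℝ) : ℂ) := by
    intro x
    have h1 : u x * g x = ((‖u x‖ ^ (q - 2) : ℝ) : ℂ) * (u x * (starRingEnd ℂ) (u x)) := by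
      simp only [hg]; ring
    rw [h1, Complex.mul_conj, ← Complex.ofReal_mul, Complex.normSq_eq_norm_sq]
    congr 1
    rcases eq_or_ne ‖u x‖ 0 with h0 | h0
    · rw [h0, Real.zero_rpow (by linarith), Real.zero_rpow q0.ne']; simp
    · rw [← Real.rpow_natCast, ← Real.rpow_add (lt_of_le_of_ne (norm_nonneg _) h0.symm)]
      norm_num
  have hswap : ∫ x, u x * g x = - ∫ s, h s * conjPoisson t g s := by
    have h1 : ∀ x, u x * g x =
        ∫ s, (((x - s) / ((x - s) ^ 2 + t ^ 2) : ℝ) : ℂ) * h s * g x := fun x => by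
      rw [hu, conjPoisson, integral_mul_const]
    simp_rw [h1]
    rw [integral_integral_swap, ← integral_neg]
    · refine integral_congr_ae (Filter.Eventually.of_forall fun s => ?_)
      dsimp only
      rw [conjPoisson, ← integral_const_mul, ← integral_neg]
      refine integral_congr_ae (Filter.Eventually.of_forall fun x => ?_)
      dsimp only
      rw [show (s - x) / ((s - x) ^ 2 + t ^ 2) = -((x - s) / ((x - s) ^ 2 + t ^ 2)) by
        rw [← neg_sub x s, neg_sq, neg_div]]
      push_cast
      ring
    · have hi : Integrable (fun z : ℝ × ℝ => g z.1 * h z.2) (volume.prod volume) :=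
        gint.mul_prod hh
      have := hi.bdd_mul (c := 1 / t) (f := fun z : ℝ × ℝ =>
        (((z.1 - z.2) / ((z.1 - z.2) ^ 2 + t ^ 2) : ℝ) : ℂ))
        (Measurable.aestronglyMeasurable (by fun_prop))
        (Filter.Eventually.of_forall fun z => by
          rw [Complex.norm_real]; exact (abs_div_sq_add_sq_le ht (z.1 - z.2)).2)
      refine this.congr (Filter.Eventually.of_forall fun z => ?_)
      simp only [Function.uncurry]
      ring
  have hSle : S ≤ ∫⁻ s, ‖h s‖ₑ * ‖conjPoisson t g s‖ₑ := by
    have h1 : S = ‖∫ x, u x * g x‖ₑ := by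
      simp_rw [hug]
      rw [integral_complex_ofReal, ← ofReal_norm, Complex.norm_real, norm_of_nonneg
        (integral_nonneg fun x => by positivity), ofReal_integral_eq_lintegral_ofReal]
      · refine lintegral_congr fun x => ?_
        rw [← ofReal_norm, ENNReal.ofReal_rpow_of_nonneg (norm_nonneg _) q0.le]
      · refine ⟨(um.norm.pow_const q).aestronglyMeasurable, ?_⟩
        rw [hasFiniteIntegral_iff_enorm]
        refine lt_of_le_of_lt (lintegral_mono fun x => ?_) (lt_top_iff_ne_top.2 hSt)
        rw [Real.enorm_eq_ofReal (by positivity), ← ofReal_norm,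
          ENNReal.ofReal_rpow_of_nonneg (norm_nonneg _) q0.le]
      · exact Filter.Eventually.of_forall fun x => by positivity
    rw [h1, hswap, enorm_neg]
    refine (enorm_integral_le_lintegral_enorm _).trans_eq ?_
    simp_rw [enorm_mul]
  have hH := ENNReal.lintegral_mul_le_Lp_mul_Lq volume hpq (f := fun s => ‖h s‖ₑ)
    (g := fun s => ‖conjPoisson t g s‖ₑ) hm.enorm.aemeasurable
    (measurable_conjPoisson gm t).enorm.aemeasurable
  have hQg : ∫⁻ s, ‖conjPoisson t g s‖ₑ ^ p ≤ C * S := by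
    refine (hb t ht g gm gint).trans_eq ?_
    simp_rw [hgne, ← ENNReal.rpow_mul, hqp]
    rfl
  set H := ∫⁻ s, ‖h s‖ₑ ^ q with hHdef
  have h2 : S ≤ H ^ (1 / q) * (C * S) ^ (1 / p) := by
    refine hSle.trans (hH.trans ?_)
    gcongr
  have h3 : S ^ q ≤ H * (C * S) ^ (q - 1) := by
    refine (ENNReal.rpow_le_rpow h2 q0.le).trans_eq ?_
    rw [ENNReal.mul_rpow_of_nonneg _ _ q0.le, ← ENNReal.rpow_mul, ← ENNReal.rpow_mul,
      one_div_mul_cancel q0.ne', ENNReal.rpow_one]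
    congr 2
    rw [hp]; field_simp
  have h4 : S * S ^ (q - 1) ≤ (C ^ (q - 1) * H) * S ^ (q - 1) := by
    calc S * S ^ (q - 1) = S ^ q := by
          conv_lhs => rw [← ENNReal.rpow_one S, ← ENNReal.rpow_mul, one_mul]
          rw [← ENNReal.rpow_add _ _ hS0 hSt]; ring_nf
      _ ≤ H * (C * S) ^ (q - 1) := h3
      _ = _ := by rw [ENNReal.mul_rpow_of_nonneg _ _ (by linarith)]; ring
  have h5 : S ^ (q - 1) ≠ 0 := by simp [ENNReal.rpow_eq_zero_iff, hS0, hSt]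
  have h6 : S ^ (q - 1) ≠ ⊤ := ENNReal.rpow_ne_top_of_nonneg (by linarith) hSt
  exact (ENNReal.mul_le_mul_iff_left h5 h6).1 h4

/-- A finite difference of order `n` is controlled by the `n`-th derivative. -/
theorem norm_fwdDiff_iter_le {n : ℕ} {F : ℕ → ℝ → ℂ} {a h B : ℝ} (hh : 0 ≤ h)
    (hF : ∀ i < n, ∀ s ∈ Set.Icc a (a + n * h), HasDerivAt (F i) (F (i + 1) s) s)
    (hB : ∀ s ∈ Set.Icc a (a + n * h), ‖F n s‖ ≤ B) :
    ‖(fwdDiff h)^[n] (F 0) a‖ ≤ h ^ n * B := by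
  induction n generalizing F B with
  | zero => simpa using hB a (by simp)
  | succ n ih =>
    rw [Function.iterate_succ_apply, pow_succ, mul_assoc]
    push_cast at hF hB
    refine ih (F := fun i => fwdDiff h (F i)) (fun i hi s hs => ?_) (fun s hs => ?_)
    · have h1 := hF i (by omega) s ⟨hs.1, by nlinarith [hs.2]⟩
      have h2 := hF i (by omega) (s + h) ⟨by linarith [hs.1], by nlinarith [hs.2]⟩
      exact (h2.comp_add_const s h).sub h1
    · have hsub : ∀ x ∈ Set.Icc s (s + h), x ∈ Set.Icc a (a + (n + 1) * h) := fun x hx =>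
        ⟨hs.1.trans hx.1, by nlinarith [hs.2, hx.2]⟩
      have := Convex.norm_image_sub_le_of_norm_hasDerivWithin_le (f := F n) (f' := F (n + 1))
        (s := Set.Icc s (s + h)) (C := B) (x := s) (y := s + h)
        (fun x hx => (hF n (by omega) x (hsub x hx)).hasDerivWithinAt)
        (fun x hx => hB x (hsub x hx)) (convex_Icc _ _) (by simp [hh]) (by simp [hh])
      rw [add_sub_cancel_left, norm_of_nonneg hh] at this
      rw [fwdDiff, mul_comm h]
      exact this

/-- The (unnormalised) inverse Fourier transform `x ↦ ∫ exp(i x·ξ) g(ξ) dξ`. -/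
noncomputable def invFourier {d : ℕ} (g : EuclideanSpace ℝ (Fin d) → ℂ)
    (x : EuclideanSpace ℝ (Fin d)) : ℂ :=
  ∫ ξ, Complex.exp (Complex.I * (⟪x, ξ⟫ : ℂ)) * g ξ

section
variable {d : ℕ}

theorem norm_exp_I_inner (x ξ : EuclideanSpace ℝ (Fin d)) :
    ‖Complex.exp (Complex.I * (⟪x, ξ⟫ : ℂ))‖ = 1 := by
  rw [mul_comm]; exact Complex.norm_exp_ofReal_mul_I _

theorem integrable_exp_mul {g : EuclideanSpace ℝ (Fin d) → ℂ} (hg : Integrable g)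
    (x : EuclideanSpace ℝ (Fin d)) :
    Integrable fun ξ => Complex.exp (Complex.I * (⟪x, ξ⟫ : ℂ)) * g ξ :=
  hg.bdd_mul (c := 1) (Continuous.aestronglyMeasurable (by fun_prop))
    (Filter.Eventually.of_forall fun ξ => (norm_exp_I_inner x ξ).le)

theorem norm_invFourier_le (g : EuclideanSpace ℝ (Fin d) → ℂ) (x : EuclideanSpace ℝ (Fin d)) :
    ‖invFourier g x‖ ≤ ∫ ξ, ‖g ξ‖ := by
  refine (norm_integral_le_integral_norm _).trans_eq ?_
  simp_rw [norm_mul, norm_exp_I_inner, one_mul]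

theorem integrable_fwdDiff {g : EuclideanSpace ℝ (Fin d) → ℂ} (hg : Integrable g)
    (v : EuclideanSpace ℝ (Fin d)) : Integrable (fwdDiff v g) :=
  (hg.comp_add_right v).sub hg

theorem integrable_fwdDiff_iter {g : EuclideanSpace ℝ (Fin d) → ℂ} (hg : Integrable g)
    (v : EuclideanSpace ℝ (Fin d)) (n : ℕ) : Integrable ((fwdDiff v)^[n] g) := by
  induction n with
  | zero => exact hg
  | succ n ih => rw [Function.iterate_succ_apply']; exact integrable_fwdDiff ih v

theorem invFourier_fwdDiff {g : EuclideanSpace ℝ (Fin d) → ℂ} (hg : Integrable g)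
    (v x : EuclideanSpace ℝ (Fin d)) :
    invFourier (fwdDiff v g) x =
      (Complex.exp (-(Complex.I * (⟪x, v⟫ : ℂ))) - 1) * invFourier g x := by
  have h1 : ∀ ξ, Complex.exp (Complex.I * (⟪x, ξ⟫ : ℂ)) * g (ξ + v) =
      Complex.exp (-(Complex.I * (⟪x, v⟫ : ℂ))) *
        (fun η => Complex.exp (Complex.I * (⟪x, η⟫ : ℂ)) * g η) (ξ + v) := by
    intro ξ
    dsimp only
    rw [← mul_assoc, ← Complex.exp_add, inner_add_right]
    congr 2
    push_cast
    ring
  simp only [invFourier, fwdDiff, mul_sub]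
  rw [integral_sub (integrable_exp_mul (hg.comp_add_right v) x) (integrable_exp_mul hg x)]
  simp_rw [h1]
  rw [integral_const_mul,
    integral_add_right_eq_self (fun η => Complex.exp (Complex.I * (⟪x, η⟫ : ℂ)) * g η) v]
  ring

theorem two_pow_mul_norm_invFourier_le {g : EuclideanSpace ℝ (Fin d) → ℂ} (hg : Integrable g)
    {v x : EuclideanSpace ℝ (Fin d)} (hv : |⟪x, v⟫| = π) (n : ℕ) :
    2 ^ n * ‖invFourier g x‖ ≤ ∫ ξ, ‖(fwdDiff v)^[n] g ξ‖ := by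
  have hc : Complex.exp (-(Complex.I * (⟪x, v⟫ : ℂ))) - 1 = -2 := by
    rcases eq_or_eq_neg_of_abs_eq hv with h | h
    · rw [h, Complex.exp_neg, mul_comm, Complex.exp_pi_mul_I]; norm_num
    · rw [h]; push_cast
      rw [mul_neg, neg_neg, mul_comm, Complex.exp_pi_mul_I]; norm_num
  have h1 : ∀ n : ℕ, invFourier ((fwdDiff v)^[n] g) x = (-2) ^ n * invFourier g x := by
    intro n
    induction n with
    | zero => simp
    | succ n ih =>
      rw [Function.iterate_succ_apply', invFourier_fwdDiff (integrable_fwdDiff_iter hg v n), ih, hc]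
      ring
  have h2 := norm_invFourier_le ((fwdDiff v)^[n] g) x
  rw [h1, norm_mul, norm_pow, norm_neg, Complex.norm_ofNat] at h2
  exact h2

/-- The decay profile `(1 + t|ξ|)^{-(d+1)}`. -/
noncomputable def decay (d : ℕ) (t : ℝ) (ξ : EuclideanSpace ℝ (Fin d)) : ℝ :=
  ((1 + t * ‖ξ‖) ^ (d + 1))⁻¹

theorem decay_nonneg {t : ℝ} (ht : 0 ≤ t) (ξ : EuclideanSpace ℝ (Fin d)) : 0 ≤ decay d t ξ := by
  unfold decay; positivity

theorem integrable_decay_one (d : ℕ) : Integrable (decay d 1) := by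
  have := integrable_one_add_norm (E := EuclideanSpace ℝ (Fin d)) (μ := volume) (r := d + 1)
    (by simp)
  refine this.congr (Filter.Eventually.of_forall fun ξ => ?_)
  dsimp only [decay]
  rw [one_mul, Real.rpow_neg (by positivity)]
  norm_cast

theorem decay_eq {t : ℝ} (ht : 0 < t) (ξ : EuclideanSpace ℝ (Fin d)) :
    decay d t ξ = decay d 1 (t • ξ) := by
  simp [decay, norm_smul, abs_of_pos ht]

theorem integrable_decay {t : ℝ} (ht : 0 < t) : Integrable (decay d t) := by
  rw [show decay d t = fun ξ => decay d 1 (t • ξ) from funext fun ξ => decay_eq ht ξ]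
  exact (integrable_decay_one d).comp_smul ht.ne'

theorem integral_decay {t : ℝ} (ht : 0 < t) :
    ∫ ξ, decay d t ξ = (t ^ d)⁻¹ * ∫ ξ, decay d 1 ξ := by
  simp_rw [decay_eq ht]
  rw [Measure.integral_comp_smul_of_nonneg volume (decay d 1) t (hR := ht.le)]
  simp

theorem integral_decay_nonneg (d : ℕ) : 0 ≤ ∫ ξ, decay d 1 ξ :=
  integral_nonneg fun ξ => decay_nonneg zero_le_one ξ

theorem exists_norm_le_sqrt_mul_abs (hd : 1 ≤ d) (x : EuclideanSpace ℝ (Fin d)) :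
    ∃ j, ‖x‖ ≤ √d * |x j| := by
  have : Nonempty (Fin d) := ⟨⟨0, hd⟩⟩
  obtain ⟨j, -, hj⟩ := Finset.exists_max_image Finset.univ (fun j => |x j|) Finset.univ_nonempty
  refine ⟨j, ?_⟩
  rw [EuclideanSpace.norm_eq]
  apply Real.sqrt_le_iff.2
  refine ⟨by positivity, ?_⟩
  rw [mul_pow, Real.sq_sqrt (by positivity)]
  calc ∑ i, ‖x i‖ ^ 2 ≤ ∑ i : Fin d, |x j| ^ 2 := by
        refine Finset.sum_le_sum fun i _ => ?_
        rw [norm_eq_abs]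
        have := hj i (Finset.mem_univ i)
        gcongr
    _ = _ := by simp

theorem exists_lintegral_invFourier_le (hd : 1 ≤ d) :
    ∃ C : ℝ, 0 ≤ C ∧ ∀ t : ℝ, 0 < t → ∀ M : ℝ, 0 ≤ M → ∀ g : EuclideanSpace ℝ (Fin d) → ℂ,
      Integrable g → (∀ᵐ ξ, ‖g ξ‖ ≤ M / t ^ (d + 1) * decay d t ξ) →
      (∀ j : Fin d, ∀ h : ℝ, 0 < h → t * h ≤ π * √d →
        ∫ ξ, ‖(fwdDiff (EuclideanSpace.single j h))^[d + 1] g ξ‖ ≤ M * h ^ (d + 1) / t ^ d) →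
      ∫⁻ x, ‖invFourier g x‖ₑ ≤ ENNReal.ofReal (C * M / t ^ (d + 1)) := by
  set I := ∫ ξ, decay d 1 ξ with hI
  have hI0 : 0 ≤ I := integral_decay_nonneg d
  set C₀ := 2 ^ (d + 1) * I + (π * √d) ^ (d + 1) with hC₀
  have hC₀0 : 0 ≤ C₀ := by positivity
  refine ⟨C₀ * I, by positivity, fun t ht M hM g hg hgb hdiff => ?_⟩
  have hpt : ∀ x, ‖invFourier g x‖ ≤ C₀ * M / t ^ (2 * d + 1) * decay d t⁻¹ x := by
    intro x
    unfold decay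
    rw [← div_eq_mul_inv, le_div_iff₀ (by positivity), ← div_eq_inv_mul]
    rcases lt_or_ge ‖x‖ t with hx | hx
    · have h1 : ‖invFourier g x‖ ≤ M / t ^ (d + 1) * ((t ^ d)⁻¹ * I) := by
        refine (norm_invFourier_le g x).trans ?_
        rw [hI, ← integral_decay ht, ← integral_const_mul]
        exact integral_mono_ae hg.norm ((integrable_decay ht).const_mul _) hgb
      have h2 : 1 + ‖x‖ / t ≤ 2 := by
        have : ‖x‖ / t ≤ 1 := (div_le_one ht).2 hx.le
        linarith
      calc ‖invFourier g x‖ * (1 + ‖x‖ / t) ^ (d + 1)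
          ≤ (M / t ^ (d + 1) * ((t ^ d)⁻¹ * I)) * 2 ^ (d + 1) := by gcongr
        _ = (2 ^ (d + 1) * I) * M / t ^ (2 * d + 1) := by
            rw [show 2 * d + 1 = (d + 1) + d by ring, pow_add t]
            field_simp
            ring
        _ ≤ _ := by
            gcongr
            rw [hC₀]
            exact le_add_of_nonneg_right (by positivity)
    · obtain ⟨j, hj⟩ := exists_norm_le_sqrt_mul_abs hd x
      have hx0 : 0 < ‖x‖ := ht.trans_le hx
      have hd0 : 0 < √(d : ℝ) := Real.sqrt_pos.2 (by exact_mod_cast hd)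
      have hxj : 0 < |x j| := by
        by_contra hc
        have : |x j| = 0 := le_antisymm (not_lt.1 hc) (abs_nonneg _)
        rw [this] at hj
        linarith
      set h := π / |x j| with hh
      have hh0 : 0 < h := by positivity
      have hle : h ≤ π * √d / ‖x‖ := by
        rw [hh, div_le_div_iff₀ hxj hx0, mul_assoc]
        gcongr
      have hth : t * h ≤ π * √d := by
        calc t * h ≤ ‖x‖ * (π * √d / ‖x‖) := by gcongr
          _ = _ := by field_simp
      have h1 := two_pow_mul_norm_invFourier_le hg (v := EuclideanSpace.single j h) (x := x) (by
        rw [EuclideanSpace.inner_single_right, hh]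
        simp only [conj_trivial]
        rw [abs_mul, abs_of_pos hh0, hh, div_mul_cancel₀ _ hxj.ne']) (d + 1)
      have h2 := h1.trans (hdiff j h hh0 hth)
      have h3 : 1 + ‖x‖ / t ≤ 2 * (‖x‖ / t) := by
        have : 1 ≤ ‖x‖ / t := (one_le_div ht).2 hx
        linarith
      calc ‖invFourier g x‖ * (1 + ‖x‖ / t) ^ (d + 1)
          ≤ ‖invFourier g x‖ * (2 * (‖x‖ / t)) ^ (d + 1) := by gcongr
        _ = (2 ^ (d + 1) * ‖invFourier g x‖) * (‖x‖ / t) ^ (d + 1) := by rw [mul_pow]; ring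
        _ ≤ (M * (π * √d / ‖x‖) ^ (d + 1) / t ^ d) * (‖x‖ / t) ^ (d + 1) := by
            gcongr
            refine h2.trans ?_
            gcongr
        _ = (π * √d) ^ (d + 1) * M / t ^ (2 * d + 1) := by
            rw [show 2 * d + 1 = (d + 1) + d by ring, pow_add t, div_pow, div_pow]
            field_simp
        _ ≤ _ := by
            gcongr
            rw [hC₀]
            exact le_add_of_nonneg_left (by positivity)
  calc ∫⁻ x, ‖invFourier g x‖ₑ
      ≤ ∫⁻ x, ENNReal.ofReal (C₀ * M / t ^ (2 * d + 1) * decay d t⁻¹ x) := by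
        refine lintegral_mono fun x => ?_
        rw [← ofReal_norm]
        exact ENNReal.ofReal_le_ofReal (hpt x)
    _ = ENNReal.ofReal (∫ x, C₀ * M / t ^ (2 * d + 1) * decay d t⁻¹ x) := by
        rw [ofReal_integral_eq_lintegral_ofReal ((integrable_decay (inv_pos.2 ht)).const_mul _)]
        exact Filter.Eventually.of_forall fun x =>
          mul_nonneg (by positivity) (decay_nonneg (inv_nonneg.2 ht.le) x)
    _ = _ := by
        rw [integral_const_mul, integral_decay (inv_pos.2 ht), ← hI]
        congr 1
        rw [show 2 * d + 1 = (d + 1) + d by ring, pow_add t, inv_pow, inv_inv]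
        field_simp

/-- The Fourier transform `ξ ↦ ∫ exp(-i z·ξ) h(z) dz`. -/
noncomputable def fourierE (h : EuclideanSpace ℝ (Fin d) → ℂ)
    (ξ : EuclideanSpace ℝ (Fin d)) : ℂ :=
  ∫ z, Complex.exp (-Complex.I * (⟪z, ξ⟫ : ℂ)) * h z

theorem norm_exp_neg_I_inner (z ξ : EuclideanSpace ℝ (Fin d)) :
    ‖Complex.exp (-Complex.I * (⟪z, ξ⟫ : ℂ))‖ = 1 := by
  rw [neg_mul_comm, mul_comm, ← Complex.ofReal_neg]; exact Complex.norm_exp_ofReal_mul_I _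

/-- The Fourier multiplier operator with symbol `g`. -/
noncomputable def mulOp (g h : EuclideanSpace ℝ (Fin d) → ℂ) : EuclideanSpace ℝ (Fin d) → ℂ :=
  invFourier fun ξ => g ξ * fourierE h ξ

theorem mulOp_eq_conv {g h : EuclideanSpace ℝ (Fin d) → ℂ} (hg : Integrable g)
    (hh : Integrable h) (x : EuclideanSpace ℝ (Fin d)) :
    mulOp g h x = ∫ z, invFourier g (x - z) * h z := by
  have h1 : ∀ ξ, Complex.exp (Complex.I * (⟪x, ξ⟫ : ℂ)) * (g ξ * fourierE h ξ) =
      ∫ z, (Complex.exp (Complex.I * (⟪x, ξ⟫ : ℂ)) * g ξ) *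
        (Complex.exp (-Complex.I * (⟪z, ξ⟫ : ℂ)) * h z) := by
    intro ξ
    rw [integral_const_mul, fourierE]
    ring
  rw [mulOp, invFourier]
  simp_rw [h1]
  rw [integral_integral_swap]
  · refine integral_congr_ae (Filter.Eventually.of_forall fun z => ?_)
    dsimp only
    rw [invFourier, ← integral_mul_const]
    refine integral_congr_ae (Filter.Eventually.of_forall fun ξ => ?_)
    dsimp only
    rw [inner_sub_left]
    push_cast
    rw [mul_sub, sub_eq_add_neg, Complex.exp_add, ← neg_mul]
    ring
  · have hi : Integrable (fun p : EuclideanSpace ℝ (Fin d) × EuclideanSpace ℝ (Fin d) =>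
        g p.1 * h p.2) (volume.prod volume) := hg.mul_prod hh
    have := hi.bdd_mul (c := 1) (f := fun p => Complex.exp (Complex.I * (⟪x, p.1⟫ : ℂ)) *
        Complex.exp (-Complex.I * (⟪p.2, p.1⟫ : ℂ)))
        (Continuous.aestronglyMeasurable (by fun_prop))
        (Filter.Eventually.of_forall fun p => by
          rw [norm_mul, norm_exp_I_inner, norm_exp_neg_I_inner, one_mul])
    refine this.congr (Filter.Eventually.of_forall fun p => ?_)
    simp only [Function.uncurry]
    ring

theorem measurable_invFourier {g : EuclideanSpace ℝ (Fin d) → ℂ} (hg : Measurable g) :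
    Measurable (invFourier g) :=
  (Measurable.stronglyMeasurable (f := fun p : EuclideanSpace ℝ (Fin d) × EuclideanSpace ℝ
      (Fin d) =>
      Complex.exp (Complex.I * (⟪p.1, p.2⟫ : ℂ)) * g p.2) (by fun_prop)).integral_prod_right'
      (ν := volume) |>.measurable

theorem lintegral_mulOp_le {q : ℝ} (hq : 1 < q) {g h : EuclideanSpace ℝ (Fin d) → ℂ}
    (gm : Measurable g) (hg : Integrable g) (hm : Measurable h) (hh : Integrable h) :
    ∫⁻ x, ‖mulOp g h x‖ₑ ^ q ≤ (∫⁻ x, ‖invFourier g x‖ₑ) ^ q * ∫⁻ z, ‖h z‖ₑ ^ q := by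
  refine le_trans (lintegral_mono fun x => ?_) (lintegral_conv_rpow_le volume hq
    (k := fun x => ‖invFourier g x‖ₑ) (h := fun z => ‖h z‖ₑ)
    (measurable_invFourier gm).enorm hm.enorm)
  have q0 : 0 ≤ q := by linarith
  refine ENNReal.rpow_le_rpow ?_ q0
  rw [mulOp_eq_conv hg hh]
  refine (enorm_integral_le_lintegral_enorm _).trans_eq ?_
  simp_rw [enorm_mul]

/-- Mikhlin-type bounds, at frequency scale `t⁻¹`, for a symbol which is smooth away from `0`. -/
structure SymbolBound (d : ℕ) (t M : ℝ) (g : EuclideanSpace ℝ (Fin d) → ℂ) : Prop where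
  measurable : Measurable g
  contDiffAt : ∀ ξ, ξ ≠ 0 → ContDiffAt ℝ (d + 1) g ξ
  bound : ∀ ξ, ξ ≠ 0 → ∀ j : Fin d, ∀ n : ℕ, n ≤ d + 1 →
    ‖iteratedDeriv n (fun s : ℝ => g (ξ + EuclideanSpace.single j s)) 0‖ ≤
      M * t ^ n / t ^ (d + 1) * decay d t ξ

theorem single_add (j : Fin d) (a b : ℝ) :
    EuclideanSpace.single j (a + b) = EuclideanSpace.single j a + EuclideanSpace.single j b := by
  ext i; simp; split_ifs <;> simp

theorem single_zero (j : Fin d) : EuclideanSpace.single j (0 : ℝ) = 0 := by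
  simp

theorem fwdDiff_iter_line (g : EuclideanSpace ℝ (Fin d) → ℂ) (ξ : EuclideanSpace ℝ (Fin d))
    (j : Fin d) (h : ℝ) (n : ℕ) (s : ℝ) :
    (fwdDiff (EuclideanSpace.single j h))^[n] g (ξ + EuclideanSpace.single j s) =
      (fwdDiff h)^[n] (fun s => g (ξ + EuclideanSpace.single j s)) s := by
  induction n generalizing s with
  | zero => rfl
  | succ n ih =>
    rw [Function.iterate_succ_apply', Function.iterate_succ_apply', fwdDiff, fwdDiff, ← ih, ← ih,
      single_add, add_assoc]

theorem hasDerivAt_iteratedDeriv {n i : ℕ} {f : ℝ → ℂ} {s : ℝ} (hf : ContDiffAt ℝ n f s)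
    (hi : i < n) : HasDerivAt (iteratedDeriv i f) (iteratedDeriv (i + 1) f s) s := by
  rw [iteratedDeriv_succ]
  apply DifferentiableAt.hasDerivAt
  have h1 := hf.differentiableAt_iteratedFDeriv (m := i) (by exact_mod_cast hi)
  have : iteratedDeriv i f = fun x => iteratedFDeriv ℝ i f x (fun _ => 1) := by
    ext x; rw [iteratedDeriv_eq_iteratedFDeriv]
  rw [this]
  exact h1.continuousMultilinear_apply_const _

theorem decay_line_le {t : ℝ} (ht : 0 ≤ t) (ξ : EuclideanSpace ℝ (Fin d)) (j : Fin d) {s : ℝ}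
    (hs : 0 ≤ s) :
    decay d t (ξ + EuclideanSpace.single j s) ≤ (1 + t * s) ^ (d + 1) * decay d t ξ := by
  unfold decay
  rw [← div_eq_mul_inv, le_div_iff₀ (by positivity), ← div_eq_inv_mul, div_le_iff₀ (by positivity),
    ← mul_pow]
  gcongr
  have h1 : ‖ξ‖ ≤ ‖ξ + EuclideanSpace.single j s‖ + s := by
    have := norm_sub_le (ξ + EuclideanSpace.single j s) (EuclideanSpace.single j s)
    rwa [add_sub_cancel_right, PiLp.norm_single, norm_of_nonneg hs] at this
  have h2 : 0 ≤ t * s * (t * ‖ξ + EuclideanSpace.single j s‖) := by positivity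
  nlinarith

theorem SymbolBound.bound_line {t M : ℝ} {g : EuclideanSpace ℝ (Fin d) → ℂ}
    (hg : SymbolBound d t M g) {ξ : EuclideanSpace ℝ (Fin d)} {j : Fin d} {s : ℝ}
    (hξ : ξ + EuclideanSpace.single j s ≠ 0) {n : ℕ} (hn : n ≤ d + 1) :
    ‖iteratedDeriv n (fun s : ℝ => g (ξ + EuclideanSpace.single j s)) s‖ ≤
      M * t ^ n / t ^ (d + 1) * decay d t (ξ + EuclideanSpace.single j s) := by
  have h1 := hg.bound _ hξ j n hn
  have h2 : (fun r : ℝ => g (ξ + EuclideanSpace.single j s + EuclideanSpace.single j r)) =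
      fun r => (fun s => g (ξ + EuclideanSpace.single j s)) (s + r) := by
    funext r; dsimp only; rw [single_add, add_assoc]
  rw [h2, iteratedDeriv_comp_const_add n (fun s => g (ξ + EuclideanSpace.single j s)) s] at h1
  simpa using h1

theorem contDiff_euclideanSingle (j : Fin d) :
    ContDiff ℝ ⊤ fun s : ℝ => EuclideanSpace.single j s := by
  have : (fun s : ℝ => EuclideanSpace.single j s) =
      fun s => s • EuclideanSpace.single j (1 : ℝ) := by
    funext s; ext i; simp
  rw [this]
  fun_prop

theorem SymbolBound.contDiffAt_line {t M : ℝ} {g : EuclideanSpace ℝ (Fin d) → ℂ}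
    (hg : SymbolBound d t M g) {ξ : EuclideanSpace ℝ (Fin d)} {j : Fin d} {s : ℝ}
    (hξ : ξ + EuclideanSpace.single j s ≠ 0) :
    ContDiffAt ℝ (d + 1 : ℕ) (fun s : ℝ => g (ξ + EuclideanSpace.single j s)) s := by
  have h1 : ContDiffAt ℝ (d + 1 : ℕ) g (ξ + EuclideanSpace.single j s) := hg.contDiffAt _ hξ
  exact h1.comp s (contDiffAt_const.add ((contDiff_euclideanSingle j).contDiffAt.of_le le_top))

theorem SymbolBound.norm_fwdDiff_le {t M : ℝ} (ht : 0 < t) (hM : 0 ≤ M)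
    {g : EuclideanSpace ℝ (Fin d) → ℂ} (hg : SymbolBound d t M g)
    {ξ : EuclideanSpace ℝ (Fin d)} {j : Fin d} {h : ℝ} (hh : 0 ≤ h) {n : ℕ} (hn : n ≤ d + 1)
    (hξ : ∀ s ∈ Set.Icc 0 (n * h), ξ + EuclideanSpace.single j s ≠ 0) :
    ‖(fwdDiff (EuclideanSpace.single j h))^[n] g ξ‖ ≤
      h ^ n * (M * t ^ n / t ^ (d + 1) * ((1 + t * (n * h)) ^ (d + 1) * decay d t ξ)) := by
  have h0 := fwdDiff_iter_line g ξ j h n 0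
  rw [single_zero, add_zero] at h0
  rw [h0]
  refine norm_fwdDiff_iter_le (F := fun i => iteratedDeriv i fun s => g
      (ξ + EuclideanSpace.single j s))
    (a := 0) hh (fun i hi s hs => ?_) (fun s hs => ?_)
  · rw [zero_add] at hs
    exact hasDerivAt_iteratedDeriv (hg.contDiffAt_line (hξ s hs)) (by omega)
  · rw [zero_add] at hs
    refine (hg.bound_line (hξ s hs) hn).trans ?_
    refine mul_le_mul_of_nonneg_left ?_ (by positivity)
    refine (decay_line_le ht.le ξ j hs.1).trans ?_
    have := hs.1
    have := decay_nonneg ht.le ξ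
    gcongr
    exact hs.2

theorem SymbolBound.norm_le {t M : ℝ} {g : EuclideanSpace ℝ (Fin d) → ℂ} (hd : 1 ≤ d)
    (hg : SymbolBound d t M g) {ξ : EuclideanSpace ℝ (Fin d)} (hξ : ξ ≠ 0) :
    ‖g ξ‖ ≤ M / t ^ (d + 1) * decay d t ξ := by
  have h1 := hg.bound ξ hξ ⟨0, hd⟩ 0 (by omega)
  rwa [iteratedDeriv_zero, pow_zero, mul_one, single_zero, add_zero] at h1

theorem ae_ne_zero (hd : 1 ≤ d) : ∀ᵐ ξ : EuclideanSpace ℝ (Fin d), ξ ≠ 0 := by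
  have : Nonempty (Fin d) := ⟨⟨0, hd⟩⟩
  have : Nontrivial (EuclideanSpace ℝ (Fin d)) := inferInstance
  exact Measure.ae_ne volume 0

theorem SymbolBound.integrable {t M : ℝ} (ht : 0 < t) {g : EuclideanSpace ℝ (Fin d) → ℂ}
    (hd : 1 ≤ d) (hg : SymbolBound d t M g) : Integrable g := by
  refine ((integrable_decay ht).const_mul (M / t ^ (d + 1))).mono'
      hg.measurable.aestronglyMeasurable ?_
  filter_upwards [ae_ne_zero hd] with ξ hξ using hg.norm_le hd hξ

theorem ae_apply_ne_zero (i : Fin d) : ∀ᵐ ξ : EuclideanSpace ℝ (Fin d), ξ i ≠ 0 := by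
  set S : Submodule ℝ (EuclideanSpace ℝ (Fin d)) := LinearMap.ker
      (EuclideanSpace.proj i).toLinearMap
  have hS : S ≠ ⊤ := by
    intro h
    have : EuclideanSpace.single i (1 : ℝ) ∈ S := by rw [h]; trivial
    simp [S] at this
  rw [ae_iff]
  convert Measure.addHaar_submodule volume S hS using 2
  ext ξ
  simp [S]

theorem exists_mulOp_bound_of_two_le (hd : 2 ≤ d) {q : ℝ} (hq : 1 < q) :
    ∃ C : ℝ, 0 ≤ C ∧ ∀ t : ℝ, 0 < t → ∀ M : ℝ, 0 ≤ M → ∀ g : EuclideanSpace ℝ (Fin d) → ℂ,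
      SymbolBound d t M g → ∀ h, Measurable h → Integrable h →
      ∫⁻ x, ‖mulOp g h x‖ₑ ^ q ≤
        ENNReal.ofReal (C * M / t ^ (d + 1)) ^ q * ∫⁻ z, ‖h z‖ₑ ^ q := by
  obtain ⟨C, hC, hk⟩ := exists_lintegral_invFourier_le (d := d) (by omega)
  set K := max 1 ((1 + (d + 1 : ℕ) * (π * √d)) ^ (d + 1) * ∫ ξ, decay d 1 ξ) with hK
  have hK1 : 1 ≤ K := le_max_left _ _
  refine ⟨C * K, by positivity, fun t ht M hM g hg h hm hh => ?_⟩
  refine (lintegral_mulOp_le hq hg.measurable (hg.integrable ht (by omega)) hm hh).trans ?_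
  have q0 : 0 ≤ q := by linarith
  gcongr
  rw [mul_assoc C]
  refine hk t ht (K * M) (by positivity) g (hg.integrable ht (by omega)) ?_ ?_
  · filter_upwards [ae_ne_zero (by omega : 1 ≤ d)] with ξ hξ
    refine (hg.norm_le (by omega) hξ).trans ?_
    have := decay_nonneg ht.le ξ
    gcongr
    exact le_mul_of_one_le_left hM hK1
  · intro j h hh0 hth
    obtain ⟨i, hij⟩ : ∃ i : Fin d, i ≠ j := by
      have : Nontrivial (Fin d) := Fin.nontrivial_iff_two_le.2 hd
      exact exists_ne j
    have hae : ∀ᵐ ξ, ‖(fwdDiff (EuclideanSpace.single j h))^[d + 1] g ξ‖ ≤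
        h ^ (d + 1) * M * (1 + (d + 1 : ℕ) * (π * √d)) ^ (d + 1) * decay d t ξ := by
      filter_upwards [ae_apply_ne_zero i] with ξ hξ
      refine (hg.norm_fwdDiff_le ht hM hh0.le le_rfl fun s _ h0 => hξ ?_).trans ?_
      · have := congrArg (fun v => v i) h0
        simpa [hij] using this
      · have h1 : M * t ^ (d + 1) / t ^ (d + 1) = M := by field_simp
        rw [h1, mul_assoc (h ^ (d + 1)), mul_assoc (h ^ (d + 1)), mul_assoc M]
        have := decay_nonneg ht.le ξ
        gcongr _ * (_ * ((1 + ?_) ^ _ * _))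
        rw [mul_left_comm]
        gcongr
    refine (integral_mono_ae (integrable_fwdDiff_iter (hg.integrable ht (by omega)) _ _).norm
      ((integrable_decay ht).const_mul _) hae).trans ?_
    rw [integral_const_mul, integral_decay ht]
    have h2 := le_max_right 1 ((1 + (d + 1 : ℕ) * (π * √d)) ^ (d + 1) * ∫ ξ, decay d 1 ξ)
    rw [← hK] at h2
    calc _ = ((1 + (d + 1 : ℕ) * (π * √d)) ^ (d + 1) * ∫ ξ, decay d 1 ξ) *
          (M * h ^ (d + 1) / t ^ d) := by ring
      _ ≤ K * (M * h ^ (d + 1) / t ^ d) := by gcongr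
      _ = _ := by ring

theorem singleton_repr_eq_single :
    ⇑(OrthonormalBasis.singleton (Fin 1) ℝ).repr = EuclideanSpace.single (0 : Fin 1) := by
  funext s; ext i
  have : i = 0 := Subsingleton.elim _ _
  subst this
  simp

theorem single_apply_zero (ξ : EuclideanSpace ℝ (Fin 1)) :
    EuclideanSpace.single (0 : Fin 1) (ξ 0) = ξ := by
  ext i
  have : i = 0 := Subsingleton.elim _ _
  subst this
  simp

theorem measurePreserving_single :
    MeasurePreserving (EuclideanSpace.single (0 : Fin 1) : ℝ → EuclideanSpace ℝ (Fin 1)) := by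
  rw [← singleton_repr_eq_single]
  exact OrthonormalBasis.measurePreserving_repr _

theorem measurableEmbedding_single :
    MeasurableEmbedding (EuclideanSpace.single (0 : Fin 1) : ℝ → EuclideanSpace ℝ (Fin 1)) := by
  rw [← singleton_repr_eq_single]
  exact (OrthonormalBasis.singleton (Fin 1) ℝ).repr.toHomeomorph.measurableEmbedding

theorem lintegral_single (f : EuclideanSpace ℝ (Fin 1) → ENNReal) :
    ∫⁻ ξ, f ξ = ∫⁻ s : ℝ, f (EuclideanSpace.single 0 s) :=
  (measurePreserving_single.lintegral_comp_emb measurableEmbedding_single f).symm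

theorem integral_single {F : Type*} [NormedAddCommGroup F] [NormedSpace ℝ F]
    (f : EuclideanSpace ℝ (Fin 1) → F) :
    ∫ ξ, f ξ = ∫ s : ℝ, f (EuclideanSpace.single 0 s) :=
  (measurePreserving_single.integral_comp measurableEmbedding_single f).symm

theorem inner_single_single (a b : ℝ) :
    ⟪(EuclideanSpace.single (0 : Fin 1) a : EuclideanSpace ℝ (Fin 1)), EuclideanSpace.single 0 b⟫ =
        a * b := by
  simp [EuclideanSpace.inner_single_left]

/-- The odd symbol `sgn(ξ) e^{-t|ξ|}` of the conjugate Poisson kernel. -/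
noncomputable def oddSymbol (t : ℝ) (ξ : EuclideanSpace ℝ (Fin 1)) : ℂ :=
  ((SignType.sign (ξ 0) * rexp (-t * |ξ 0|) : ℝ) : ℂ)

theorem measurable_sign_real : Measurable fun s : ℝ => ((SignType.sign s : ℝ)) := by
  have : (fun s : ℝ => ((SignType.sign s : ℝ))) = fun s => if 0 < s then 1 else if s < 0 then -1
      else 0 := by
    funext s
    rw [sign_apply]
    split_ifs <;> simp
  rw [this]
  exact Measurable.ite measurableSet_Ioi measurable_const
    (Measurable.ite measurableSet_Iio measurable_const measurable_const)

theorem measurable_oddSymbol (t : ℝ) : Measurable (oddSymbol t) := by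
  unfold oddSymbol
  have h0 : Measurable fun ξ : EuclideanSpace ℝ (Fin 1) => ξ 0 := by fun_prop
  have h1 := measurable_sign_real.comp h0
  refine Complex.measurable_ofReal.comp (h1.mul ?_)
  fun_prop

theorem norm_oddSymbol_le (t : ℝ) (ξ : EuclideanSpace ℝ (Fin 1)) :
    ‖oddSymbol t ξ‖ ≤ rexp (-t * |ξ 0|) := by
  unfold oddSymbol
  rw [Complex.norm_real, norm_mul, norm_of_nonneg (exp_pos _).le]
  refine mul_le_of_le_one_left (exp_pos _).le ?_
  rcases lt_trichotomy (ξ 0) 0 with h | h | h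
  · simp [sign_neg h]
  · simp [h]
  · simp [sign_pos h]

theorem oddSymbol_of_pos (t : ℝ) {s : ℝ} (hs : 0 < s) :
    oddSymbol t (EuclideanSpace.single 0 s) = Complex.exp (-t * s) := by
  simp [oddSymbol, sign_pos hs, abs_of_pos hs]

theorem oddSymbol_of_neg (t : ℝ) {s : ℝ} (hs : s < 0) :
    oddSymbol t (EuclideanSpace.single 0 s) = -Complex.exp (t * s) := by
  simp [oddSymbol, sign_neg hs, abs_of_neg hs]

theorem exp_neg_le_two_mul {r : ℝ} (hr : 0 ≤ r) : rexp (-r) ≤ 2 * ((1 + r) ^ 2)⁻¹ := by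
  rw [exp_neg, ← div_eq_mul_inv, inv_eq_one_div, div_le_div_iff₀ (exp_pos _) (by positivity)]
  have := quadratic_le_exp_of_nonneg hr
  nlinarith [sq_nonneg r]

theorem symbolBound_oddSymbol {t : ℝ} (ht : 0 < t) : SymbolBound 1 t (2 * t ^ 2) (oddSymbol t) := by
  have h0 : ∀ ξ : EuclideanSpace ℝ (Fin 1), ξ ≠ 0 → ξ 0 ≠ 0 := by
    intro ξ h h0
    apply h
    rw [← single_apply_zero ξ, h0]; simp
  have hexp : ∀ ξ : EuclideanSpace ℝ (Fin 1), rexp (-t * |ξ 0|) ≤ 2 * decay 1 t ξ := by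
    intro ξ
    have h1 := exp_neg_le_two_mul (r := t * |ξ 0|) (by positivity)
    have h2 : ‖ξ‖ = |ξ 0| := by
      conv_lhs => rw [← single_apply_zero ξ, PiLp.norm_single]
      rfl
    rw [decay, h2, neg_mul]
    exact h1
  have hloc : ∀ ξ : EuclideanSpace ℝ (Fin 1), ξ ≠ 0 → ∃ ε : ℝ, |ε| = 1 ∧ ∀ᶠ η in nhds ξ,
      oddSymbol t η = ε * Complex.exp ((-ε * t * η 0 : ℝ)) := by
    intro ξ hξ
    have hc : Filter.Tendsto (fun η : EuclideanSpace ℝ (Fin 1) => η 0) (nhds ξ) (nhds (ξ 0)) :=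
      Continuous.tendsto (by fun_prop) _
    rcases lt_or_gt_of_ne (h0 ξ hξ) with h | h
    · refine ⟨-1, by simp, ?_⟩
      filter_upwards [hc.eventually (gt_mem_nhds h)] with η hη
      rw [← single_apply_zero η, oddSymbol_of_neg t hη]
      simp
    · refine ⟨1, by simp, ?_⟩
      filter_upwards [hc.eventually (lt_mem_nhds h)] with η hη
      rw [← single_apply_zero η, oddSymbol_of_pos t hη]
      simp
  refine ⟨measurable_oddSymbol t, fun ξ hξ => ?_, fun ξ hξ j n _ => ?_⟩
  · obtain ⟨ε, -, he⟩ := hloc ξ hξ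
    refine ContDiffAt.congr_of_eventuallyEq ?_ he
    have h1 : ContDiff ℝ (1 + 1) fun η : EuclideanSpace ℝ (Fin 1) => -ε * t * η 0 := by fun_prop
    exact contDiffAt_const.mul (ContDiffAt.cexp (Complex.ofRealCLM.contDiff.contDiffAt.comp ξ
      h1.contDiffAt))
  · obtain rfl : j = 0 := Subsingleton.elim _ _
    obtain ⟨ε, hε, he⟩ := hloc ξ hξ
    have hc : Filter.Tendsto (fun s : ℝ => ξ + EuclideanSpace.single 0 s) (nhds 0) (nhds ξ) := by
      have h1 : Continuous fun s : ℝ => ξ + EuclideanSpace.single 0 s :=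
        continuous_const.add (contDiff_euclideanSingle 0).continuous
      have h2 := h1.tendsto 0
      rwa [single_zero, add_zero] at h2
    have h1 : (fun s : ℝ => oddSymbol t (ξ + EuclideanSpace.single 0 s)) =ᶠ[nhds 0]
        fun s => (ε * Complex.exp ((-ε * t * ξ 0 : ℝ))) * Complex.exp ((-ε * t : ℂ) * s) := by
      filter_upwards [hc.eventually he] with s hs
      rw [hs, mul_assoc (ε : ℂ) (Complex.exp _), ← Complex.exp_add]
      congr 2
      simp; ring
    have h2 : ∀ n : ℕ, iteratedDeriv n (fun s : ℝ => Complex.exp ((-ε * t : ℂ) * s)) =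
        fun s : ℝ => (-ε * t : ℂ) ^ n * Complex.exp ((-ε * t : ℂ) * s) := by
      intro n
      induction n with
      | zero => simp
      | succ n ih =>
        rw [iteratedDeriv_succ, ih]
        funext s
        have h3 : HasDerivAt (fun s : ℝ => Complex.exp ((-ε * t : ℂ) * s))
            (Complex.exp ((-ε * t : ℂ) * s) * ((-ε * t : ℂ) * 1)) s := by
          exact (((hasDerivAt_id (s : ℂ)).const_mul (-ε * t : ℂ)).cexp).comp_ofReal
        rw [(h3.const_mul _).deriv]
        ring
    rw [h1.iteratedDeriv_eq, iteratedDeriv_const_mul_field, h2]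
    have h3 := norm_oddSymbol_le t ξ
    rw [he.self_of_nhds] at h3
    have h4 : 2 * t ^ 2 * t ^ n / t ^ (1 + 1) * decay 1 t ξ = t ^ n * (2 * decay 1 t ξ) := by
      field_simp
    rw [h4]
    refine le_trans (le_of_eq ?_) (mul_le_mul_of_nonneg_left (h3.trans (hexp ξ)) (by positivity))
    simp [hε, abs_of_pos ht]
    ring

theorem invFourier_oddSymbol {t : ℝ} (ht : 0 < t) (x : ℝ) :
    invFourier (oddSymbol t) (EuclideanSpace.single 0 x) =
      2 * Complex.I * ((x / (x ^ 2 + t ^ 2) : ℝ) : ℂ) := by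
  unfold invFourier
  rw [integral_single]
  simp_rw [inner_single_single]
  have ha : (-t + Complex.I * x : ℂ).re < 0 := by simp [ht]
  have hb : 0 < (t + Complex.I * x : ℂ).re := by simp [ht]
  have e1 : ∀ s ∈ Set.Ioi (0 : ℝ), Complex.exp (Complex.I * ((x * s : ℝ) : ℂ)) *
      oddSymbol t (EuclideanSpace.single 0 s) = Complex.exp ((-t + Complex.I * x : ℂ) * s) := by
    intro s hs
    rw [oddSymbol_of_pos t hs, ← Complex.exp_add]
    congr 1; push_cast; ring
  have e2 : ∀ s ∈ Set.Iio (0 : ℝ), Complex.exp (Complex.I * ((x * s : ℝ) : ℂ)) *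
      oddSymbol t (EuclideanSpace.single 0 s) = -Complex.exp ((t + Complex.I * x : ℂ) * s) := by
    intro s hs
    rw [oddSymbol_of_neg t hs, mul_neg, ← Complex.exp_add]
    congr 2; push_cast; ring
  have i1 := integrableOn_exp_mul_complex_Ioi ha 0
  have i2 := integrableOn_exp_mul_complex_Iic hb 0
  rw [← integral_add_compl (measurableSet_Ioi (a := (0 : ℝ))), Set.compl_Ioi,
    setIntegral_congr_fun measurableSet_Ioi e1, integral_Iic_eq_integral_Iio,
    setIntegral_congr_fun measurableSet_Iio e2, integral_neg, ← integral_Iic_eq_integral_Iio,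
    integral_exp_mul_complex_Ioi ha, integral_exp_mul_complex_Iic hb]
  · have h1 : (-t + Complex.I * x : ℂ) ≠ 0 := fun h => by rw [h] at ha; simp at ha
    have h2 : (t + Complex.I * x : ℂ) ≠ 0 := fun h => by rw [h] at hb; simp at hb
    have h3 : (x ^ 2 + t ^ 2 : ℂ) ≠ 0 := by exact_mod_cast (by positivity : x ^ 2 + t ^ 2 ≠ 0)
    simp
    field_simp
    linear_combination (-2 * x ^ 3 * Complex.I) * Complex.I_sq
  · have hi := (symbolBound_oddSymbol ht).integrable ht le_rfl
    have h1 := (measurePreserving_single.integrable_comp_emb measurableEmbedding_single).2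
      (integrable_exp_mul hi (EuclideanSpace.single 0 x))
    refine h1.congr (Filter.Eventually.of_forall fun s => ?_)
    simp only [Function.comp_apply, inner_single_single]

theorem mulOp_oddSymbol {t : ℝ} (ht : 0 < t) {h : EuclideanSpace ℝ (Fin 1) → ℂ} (hi : Integrable h)
    (hψ : Integrable (oddSymbol t)) (x : ℝ) :
    mulOp (oddSymbol t) h (EuclideanSpace.single 0 x) =
      2 * Complex.I * conjPoisson t (fun s => h (EuclideanSpace.single 0 s)) x := by
  rw [mulOp_eq_conv hψ hi, integral_single, conjPoisson, ← integral_const_mul]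
  congr 1; funext s
  have : (EuclideanSpace.single 0 x - EuclideanSpace.single 0 s : EuclideanSpace ℝ (Fin 1)) =
      EuclideanSpace.single 0 (x - s) := by
    rw [sub_eq_iff_eq_add, ← single_add, sub_add_cancel]
  rw [this, invFourier_oddSymbol ht, mul_assoc]

theorem exists_rightLimit {γ : ℝ → ℂ} {K : ℝ} (hK : 0 ≤ K)
    (hd : ∀ s, 0 < s → DifferentiableAt ℝ γ s) (hb : ∀ s, 0 < s → ‖deriv γ s‖ ≤ K) :
    ∃ a : ℂ, ∀ s, 0 < s → ‖γ s - a‖ ≤ lipschitzExtensionConstant ℂ * K * s := by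
  have h1 : LipschitzOnWith K.toNNReal γ (Set.Ioi 0) :=
    Convex.lipschitzOnWith_of_nnnorm_deriv_le hd
      (fun s hs => by
        rw [← NNReal.coe_le_coe, Real.coe_toNNReal _ hK]; exact hb s hs) (convex_Ioi 0)
  obtain ⟨G, hG, he⟩ := h1.extend_finite_dimension
  refine ⟨G 0, fun s hs => ?_⟩
  rw [he hs]
  have := hG.dist_le_mul s 0
  rw [dist_eq_norm, dist_zero_right, norm_of_nonneg hs.le, NNReal.coe_mul,
    Real.coe_toNNReal _ hK] at this
  exact this

theorem SymbolBound.sub_const_mul {d : ℕ} {t M M' : ℝ} {g g' : EuclideanSpace ℝ (Fin d) → ℂ}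
    (hg : SymbolBound d t M g) (hg' : SymbolBound d t M' g') (J : ℂ) :
    SymbolBound d t (M + ‖J‖ * M') fun ξ => g ξ - J * g' ξ := by
  refine ⟨hg.measurable.sub (hg'.measurable.const_mul J), fun ξ hξ =>
    (hg.contDiffAt ξ hξ).sub (contDiffAt_const.mul (hg'.contDiffAt ξ hξ)), fun ξ hξ j n hn => ?_⟩
  have h0 : ξ + EuclideanSpace.single j 0 ≠ 0 := by rwa [single_zero, add_zero]
  have hn' : ((n : ℕ∞) : WithTop ℕ∞) ≤ ((d + 1 : ℕ) : ℕ∞) := by exact_mod_cast hn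
  rw [iteratedDeriv_fun_sub ((hg.contDiffAt_line h0).of_le hn')
    (contDiffAt_const.mul ((hg'.contDiffAt_line h0).of_le hn')), iteratedDeriv_const_mul_field]
  refine (norm_sub_le _ _).trans ?_
  rw [norm_mul]
  have h1 := hg.bound ξ hξ j n hn
  have h2 := mul_le_mul_of_nonneg_left (hg'.bound ξ hξ j n hn) (norm_nonneg J)
  refine (add_le_add h1 h2).trans (le_of_eq ?_)
  ring

theorem integral_fwdDiff_two_le {t M B : ℝ} (ht : 0 < t) (hM : 0 ≤ M) (hB : 0 ≤ B)
    {g : EuclideanSpace ℝ (Fin 1) → ℂ}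
    (hg : SymbolBound 1 t M g) {m : ℂ}
    (hm : ∀ s : ℝ, s ≠ 0 → ‖g (EuclideanSpace.single 0 s) - m‖ ≤ B / t * |s|) {h : ℝ} (hh : 0 < h)
    (hth : t * h ≤ π) :
    ∫ ξ, ‖(fwdDiff (EuclideanSpace.single 0 h))^[2] g ξ‖ ≤
      (M * (1 + 2 * π) ^ 2 * (∫ ξ, decay 1 1 ξ) + 12 * B) * h ^ 2 / t := by
  set F : ℝ → ℝ := fun s => ‖(fwdDiff (EuclideanSpace.single 0 h : EuclideanSpace ℝ (Fin 1)))^[2] g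
      (EuclideanSpace.single 0 s)‖
  have hae : ∀ᵐ s : ℝ, F s ≤ h ^ 2 * M * (1 + 2 * π) ^ 2 * decay 1 t (EuclideanSpace.single 0 s) +
      (Set.Icc (-2 * h) 0).indicator (fun _ => 6 * h * B / t) s := by
    filter_upwards [Measure.ae_ne volume (0 : ℝ), Measure.ae_ne volume (-h),
      Measure.ae_ne volume (-2 * h)] with s hs0 hs1 hs2
    have hd0 := decay_nonneg ht.le (EuclideanSpace.single 0 s : EuclideanSpace ℝ (Fin 1))
    by_cases hs : s ∈ Set.Icc (-2 * h) 0
    · rw [Set.indicator_of_mem hs]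
      have e : (fwdDiff (EuclideanSpace.single 0 h : EuclideanSpace ℝ (Fin 1)))^[2] g
          (EuclideanSpace.single 0 s) =
          (g (EuclideanSpace.single 0 (s + h + h)) - m) - 2 *
              (g (EuclideanSpace.single 0 (s + h)) - m)
            + (g (EuclideanSpace.single 0 s) - m) := by
        simp only [Function.iterate_succ, Function.iterate_zero, Function.comp_apply, id, fwdDiff,
          single_add]
        ring
      have h1 := hm s hs0
      have h2 := hm (s + h) (fun h => hs1 (by linarith))
      have h3 := hm (s + h + h) (fun h => hs2 (by linarith))
      have b1 : |s| ≤ 2 * h := abs_le.2 ⟨by linarith [hs.1], by linarith [hs.2]⟩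
      have b2 : |s + h| ≤ h := abs_le.2 ⟨by linarith [hs.1], by linarith [hs.2]⟩
      have b3 : |s + h + h| ≤ 2 * h := abs_le.2 ⟨by linarith [hs.1], by linarith [hs.2]⟩
      have hBt : 0 ≤ B / t := by positivity
      have c1 := mul_le_mul_of_nonneg_left b1 hBt
      have c2 := mul_le_mul_of_nonneg_left b2 hBt
      have c3 := mul_le_mul_of_nonneg_left b3 hBt
      have h4 : F s ≤ ‖g (EuclideanSpace.single 0 (s + h + h)) - m‖ +
          2 * ‖g (EuclideanSpace.single 0 (s + h)) - m‖ + ‖g (EuclideanSpace.single 0 s) - m‖ := by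
        simp only [F]
        rw [e]
        refine (norm_add_le _ _).trans (add_le_add_left ((norm_sub_le _ _).trans ?_) _)
        rw [norm_mul]; simp
      have h5 : 0 ≤ h ^ 2 * M * (1 + 2 * π) ^ 2 * decay 1 t (EuclideanSpace.single 0 s) := by
        positivity
      have h6 : 6 * h * B / t = B / t * (2 * h) + 2 * (B / t * h) + B / t * (2 * h) := by ring
      rw [h6]
      linarith
    · rw [Set.indicator_of_notMem hs, add_zero]
      refine (hg.norm_fwdDiff_le ht hM hh.le (n := 2) le_rfl fun r hr h0 => hs ?_).trans ?_
      · rw [← single_add] at h0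
        have h1 := congrArg (fun v : EuclideanSpace ℝ (Fin 1) => v 0) h0
        simp at h1
        have := hr.2
        have := hr.1
        push_cast at *
        exact ⟨by linarith, by linarith⟩
      · have h1 : M * t ^ 2 / t ^ (1 + 1) = M := by field_simp
        rw [h1, ← mul_assoc, ← mul_assoc]
        have h2 : t * ((2 : ℕ) * h) ≤ 2 * π := by push_cast; linarith
        gcongr
  have hgi := hg.integrable ht le_rfl
  have hFi : Integrable F :=
    (measurePreserving_single.integrable_comp_emb measurableEmbedding_single).2
      (integrable_fwdDiff_iter hgi _ 2).norm
  have hdi : Integrable fun s : ℝ => decay 1 t (EuclideanSpace.single 0 s) :=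
    (measurePreserving_single.integrable_comp_emb measurableEmbedding_single).2
      (integrable_decay ht)
  have hii : Integrable ((Set.Icc (-2 * h) 0).indicator (fun _ : ℝ => 6 * h * B / t)) :=
    (integrable_indicator_iff measurableSet_Icc).2 (integrableOn_const measure_Icc_lt_top.ne)
  rw [integral_single]
  refine (integral_mono_ae hFi ((hdi.const_mul _).add hii) hae).trans (le_of_eq ?_)
  rw [integral_add' (hdi.const_mul _) hii, integral_const_mul, integral_indicator measurableSet_Icc,
    ← integral_single (fun ξ => decay 1 t ξ), integral_decay ht]
  simp [hh.le]
  field_simp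
  ring

theorem integrable_invFourier_sub_mul {d : ℕ} {g h : EuclideanSpace ℝ (Fin d) → ℂ}
    (gm : Measurable g) (hh : Integrable h) (x : EuclideanSpace ℝ (Fin d)) :
    Integrable fun z => invFourier g (x - z) * h z := by
  refine hh.bdd_mul (c := ∫ ξ, ‖g ξ‖)
    ((measurable_invFourier gm).comp (measurable_const.sub measurable_id)).aestronglyMeasurable
    (Filter.Eventually.of_forall fun z => norm_invFourier_le _ _)

theorem mulOp_sub_const_mul {d : ℕ} {g g' h : EuclideanSpace ℝ (Fin d) → ℂ}
    (gm : Measurable g) (hg : Integrable g) (gm' : Measurable g') (hg' : Integrable g')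
    (hh : Integrable h) (J : ℂ) (x : EuclideanSpace ℝ (Fin d)) :
    mulOp (fun ξ => g ξ - J * g' ξ) h x = mulOp g h x - J * mulOp g' h x := by
  have hi : Integrable fun ξ => g ξ - J * g' ξ := hg.sub (hg'.const_mul J)
  rw [mulOp_eq_conv hg hh, mulOp_eq_conv hg' hh, mulOp_eq_conv hi hh,
    ← integral_const_mul, ← integral_sub (integrable_invFourier_sub_mul gm hh x)
      ((integrable_invFourier_sub_mul gm' hh x).const_mul J)]
  congr 1; funext z
  have : invFourier (fun ξ => g ξ - J * g' ξ) (x - z) =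
      invFourier g (x - z) - J * invFourier g' (x - z) := by
    unfold invFourier
    rw [← integral_const_mul, ← integral_sub (integrable_exp_mul hg _)
      ((integrable_exp_mul hg' _).const_mul J)]
    congr 1; funext ξ; ring
  rw [this]; ring

theorem measurable_fourierE {d : ℕ} {h : EuclideanSpace ℝ (Fin d) → ℂ} (hm : Measurable h) :
    Measurable (fourierE h) :=
  (Measurable.stronglyMeasurable (f := fun p : EuclideanSpace ℝ (Fin d) × EuclideanSpace ℝ
      (Fin d) =>
      Complex.exp (-Complex.I * (⟪p.2, p.1⟫ : ℂ)) * h p.2) (by fun_prop)).integral_prod_right'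
      (ν := volume) |>.measurable

theorem measurable_mulOp {d : ℕ} {g h : EuclideanSpace ℝ (Fin d) → ℂ} (gm : Measurable g)
    (hm : Measurable h) : Measurable (mulOp g h) :=
  measurable_invFourier (gm.mul (measurable_fourierE hm))

theorem exists_mulOp_oddSymbol_bound {q : ℝ} (hq : 1 < q) :
    ∃ C : ENNReal, C ≠ ⊤ ∧ ∀ t : ℝ, 0 < t → ∀ h : EuclideanSpace ℝ (Fin 1) → ℂ, Measurable h →
        Integrable h →
      ∫⁻ x, ‖mulOp (oddSymbol t) h x‖ₑ ^ q ≤ C * ∫⁻ z, ‖h z‖ₑ ^ q := by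
  obtain ⟨C, hC, hb⟩ := exists_conjPoisson_bound hq
  have q0 : 0 ≤ q := by linarith
  refine ⟨2 ^ q * C, ENNReal.mul_ne_top (by simp) hC, fun t ht h hm hi => ?_⟩
  rw [lintegral_single, lintegral_single]
  have h1 : ∀ x : ℝ, ‖mulOp (oddSymbol t) h (EuclideanSpace.single 0 x)‖ₑ ^ q =
      2 ^ q * ‖conjPoisson t (fun s => h (EuclideanSpace.single 0 s)) x‖ₑ ^ q := by
    intro x
    rw [mulOp_oddSymbol ht hi ((symbolBound_oddSymbol ht).integrable ht le_rfl), enorm_mul,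
      ENNReal.mul_rpow_of_nonneg _ _ q0, enorm_mul]
    congr 2
    rw [← ofReal_norm, ← ofReal_norm]; simp
  simp_rw [h1]
  rw [lintegral_const_mul' _ _ (by simp), mul_assoc]
  gcongr
  exact hb t ht _ (hm.comp measurableEmbedding_single.measurable)
    ((measurePreserving_single.integrable_comp_emb measurableEmbedding_single).2 hi)

theorem SymbolBound.exists_jump {t M : ℝ} (ht : 0 < t) (hM : 0 ≤ M)
    {g : EuclideanSpace ℝ (Fin 1) → ℂ}
    (hg : SymbolBound 1 t M g) :
    ∃ J m : ℂ, ‖J‖ ≤ (1 + lipschitzExtensionConstant ℂ) * M / t ^ 2 ∧ ∀ s : ℝ, s ≠ 0 →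
      ‖g (EuclideanSpace.single 0 s) - J * oddSymbol t (EuclideanSpace.single 0 s) - m‖ ≤
        (1 + 2 * lipschitzExtensionConstant ℂ) * M / t * |s| := by
  set L : ℝ := ((lipschitzExtensionConstant ℂ : NNReal) : ℝ)
  have hL : 0 ≤ L := NNReal.coe_nonneg _
  set γ : ℝ → ℂ := fun s => g (EuclideanSpace.single 0 s)
  have h0 : ∀ s : ℝ, s ≠ 0 → (0 : EuclideanSpace ℝ (Fin 1)) + EuclideanSpace.single 0 s ≠ 0 := by
    intro s hs h; apply hs; simpa using h
  have hγ : (fun s : ℝ => g (0 + EuclideanSpace.single 0 s)) = γ := by simp [γ]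
  have hdiff : ∀ s : ℝ, s ≠ 0 → DifferentiableAt ℝ γ s := by
    intro s hs
    have := hg.contDiffAt_line (h0 s hs)
    rw [hγ] at this
    exact this.differentiableAt (by simp)
  have hder : ∀ s : ℝ, s ≠ 0 → ‖deriv γ s‖ ≤ M / t := by
    intro s hs
    have := hg.bound_line (h0 s hs) (n := 1) (by norm_num)
    rw [hγ, iteratedDeriv_one] at this
    refine this.trans ?_
    have hdec : decay 1 t ((0 : EuclideanSpace ℝ (Fin 1)) + EuclideanSpace.single 0 s) ≤ 1 := by
      unfold decay
      apply inv_le_one_of_one_le₀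
      apply one_le_pow₀
      have : 0 ≤ t * ‖(0 : EuclideanSpace ℝ (Fin 1)) + EuclideanSpace.single 0 s‖ := by positivity
      linarith
    have h2 : M * t ^ 1 / t ^ (1 + 1) = M / t := by field_simp
    rw [h2]
    exact mul_le_of_le_one_right (by positivity) hdec
  obtain ⟨a, ha⟩ := exists_rightLimit (γ := γ) (K := M / t) (by positivity)
    (fun s hs => hdiff s hs.ne') (fun s hs => hder s hs.ne')
  obtain ⟨b, hb⟩ := exists_rightLimit (γ := fun s => γ (-s)) (K := M / t) (by positivity)
    (fun s hs => (hdiff (-s) (by linarith)).comp s differentiableAt_id.neg)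
    (fun s hs => by
      rw [deriv_comp_neg, norm_neg]; exact hder _ (by linarith))
  have hval : ∀ s : ℝ, s ≠ 0 → ‖γ s‖ ≤ M / t ^ 2 := by
    intro s hs
    have h1 := hg.norm_le le_rfl (h0 s hs)
    rw [zero_add] at h1
    refine h1.trans (mul_le_of_le_one_right (by positivity) ?_)
    unfold decay
    apply inv_le_one_of_one_le₀
    apply one_le_pow₀
    have : 0 ≤ t * ‖(EuclideanSpace.single 0 s : EuclideanSpace ℝ (Fin 1))‖ := by positivity
    linarith
  have key : ∀ c v : ℂ, ‖v‖ ≤ M / t ^ 2 → ‖v - c‖ ≤ L * (M / t) * (1 / t) →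
      ‖c‖ ≤ (1 + L) * M / t ^ 2 := by
    intro c v h1 h2
    have h3 := norm_sub_le v (v - c)
    rw [sub_sub_cancel] at h3
    refine h3.trans ((add_le_add h1 h2).trans (le_of_eq ?_))
    field_simp
  have t1 : 0 < 1 / t := by positivity
  have ha' := key a _ (hval (1 / t) t1.ne') (ha _ t1)
  have hb' := key b _ (hval (-(1 / t)) (by linarith)) (hb _ t1)
  have hexp : ∀ s : ℝ, 0 < s → ‖(1 : ℂ) - Complex.exp (-t * s)‖ ≤ t * s := by
    intro s hs
    have h1 : (1 : ℂ) - Complex.exp (-t * s) = ((1 - rexp (-(t * s)) : ℝ) : ℂ) := by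
      push_cast; ring_nf
    have h2 : rexp (-(t * s)) ≤ 1 := exp_le_one_iff.2 (by have := mul_pos ht hs; linarith)
    rw [h1, Complex.norm_real, norm_of_nonneg (by linarith)]
    linarith [add_one_le_exp (-(t * s))]
  have hJ : ‖(a - b) / 2‖ ≤ (1 + L) * M / t ^ 2 := by
    rw [norm_div, Complex.norm_two, div_le_iff₀ two_pos]
    linarith [norm_sub_le a b]
  have fin : ∀ s : ℝ, 0 < s → ∀ u v : ℂ, ‖u‖ ≤ L * (M / t) * s → v = 1 - Complex.exp (-t * s) ∨
      v = -(1 - Complex.exp (-t * s)) → ‖u + (a - b) / 2 * v‖ ≤ (1 + 2 * L) * M / t * s := by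
    intro s hs u v hu hv
    have hv' : ‖v‖ ≤ t * s := by
      rcases hv with rfl | rfl
      · exact hexp s hs
      · rw [norm_neg]; exact hexp s hs
    refine (norm_add_le _ _).trans ?_
    rw [norm_mul]
    refine (add_le_add hu (mul_le_mul hJ hv' (norm_nonneg _) (by positivity))).trans (le_of_eq ?_)
    field_simp; ring
  refine ⟨(a - b) / 2, (a + b) / 2, hJ, fun s hs => ?_⟩
  rcases lt_or_gt_of_ne hs with h | h
  · rw [oddSymbol_of_neg t h, abs_of_neg h]
    have h1 := hb (-s) (by linarith)
    rw [neg_neg] at h1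
    refine le_trans (le_of_eq ?_) (fin (-s) (by linarith) _ _ h1 (Or.inr rfl))
    congr 1
    push_cast
    rw [show -(t : ℂ) * -s = t * s by ring]
    ring
  · rw [oddSymbol_of_pos t h, abs_of_pos h]
    refine le_trans (le_of_eq ?_) (fin s h _ _ (ha s h) (Or.inl rfl))
    congr 1
    ring

theorem exists_mulOp_bound_one {q : ℝ} (hq : 1 < q) :
    ∃ C : ℝ, 0 ≤ C ∧ ∀ t : ℝ, 0 < t → ∀ M : ℝ, 0 ≤ M → ∀ g : EuclideanSpace ℝ (Fin 1) → ℂ,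
      SymbolBound 1 t M g → ∀ h, Measurable h → Integrable h →
      ∫⁻ x, ‖mulOp g h x‖ₑ ^ q ≤
        ENNReal.ofReal (C * M / t ^ 2) ^ q * ∫⁻ z, ‖h z‖ₑ ^ q := by
  obtain ⟨C, hC, hk⟩ := exists_lintegral_invFourier_le (d := 1) le_rfl
  obtain ⟨D, hD, hD'⟩ := exists_mulOp_oddSymbol_bound hq
  set L : ℝ := ((lipschitzExtensionConstant ℂ : NNReal) : ℝ)
  have hL : 0 ≤ L := NNReal.coe_nonneg _
  have q0 : 0 ≤ q := by linarith
  set I : ℝ := ∫ ξ, decay 1 1 ξ with hI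
  have hI0 : 0 ≤ I := integral_decay_nonneg 1
  set a : ℝ := 1 + 2 * (1 + L) with ha
  set K : ℝ := a + (a * (1 + 2 * π) ^ 2 * I + 12 * (1 + 2 * L)) with hK
  have hK0 : 0 ≤ K := by positivity
  set Z : ENNReal := 2 ^ (q - 1) * (ENNReal.ofReal (C * K) ^ q + ENNReal.ofReal (1 + L) ^ q * D)
  have hZ : Z ≠ ⊤ := by
    refine ENNReal.mul_ne_top (ENNReal.rpow_ne_top_of_nonneg (by linarith) (by simp))
      (ENNReal.add_ne_top.2 ⟨ENNReal.rpow_ne_top_of_nonneg q0 ENNReal.ofReal_ne_top,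
        ENNReal.mul_ne_top (ENNReal.rpow_ne_top_of_nonneg q0 ENNReal.ofReal_ne_top) hD⟩)
  refine ⟨(Z ^ (1 / q)).toReal, ENNReal.toReal_nonneg, fun t ht M hM g hg h hm hh => ?_⟩
  obtain ⟨J, m, hJ, hJm⟩ := hg.exists_jump ht hM
  have hψ := symbolBound_oddSymbol ht
  have ht2 : 0 < t ^ 2 := by positivity
  have hgc := hg.sub_const_mul hψ J
  have hle : M + ‖J‖ * (2 * t ^ 2) ≤ a * M := by
    have : ‖J‖ * (2 * t ^ 2) ≤ (1 + L) * M / t ^ 2 * (2 * t ^ 2) := by gcongr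
    refine (add_le_add_right this M).trans (le_of_eq ?_)
    field_simp; ring
  have hgc' : SymbolBound 1 t (a * M) fun ξ => g ξ - J * oddSymbol t ξ :=
    ⟨hgc.measurable, hgc.contDiffAt, fun ξ hξ j n hn => (hgc.bound ξ hξ j n hn).trans (by
      have := decay_nonneg ht.le ξ
      gcongr)⟩
  have ha0 : 0 ≤ a * M := by positivity
  have hgi := hgc'.integrable ht le_rfl
  have b1 : ∫⁻ x, ‖mulOp (fun ξ => g ξ - J * oddSymbol t ξ) h x‖ₑ ^ q ≤
      (ENNReal.ofReal (C * K) * ENNReal.ofReal (M / t ^ 2)) ^ q * ∫⁻ z, ‖h z‖ₑ ^ q := by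
    refine (lintegral_mulOp_le hq hgc'.measurable hgi hm hh).trans ?_
    gcongr
    rw [← ENNReal.ofReal_mul (by positivity), show C * K * (M / t ^ 2) = C *
        (K * M) / t ^ 2 by ring]
    refine hk t ht (K * M) (by positivity) _ hgi ?_ ?_
    · filter_upwards [ae_ne_zero le_rfl] with ξ hξ
      refine (hgc'.norm_le le_rfl hξ).trans ?_
      have := decay_nonneg ht.le ξ
      gcongr
      exact le_add_of_nonneg_right (by positivity)
    · intro j r hr htr
      obtain rfl : j = 0 := Subsingleton.elim _ _
      rw [Nat.cast_one, sqrt_one, mul_one] at htr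
      refine (integral_fwdDiff_two_le ht ha0 (by positivity) hgc' hJm hr htr).trans ?_
      rw [pow_one]
      gcongr
      rw [hK, add_mul a]
      refine le_trans (le_of_eq ?_) (le_add_of_nonneg_left ha0)
      ring
  have b2 : ∫⁻ x, ‖J * mulOp (oddSymbol t) h x‖ₑ ^ q ≤
      (ENNReal.ofReal (1 + L) * ENNReal.ofReal (M / t ^ 2)) ^ q * (D * ∫⁻ z, ‖h z‖ₑ ^ q) := by
    simp_rw [enorm_mul, ENNReal.mul_rpow_of_nonneg _ _ q0]
    rw [lintegral_const_mul' _ _ (ENNReal.rpow_ne_top_of_nonneg q0 enorm_ne_top),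
      ← ENNReal.mul_rpow_of_nonneg _ _ q0]
    refine mul_le_mul' (ENNReal.rpow_le_rpow ?_ q0) (hD' t ht h hm hh)
    rw [← ENNReal.ofReal_mul (by positivity), ← ofReal_norm]
    exact ENNReal.ofReal_le_ofReal (hJ.trans (le_of_eq (by ring)))
  have hZq : (Z ^ (1 / q)) ^ q = Z := by
    rw [← ENNReal.rpow_mul, one_div_mul_cancel (by linarith), ENNReal.rpow_one]
  have hsplit : ∀ x, ‖mulOp g h x‖ₑ ^ q ≤ 2 ^ (q - 1) *
      (‖mulOp (fun ξ => g ξ - J * oddSymbol t ξ) h x‖ₑ ^ q +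
        ‖J * mulOp (oddSymbol t) h x‖ₑ ^ q) := by
    intro x
    refine le_trans ?_ (ENNReal.rpow_add_le_mul_rpow_add_rpow _ _ hq.le)
    refine ENNReal.rpow_le_rpow ?_ q0
    rw [mulOp_sub_const_mul hg.measurable (hg.integrable ht le_rfl) hψ.measurable
      (hψ.integrable ht le_rfl) hh]
    refine le_trans (le_of_eq ?_) (enorm_add_le _ _)
    rw [sub_add_cancel]
  refine (lintegral_mono hsplit).trans ?_
  rw [lintegral_const_mul' _ _ (ENNReal.rpow_ne_top_of_nonneg (by linarith) (by simp)),
    lintegral_add_left]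
  · refine (mul_le_mul_right (add_le_add b1 b2) _).trans (le_of_eq ?_)
    rw [mul_div_assoc, ENNReal.ofReal_mul ENNReal.toReal_nonneg, ENNReal.ofReal_toReal
      (ENNReal.rpow_ne_top_of_nonneg (by positivity) hZ), ENNReal.mul_rpow_of_nonneg _ _ q0,
      ENNReal.mul_rpow_of_nonneg _ _ q0, ENNReal.mul_rpow_of_nonneg _ _ q0, hZq]
    ring
  · refine Measurable.pow_const (Measurable.enorm ?_) q
    exact measurable_mulOp hgc'.measurable hm

theorem exists_mulOp_bound {d : ℕ} (hd : 1 ≤ d) {q : ℝ} (hq : 1 < q) :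
    ∃ C : ℝ, 0 ≤ C ∧ ∀ t : ℝ, 0 < t → ∀ M : ℝ, 0 ≤ M → ∀ g : EuclideanSpace ℝ (Fin d) → ℂ,
      SymbolBound d t M g → ∀ h, Measurable h → Integrable h →
      ∫⁻ x, ‖mulOp g h x‖ₑ ^ q ≤
        ENNReal.ofReal (C * M / t ^ (d + 1)) ^ q * ∫⁻ z, ‖h z‖ₑ ^ q := by
  rcases hd.eq_or_lt with rfl | h
  · exact exists_mulOp_bound_one hq
  · exact exists_mulOp_bound_of_two_le h hq

theorem re_cpow_half (z : ℂ) : (z ^ ((1 : ℂ) / 2)).re = √((‖z‖ + z.re) / 2) := by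
  have h : z ^ ((1 : ℂ) / 2) = z.sqrt := by
    simp [Complex.sqrt]
  rw [h, Complex.sqrt_eq_real_add_ite]
  split_ifs <;> simp

theorem norm_cpow_half (z : ℂ) : ‖z ^ ((1 : ℂ) / 2)‖ = √‖z‖ := by
  rcases eq_or_ne z 0 with rfl | h
  · simp
  · rw [Complex.norm_cpow_of_ne_zero h, sqrt_eq_rpow]; simp

theorem cpow_half_sq (z : ℂ) : (z ^ ((1 : ℂ) / 2)) ^ 2 = z := by
  rw [one_div]; exact Complex.cpow_nat_inv_pow z two_ne_zero

theorem mem_slitPlane_of_norm_add_re_pos {z : ℂ} (h : 0 < ‖z‖ + z.re) : z ∈ Complex.slitPlane := by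
  rw [Complex.mem_slitPlane_iff]
  by_contra! hc
  have : z = (z.re : ℂ) := Complex.ext rfl (by simp [hc.2])
  rw [this, Complex.norm_real, Complex.ofReal_re, norm_of_nonpos hc.1] at h
  linarith

theorem norm_add_re_add_sq_ge {b : ℝ} {ν : ℂ} (hν : ν ≠ 0) (hb : b * ‖ν‖ ≤ ‖ν‖ + ν.re) (r : ℝ)
    (δ : ℂ) :
    b * (‖ν‖ + r ^ 2) - 2 * ‖δ‖ ≤ ‖ν + (r : ℂ) ^ 2 + δ‖ + (ν + (r : ℂ) ^ 2 + δ).re := by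
  have hn : 0 < ‖ν‖ := norm_pos_iff.2 hν
  set z : ℂ := ν + (r : ℂ) ^ 2 with hz
  have hr2 : ((r : ℂ) ^ 2).re = r ^ 2 := by rw [← Complex.ofReal_pow, Complex.ofReal_re]
  have h1 : ‖ν‖ * (‖ν‖ + r ^ 2 * (ν.re / ‖ν‖)) ≤ ‖ν‖ * ‖z‖ := by
    have h2 : (z * (starRingEnd ℂ) ν).re ≤ ‖z * (starRingEnd ℂ) ν‖ := Complex.re_le_norm _
    rw [norm_mul, RCLike.norm_conj] at h2
    have h3 : (z * (starRingEnd ℂ) ν).re = ‖ν‖ ^ 2 + r ^ 2 * ν.re := by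
      rw [hz, add_mul, Complex.mul_conj, Complex.add_re, Complex.ofReal_re,
          Complex.normSq_eq_norm_sq,
        ← Complex.ofReal_pow, Complex.re_ofReal_mul, Complex.conj_re]
    rw [h3] at h2
    field_simp
    linarith
  have h1' := le_of_mul_le_mul_left h1 hn
  have hb' : b ≤ 1 + ν.re / ‖ν‖ := by
    rw [← mul_le_mul_iff_left₀ hn]; field_simp; linarith
  have h4 := mul_le_mul_of_nonneg_right hb' (sq_nonneg r)
  have h5 : z.re = ν.re + r ^ 2 := by rw [hz, Complex.add_re, hr2]
  have h6 : ‖z‖ ≤ ‖z + δ‖ + ‖δ‖ := by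
    have := norm_sub_le (z + δ) δ
    rwa [add_sub_cancel_right] at this
  have h7 : -‖δ‖ ≤ δ.re := (abs_le.1 (Complex.abs_re_le_norm δ)).1
  rw [Complex.add_re, h5]
  nlinarith

/-- The square root `√(ν + |ξ|²)`, continued analytically in the `j`-th frequency variable. -/
noncomputable def rootLine (ν : ℂ) (ξ : EuclideanSpace ℝ (Fin d)) (j : Fin d) (z : ℂ) : ℂ :=
  (ν + (‖ξ‖ : ℂ) ^ 2 + (2 * z * ξ j + z ^ 2)) ^ ((1 : ℂ) / 2)

/-- The square root `√(ν + |ξ|²)`. -/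
noncomputable def rootA (ν : ℂ) (ξ : EuclideanSpace ℝ (Fin d)) : ℂ :=
  (ν + (‖ξ‖ : ℂ) ^ 2) ^ ((1 : ℂ) / 2)

/-- The frequency scale `|ν|^{1/2} + |ξ|`. -/
noncomputable def weight (ν : ℂ) (ξ : EuclideanSpace ℝ (Fin d)) : ℝ := √‖ν‖ + ‖ξ‖

theorem rootA_add_single (ν : ℂ) (ξ : EuclideanSpace ℝ (Fin d)) (j : Fin d) (s : ℝ) :
    rootA ν (ξ + EuclideanSpace.single j s) = rootLine ν ξ j s := by
  unfold rootA rootLine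
  have h : ‖ξ + EuclideanSpace.single j s‖ ^ 2 = ‖ξ‖ ^ 2 + (2 * s * ξ j + s ^ 2) := by
    rw [norm_add_sq_real, EuclideanSpace.inner_single_right, PiLp.norm_single, norm_eq_abs, sq_abs]
    simp; ring
  congr 1
  rw [add_assoc]
  congr 1
  exact_mod_cast h

theorem weight_pos {ν : ℂ} (hν : ν ≠ 0) (ξ : EuclideanSpace ℝ (Fin d)) : 0 < weight ν ξ := by
  have : 0 < √‖ν‖ := sqrt_pos.2 (norm_pos_iff.2 hν)
  unfold weight; positivity

theorem norm_perturbation_le {ε : ℝ} (hε : ε ≤ 1) {ν : ℂ} (hν : ν ≠ 0)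
    (ξ : EuclideanSpace ℝ (Fin d)) (j : Fin d) {z : ℂ} (hz : ‖z‖ ≤ ε * weight ν ξ) :
    ‖2 * z * ξ j + z ^ 2‖ ≤ 3 * ε * weight ν ξ ^ 2 := by
  have hw := weight_pos hν ξ
  have hε0 : 0 ≤ ε := by
    by_contra! h
    have := norm_nonneg z
    nlinarith
  have h1 : |ξ j| ≤ weight ν ξ := by
    have := PiLp.norm_apply_le ξ j
    have h2 : 0 ≤ √‖ν‖ := sqrt_nonneg _
    rw [norm_eq_abs] at this
    unfold weight; linarith
  refine (norm_add_le _ _).trans ?_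
  rw [norm_mul, norm_mul, norm_pow, Complex.norm_two, Complex.norm_real, norm_eq_abs]
  have h3 : ‖z‖ * |ξ j| ≤ ε * weight ν ξ * weight ν ξ := by gcongr
  have h4 : ‖z‖ ^ 2 ≤ (ε * weight ν ξ) ^ 2 := by gcongr
  have h5 : ε ^ 2 * weight ν ξ ^ 2 ≤ ε * weight ν ξ ^ 2 := by
    gcongr; nlinarith
  nlinarith

theorem weight_sq_le (ν : ℂ) (ξ : EuclideanSpace ℝ (Fin d)) :
    weight ν ξ ^ 2 ≤ 2 * (‖ν‖ + ‖ξ‖ ^ 2) := by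
  unfold weight
  have := sq_sqrt (norm_nonneg ν)
  nlinarith [sq_nonneg (√‖ν‖ - ‖ξ‖)]

theorem le_weight_sq (ν : ℂ) (ξ : EuclideanSpace ℝ (Fin d)) :
    ‖ν‖ + ‖ξ‖ ^ 2 ≤ weight ν ξ ^ 2 := by
  unfold weight
  have := sq_sqrt (norm_nonneg ν)
  nlinarith [mul_nonneg (sqrt_nonneg ‖ν‖) (norm_nonneg ξ)]

theorem radicand_line_ge {b : ℝ} (hb0 : 0 < b) (hb1 : b ≤ 1) {ν : ℂ} (hν : ν ≠ 0)
    (hb : b * ‖ν‖ ≤ ‖ν‖ + ν.re) (ξ : EuclideanSpace ℝ (Fin d)) (j : Fin d) {z : ℂ}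
    (hz : ‖z‖ ≤ b / 24 * weight ν ξ) :
    b / 4 * weight ν ξ ^ 2 ≤ ‖ν + (‖ξ‖ : ℂ) ^ 2 + (2 * z * ξ j + z ^ 2)‖ +
      (ν + (‖ξ‖ : ℂ) ^ 2 + (2 * z * ξ j + z ^ 2)).re := by
  refine le_trans ?_ (norm_add_re_add_sq_ge hν hb ‖ξ‖ _)
  have h1 := norm_perturbation_le (by linarith) hν ξ j hz
  have h2 := mul_le_mul_of_nonneg_left (weight_sq_le ν ξ) hb0.le
  linarith

theorem le_re_rootLine {b : ℝ} (hb0 : 0 < b) (hb1 : b ≤ 1) {ν : ℂ} (hν : ν ≠ 0)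
    (hb : b * ‖ν‖ ≤ ‖ν‖ + ν.re) (ξ : EuclideanSpace ℝ (Fin d)) (j : Fin d) {z : ℂ}
    (hz : ‖z‖ ≤ b / 24 * weight ν ξ) : √(b / 8) * weight ν ξ ≤ (rootLine ν ξ j z).re := by
  rw [rootLine, re_cpow_half]
  apply le_sqrt_of_sq_le
  rw [mul_pow, sq_sqrt (by positivity)]
  have := radicand_line_ge hb0 hb1 hν hb ξ j hz
  linarith

theorem norm_rootLine_le {b : ℝ} (hb1 : b ≤ 1) {ν : ℂ} (hν : ν ≠ 0)
    (ξ : EuclideanSpace ℝ (Fin d)) (j : Fin d) {z : ℂ}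
    (hz : ‖z‖ ≤ b / 24 * weight ν ξ) : ‖rootLine ν ξ j z‖ ≤ 2 * weight ν ξ := by
  rw [rootLine, norm_cpow_half]
  have hw := weight_pos hν ξ
  rw [sqrt_le_left (by positivity)]
  refine (norm_add_le _ _).trans ?_
  have h1 := norm_perturbation_le (by linarith) hν ξ j hz
  have h2 : ‖ν + (‖ξ‖ : ℂ) ^ 2‖ ≤ ‖ν‖ + ‖ξ‖ ^ 2 := by
    refine (norm_add_le _ _).trans (le_of_eq ?_)
    rw [norm_pow, Complex.norm_real, norm_norm]
  have h3 := le_weight_sq ν ξ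
  nlinarith [sq_nonneg (weight ν ξ)]

theorem rootLine_differentiableAt {b : ℝ} (hb0 : 0 < b) (hb1 : b ≤ 1) {ν : ℂ} (hν : ν ≠ 0)
    (hb : b * ‖ν‖ ≤ ‖ν‖ + ν.re) (ξ : EuclideanSpace ℝ (Fin d)) (j : Fin d) {z : ℂ}
    (hz : ‖z‖ ≤ b / 24 * weight ν ξ) : DifferentiableAt ℂ (rootLine ν ξ j) z := by
  have hw := weight_pos hν ξ
  have h1 := radicand_line_ge hb0 hb1 hν hb ξ j hz
  have h2 := mem_slitPlane_of_norm_add_re_pos (lt_of_lt_of_le (by positivity) h1)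
  unfold rootLine
  exact DifferentiableAt.cpow_const (by fun_prop) h2

/-- The symbols `|ν|^{1/2}`, `iξ_j` and `-√(ν + |ξ|²)` which represent, respectively, multiplication
by `|ν|^{1/2}`, tangential differentiation and normal differentiation. -/
noncomputable def sym (ν : ℂ) : Fin d ⊕ Bool → EuclideanSpace ℝ (Fin d) → ℂ
  | .inl j, ξ => Complex.I * ξ j
  | .inr false, _ => (√‖ν‖ : ℝ)
  | .inr true, ξ => -rootA ν ξ

/-- Analytic continuation of `sym` along the `j`-th frequency variable. -/
noncomputable def symLine (ν : ℂ) (i : Fin d ⊕ Bool) (ξ : EuclideanSpace ℝ (Fin d)) (j : Fin d)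
    (z : ℂ) : ℂ :=
  match i with
  | .inl k => Complex.I * (ξ k + if k = j then z else 0)
  | .inr false => (√‖ν‖ : ℝ)
  | .inr true => -rootLine ν ξ j z

theorem sym_add_single (ν : ℂ) (i : Fin d ⊕ Bool) (ξ : EuclideanSpace ℝ (Fin d)) (j : Fin d)
    (s : ℝ) : sym ν i (ξ + EuclideanSpace.single j s) = symLine ν i ξ j s := by
  match i with
  | .inl k =>
    simp only [sym, symLine, PiLp.add_apply, PiLp.single_apply]
    split_ifs <;> simp
  | .inr false => rfl
  | .inr true => simp only [sym, symLine, rootA_add_single]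

theorem symLine_differentiableAt {b : ℝ} (hb0 : 0 < b) (hb1 : b ≤ 1) {ν : ℂ} (hν : ν ≠ 0)
    (hb : b * ‖ν‖ ≤ ‖ν‖ + ν.re) (i : Fin d ⊕ Bool) (ξ : EuclideanSpace ℝ (Fin d)) (j : Fin d)
        {z : ℂ}
    (hz : ‖z‖ ≤ b / 24 * weight ν ξ) : DifferentiableAt ℂ (symLine ν i ξ j) z := by
  unfold symLine
  match i with
  | .inl k => dsimp only; split_ifs <;> fun_prop
  | .inr false => fun_prop
  | .inr true => exact (rootLine_differentiableAt hb0 hb1 hν hb ξ j hz).neg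

theorem norm_symLine_le {b : ℝ} (hb1 : b ≤ 1) {ν : ℂ} (hν : ν ≠ 0) (i : Fin d ⊕ Bool)
    (ξ : EuclideanSpace ℝ (Fin d)) (j : Fin d) {z : ℂ}
    (hz : ‖z‖ ≤ b / 24 * weight ν ξ) : ‖symLine ν i ξ j z‖ ≤ 2 * weight ν ξ := by
  have hw := weight_pos hν ξ
  unfold symLine
  match i with
  | .inl k =>
    have h1 : ‖ξ k‖ ≤ weight ν ξ :=
      (PiLp.norm_apply_le ξ k).trans (le_add_of_nonneg_left (sqrt_nonneg _))
    have h2 : ‖if k = j then z else 0‖ ≤ weight ν ξ := by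
      split_ifs
      · nlinarith
      · simpa using hw.le
    simp only [norm_mul, Complex.norm_I, one_mul]
    refine (norm_add_le _ _).trans ?_
    rw [Complex.norm_real]
    linarith
  | .inr false =>
    have : √‖ν‖ ≤ weight ν ξ := le_add_of_nonneg_right (norm_nonneg _)
    simp only [Complex.norm_real, norm_of_nonneg (sqrt_nonneg _)]
    linarith
  | .inr true =>
    rw [norm_neg]
    exact norm_rootLine_le hb1 hν ξ j hz

/-- The symbol `s_i s_k s_l A^{d-1} e^{-At}`. -/
noncomputable def kernelSymbol (ν : ℂ) (i k l : Fin d ⊕ Bool) (t : ℝ)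
    (ξ : EuclideanSpace ℝ (Fin d)) : ℂ :=
  sym ν i ξ * sym ν k ξ * sym ν l ξ * rootA ν ξ ^ (d - 1) * Complex.exp (-rootA ν ξ * t)

/-- Analytic continuation of `kernelSymbol` along the `j`-th frequency variable. -/
noncomputable def kernelLine (ν : ℂ) (i k l : Fin d ⊕ Bool) (t : ℝ)
    (ξ : EuclideanSpace ℝ (Fin d)) (j : Fin d) (z : ℂ) : ℂ :=
  symLine ν i ξ j z * symLine ν k ξ j z * symLine ν l ξ j z * rootLine ν ξ j z ^ (d - 1) *
    Complex.exp (-rootLine ν ξ j z * t)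

theorem kernelSymbol_add_single (ν : ℂ) (i k l : Fin d ⊕ Bool) (t : ℝ)
    (ξ : EuclideanSpace ℝ (Fin d)) (j : Fin d) (s : ℝ) :
    kernelSymbol ν i k l t (ξ + EuclideanSpace.single j s) = kernelLine ν i k l t ξ j s := by
  simp only [kernelSymbol, kernelLine, sym_add_single, rootA_add_single]

theorem kernelLine_differentiableAt {b : ℝ} (hb0 : 0 < b) (hb1 : b ≤ 1) {ν : ℂ} (hν : ν ≠ 0)
    (hb : b * ‖ν‖ ≤ ‖ν‖ + ν.re) (i k l : Fin d ⊕ Bool) (t : ℝ) (ξ : EuclideanSpace ℝ (Fin d))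
    (j : Fin d) {z : ℂ} (hz : ‖z‖ ≤ b / 24 * weight ν ξ) :
    DifferentiableAt ℂ (kernelLine ν i k l t ξ j) z := by
  have h1 := fun i => symLine_differentiableAt hb0 hb1 hν hb i ξ j hz
  have h2 := rootLine_differentiableAt hb0 hb1 hν hb ξ j hz
  have hi := h1 i
  have hk := h1 k
  have hl := h1 l
  unfold kernelLine
  fun_prop

theorem norm_kernelLine_le {b : ℝ} (hb0 : 0 < b) (hb1 : b ≤ 1) {ν : ℂ} (hν : ν ≠ 0)
    (hb : b * ‖ν‖ ≤ ‖ν‖ + ν.re) (hd : 1 ≤ d) (i k l : Fin d ⊕ Bool) {t : ℝ} (ht : 0 ≤ t)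
    (ξ : EuclideanSpace ℝ (Fin d)) (j : Fin d) {z : ℂ} (hz : ‖z‖ ≤ b / 24 * weight ν ξ) :
    ‖kernelLine ν i k l t ξ j z‖ ≤
      (2 * weight ν ξ) ^ (d + 2) * rexp (-(√(b / 8) * (t * weight ν ξ))) := by
  have hw := weight_pos hν ξ
  have h1 := fun i => norm_symLine_le hb1 hν i ξ j hz
  have h2 := norm_rootLine_le hb1 hν ξ j hz
  have h3 := le_re_rootLine hb0 hb1 hν hb ξ j hz
  unfold kernelLine
  have h4 : (2 * weight ν ξ) ^ (d + 2) = 2 * weight ν ξ * (2 * weight ν ξ) * (2 * weight ν ξ) *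
      (2 * weight ν ξ) ^ (d - 1) := by
    obtain ⟨m, rfl⟩ : ∃ m, d = m + 1 := ⟨d - 1, by omega⟩
    rw [Nat.add_sub_cancel]; ring
  rw [h4, norm_mul, norm_mul, norm_mul, norm_mul, norm_pow, Complex.norm_exp]
  gcongr
  · exact h1 i
  · exact h1 k
  · exact h1 l
  · rw [Complex.re_mul_ofReal, Complex.neg_re]
    nlinarith

theorem iteratedDeriv_comp_ofReal {Q : ℂ → ℂ} {U : Set ℂ} (hU : IsOpen U)
    (hQ : DifferentiableOn ℂ Q U) (n : ℕ) {s : ℝ} (hs : (s : ℂ) ∈ U) :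
    iteratedDeriv n (fun s : ℝ => Q s) s = iteratedDeriv n Q s := by
  induction n generalizing s with
  | zero => simp
  | succ n ih =>
    rw [iteratedDeriv_succ, iteratedDeriv_succ]
    have h1 : iteratedDeriv n (fun s : ℝ => Q s) =ᶠ[nhds s] fun s : ℝ => iteratedDeriv n Q s := by
      filter_upwards [(Complex.continuous_ofReal.tendsto s).eventually (hU.mem_nhds hs)] with r hr
        using ih hr
    rw [h1.deriv_eq]
    have h2 : ContDiffAt ℂ (n + 1 : ℕ) Q s :=
      ((hQ.contDiffOn hU).contDiffAt (hU.mem_nhds hs))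
    have h3 : DifferentiableAt ℂ (iteratedDeriv n Q) s := by
      have h4 := h2.differentiableAt_iteratedFDeriv (m := n) (by exact_mod_cast n.lt_succ_self)
      have : iteratedDeriv n Q = fun x => iteratedFDeriv ℂ n Q x (fun _ => 1) := by
        ext x; rw [iteratedDeriv_eq_iteratedFDeriv]
      rw [this]
      exact (h4.hasFDerivAt.continuousMultilinear_apply_const _).differentiableAt
    exact (h3.hasDerivAt.comp_ofReal).deriv

theorem norm_iteratedDeriv_kernelSymbol_le {b : ℝ} (hb0 : 0 < b) (hb1 : b ≤ 1) {ν : ℂ} (hν : ν ≠ 0)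
    (hb : b * ‖ν‖ ≤ ‖ν‖ + ν.re) (hd : 1 ≤ d) (i k l : Fin d ⊕ Bool) {t : ℝ} (ht : 0 ≤ t)
    (ξ : EuclideanSpace ℝ (Fin d)) (j : Fin d) (n : ℕ) :
    ‖iteratedDeriv n (fun s : ℝ => kernelSymbol ν i k l t (ξ + EuclideanSpace.single j s)) 0‖ ≤
      n.factorial * ((2 * weight ν ξ) ^ (d + 2) * rexp (-(√(b / 8) * (t * weight ν ξ)))) /
        (b / 24 * weight ν ξ) ^ n := by
  have hw := weight_pos hν ξ
  have hR : 0 < b / 24 * weight ν ξ := by positivity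
  have hdiff : DifferentiableOn ℂ (kernelLine ν i k l t ξ j) (Metric.closedBall 0
      (b / 24 * weight ν ξ)) :=
    fun z hz => (kernelLine_differentiableAt hb0 hb1 hν hb i k l t ξ j
      (by simpa using hz)).differentiableWithinAt
  simp_rw [kernelSymbol_add_single]
  rw [iteratedDeriv_comp_ofReal Metric.isOpen_ball (hdiff.mono Metric.ball_subset_closedBall) n
    (by simpa using hR), Complex.ofReal_zero]
  refine Complex.norm_iteratedDeriv_le_of_forall_mem_sphere_norm_le n hR ?_ fun z hz => ?_
  · exact DifferentiableOn.diffContOnCl (by rwa [closure_ball _ hR.ne'])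
  · exact norm_kernelLine_le hb0 hb1 hν hb hd i k l ht ξ j (by simpa using (le_of_eq hz))

theorem contDiff_rootA {b : ℝ} (hb0 : 0 < b) {ν : ℂ} (hν : ν ≠ 0)
    (hb : b * ‖ν‖ ≤ ‖ν‖ + ν.re) (n : ℕ∞) :
    ContDiff ℝ n (rootA ν : EuclideanSpace ℝ (Fin d) → ℂ) := by
  rw [contDiff_iff_contDiffAt]
  intro ξ
  have hn : 0 < ‖ν‖ := norm_pos_iff.2 hν
  have h1 := norm_add_re_add_sq_ge hν hb ‖ξ‖ 0
  rw [add_zero, norm_zero, mul_zero, sub_zero] at h1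
  have h2 := mem_slitPlane_of_norm_add_re_pos (lt_of_lt_of_le (by positivity) h1)
  have h3 : ContDiffAt ℝ n (fun z : ℂ => z ^ ((1 : ℂ) / 2)) (ν + (‖ξ‖ : ℂ) ^ 2) :=
    ((analyticAt_id.cpow analyticAt_const h2).contDiffAt (n := n)).restrict_scalars ℝ
  have h4 : ContDiff ℝ n fun ξ : EuclideanSpace ℝ (Fin d) => ν + (‖ξ‖ : ℂ) ^ 2 := by
    have : (fun ξ : EuclideanSpace ℝ (Fin d) => ν + (‖ξ‖ : ℂ) ^ 2) =
        fun ξ => ν + Complex.ofRealCLM (‖ξ‖ ^ 2) := by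
      funext ξ; simp
    rw [this]
    exact contDiff_const.add (Complex.ofRealCLM.contDiff.comp (contDiff_norm_sq ℝ))
  exact h3.comp ξ h4.contDiffAt

theorem contDiff_sym {b : ℝ} (hb0 : 0 < b) {ν : ℂ} (hν : ν ≠ 0)
    (hb : b * ‖ν‖ ≤ ‖ν‖ + ν.re) (i : Fin d ⊕ Bool) (n : ℕ∞) : ContDiff ℝ n (sym ν i) := by
  match i with
  | .inl k =>
    have h1 : ContDiff ℝ n fun ξ : EuclideanSpace ℝ (Fin d) => ξ k := by fun_prop
    exact contDiff_const.mul (Complex.ofRealCLM.contDiff.comp h1)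
  | .inr false => exact contDiff_const
  | .inr true => exact (contDiff_rootA hb0 hν hb n).neg

theorem contDiff_kernelSymbol {b : ℝ} (hb0 : 0 < b) {ν : ℂ} (hν : ν ≠ 0)
    (hb : b * ‖ν‖ ≤ ‖ν‖ + ν.re) (i k l : Fin d ⊕ Bool) (t : ℝ) (n : ℕ∞) :
    ContDiff ℝ n (kernelSymbol ν i k l t) := by
  have h1 := contDiff_rootA (d := d) hb0 hν hb n
  exact ((((contDiff_sym hb0 hν hb i n).mul (contDiff_sym hb0 hν hb k n)).mul
    (contDiff_sym hb0 hν hb l n)).mul (h1.pow _)).mul ((h1.neg.mul contDiff_const).cexp)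

/-- Symbols of order `-1`, smooth away from the origin, at the frequency scale of `ν`. -/
structure OrderNegOne (d : ℕ) (ν : ℂ) (c : ℝ) (l : EuclideanSpace ℝ (Fin d) → ℂ) : Prop where
  contDiffOn : ContDiffOn ℝ (⊤ : ℕ∞) l {0}ᶜ
  bound : ∀ ξ, ξ ≠ 0 → ∀ n : ℕ, n ≤ d + 1 →
    ‖iteratedFDeriv ℝ n l ξ‖ ≤ c / weight ν ξ ^ (n + 1)

theorem measurable_of_continuousOn_compl_zero {l : EuclideanSpace ℝ (Fin d) → ℂ}
    (h : ContinuousOn l {0}ᶜ) : Measurable l :=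
  measurable_of_continuousOn_compl_singleton 0 h

theorem norm_iteratedDeriv_line_le {l : EuclideanSpace ℝ (Fin d) → ℂ}
    (hl : ContDiffOn ℝ (⊤ : ℕ∞) l {0}ᶜ) {ξ : EuclideanSpace ℝ (Fin d)} (hξ : ξ ≠ 0) (j : Fin d)
    (n : ℕ) :
    ‖iteratedDeriv n (fun s : ℝ => l (ξ + EuclideanSpace.single j s)) 0‖ ≤
      ‖iteratedFDeriv ℝ n l ξ‖ := by
  set g : ℝ →L[ℝ] EuclideanSpace ℝ (Fin d) :=
    ContinuousLinearMap.toSpanSingleton ℝ (EuclideanSpace.single j (1 : ℝ)) with hg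
  have hgs : ∀ s, g s = EuclideanSpace.single j s := by
    intro s; ext i; simp [hg]
  set S : Set (EuclideanSpace ℝ (Fin d)) := (fun y => ξ + y) ⁻¹' {0}ᶜ with hS
  have hSo : IsOpen S := isOpen_compl_singleton.preimage (by fun_prop)
  have hgo : IsOpen (g ⁻¹' S) := hSo.preimage g.continuous
  have hf : ContDiffOn ℝ (⊤ : ℕ∞) (fun y => l (ξ + y)) S :=
    hl.comp (contDiff_const.add contDiff_id).contDiffOn fun y hy => hy
  have h0 : g 0 ∈ S := by simpa [hS] using hξ
  have h1 := g.iteratedFDerivWithin_comp_right hf hSo.uniqueDiffOn hgo.uniqueDiffOn h0 (i := n)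
    (by exact_mod_cast le_top)
  rw [iteratedFDerivWithin_of_isOpen n hgo h0, iteratedFDerivWithin_of_isOpen n hSo h0,
    iteratedFDeriv_comp_add_left, map_zero, add_zero] at h1
  have h2 : (fun s : ℝ => l (ξ + EuclideanSpace.single j s)) = (fun y => l (ξ + y)) ∘ g := by
    funext s; simp [hgs]
  rw [← norm_iteratedFDeriv_eq_norm_iteratedDeriv, h2, h1]
  refine (ContinuousMultilinearMap.norm_compContinuousLinearMap_le _ _).trans (le_of_eq ?_)
  simp [hg]

theorem exists_pow_mul_exp_neg_le (m : ℕ) {a : ℝ} (ha : 0 < a) :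
    ∃ C : ℝ, 0 < C ∧ ∀ x : ℝ, 0 ≤ x → (1 + x) ^ m * rexp (-(a * x)) ≤ C := by
  refine ⟨m.factorial * rexp a / a ^ m, by positivity, fun x hx => ?_⟩
  have h1 := pow_div_factorial_le_exp (a * (1 + x)) (by positivity) m
  rw [exp_neg, ← div_eq_mul_inv, div_le_div_iff₀ (exp_pos _) (by positivity)]
  rw [div_le_iff₀ (by positivity), mul_pow, mul_add, mul_one, exp_add] at h1
  linarith

theorem exists_symbolBound {b : ℝ} (hb0 : 0 < b) (hb1 : b ≤ 1) (hd : 1 ≤ d) {c : ℝ} (hc : 0 ≤ c) :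
    ∃ M : ℝ, 0 ≤ M ∧ ∀ ν : ℂ, ν ≠ 0 → b * ‖ν‖ ≤ ‖ν‖ + ν.re → ∀ a, OrderNegOne d ν c a →
      ∀ (i k l : Fin d ⊕ Bool) (t : ℝ), 0 < t →
        SymbolBound d t M fun ξ => a ξ * kernelSymbol ν i k l t ξ := by
  have hs : 0 < √(b / 8) := by positivity
  obtain ⟨C, hC, hexp⟩ := exists_pow_mul_exp_neg_le (2 * (d + 1)) hs
  set B : ℝ := 2 ^ (d + 1) * (c * ((d + 1).factorial * 2 ^ (d + 2) * (24 / b) ^ (d + 1))) with hB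
  refine ⟨B * C, by positivity, fun ν hν hb a ha i k l t ht => ⟨?_, ?_, ?_⟩⟩
  · exact (measurable_of_continuousOn_compl_zero ha.contDiffOn.continuousOn).mul
      (contDiff_kernelSymbol hb0 hν hb i k l t 0).continuous.measurable
  · intro ξ hξ
    have h1 := (ha.contDiffOn.contDiffAt (isOpen_compl_singleton.mem_nhds hξ)).of_le
      (m := ((d + 1 : ℕ) : ℕ∞)) (by exact_mod_cast le_top)
    exact h1.mul (contDiff_kernelSymbol hb0 hν hb i k l t (d + 1 : ℕ)).contDiffAt
  · intro ξ hξ j n hn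
    have hw := weight_pos hν ξ
    set w := weight ν ξ with hwdef
    have hline : ContDiffAt ℝ (n : ℕ∞) (fun s : ℝ => ξ + EuclideanSpace.single j s) 0 :=
      contDiffAt_const.add ((contDiff_euclideanSingle j).contDiffAt.of_le le_top)
    have c1 : ContDiffAt ℝ (n : ℕ∞) (fun s : ℝ => a (ξ + EuclideanSpace.single j s)) 0 := by
      refine ContDiffAt.comp (g := a) 0 ?_ hline
      rw [single_zero, add_zero]
      exact (ha.contDiffOn.contDiffAt (isOpen_compl_singleton.mem_nhds hξ)).of_le
        (by exact_mod_cast le_top)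
    have c2 : ContDiffAt ℝ (n : ℕ∞)
        (fun s : ℝ => kernelSymbol ν i k l t (ξ + EuclideanSpace.single j s)) 0 :=
      (contDiff_kernelSymbol hb0 hν hb i k l t n).contDiffAt.comp 0 hline
    rw [iteratedDeriv_fun_mul c1 c2]
    have hterm : ∀ p ∈ Finset.range (n + 1),
        ‖((n.choose p : ℕ) : ℂ) * iteratedDeriv p (fun s : ℝ => a (ξ + EuclideanSpace.single j s))
            0 *
          iteratedDeriv (n - p) (fun s : ℝ => kernelSymbol ν i k l t
            (ξ + EuclideanSpace.single j s)) 0‖ ≤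
        n.choose p * (c * ((d + 1).factorial * 2 ^ (d + 2) * (24 / b) ^ (d + 1)) *
          (w ^ (d + 1 - n) * rexp (-(√(b / 8) * (t * w))))) := by
      intro p hp
      have hpn : p ≤ n := by simpa [Nat.lt_succ_iff] using hp
      rw [norm_mul, norm_mul, Complex.norm_natCast, mul_assoc]
      refine mul_le_mul_of_nonneg_left ?_ (Nat.cast_nonneg _)
      have h1 := (norm_iteratedDeriv_line_le ha.contDiffOn hξ j p).trans
          (ha.bound ξ hξ p (by omega))
      have h2 := norm_iteratedDeriv_kernelSymbol_le hb0 hb1 hν hb hd i k l ht.le ξ j (n - p)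
      rw [← hwdef] at h1 h2
      refine (mul_le_mul h1 h2 (norm_nonneg _) (by positivity)).trans ?_
      have e1 : w ^ (d + 2) = w ^ (d + 1 - n) * (w ^ (p + 1) * w ^ (n - p)) := by
        rw [← pow_add, ← pow_add]; congr 1; omega
      have e2 : c / w ^ (p + 1) * ((n - p).factorial * ((2 * w) ^ (d + 2) *
          rexp (-(√(b / 8) * (t * w)))) / (b / 24 * w) ^ (n - p)) =
          c * ((n - p).factorial * 2 ^ (d + 2) * (24 / b) ^ (n - p)) * (w ^ (d + 1 - n) *
            rexp (-(√(b / 8) * (t * w)))) := by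
        rw [mul_pow 2 w, e1, mul_pow _ w, div_pow, div_pow]
        field_simp
      rw [e2]
      gcongr
      · omega
      · rw [le_div_iff₀ hb0]; linarith
      · omega
    refine (norm_sum_le_of_le _ hterm).trans ?_
    rw [← Finset.sum_mul]
    have h3 : (∑ p ∈ Finset.range (n + 1), (n.choose p : ℝ)) = 2 ^ n := by
      exact_mod_cast Nat.sum_range_choose n
    rw [h3]
    have h4 : t ^ (d + 1 - n) * (w ^ (d + 1 - n) * rexp (-(√(b / 8) * (t * w)))) ≤
        C * decay d t ξ := by
      have htw : 0 ≤ t * w := by positivity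
      have h5 := hexp (t * w) htw
      have h6 : t * ‖ξ‖ ≤ t * w := by
        gcongr; exact le_add_of_nonneg_left (sqrt_nonneg _)
      rw [decay, ← div_eq_mul_inv, le_div_iff₀ (by positivity), ← mul_assoc, ← mul_pow]
      calc _ ≤ (1 + t * w) ^ (d + 1) * rexp (-(√(b / 8) * (t * w))) * (1 + t * w) ^ (d + 1) := by
            gcongr
            calc (t * w) ^ (d + 1 - n) ≤ (1 + t * w) ^ (d + 1 - n) := by gcongr; linarith
              _ ≤ (1 + t * w) ^ (d + 1) := pow_le_pow_right₀ (by linarith) (by omega)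
        _ = (1 + t * w) ^ (2 * (d + 1)) * rexp (-(√(b / 8) * (t * w))) := by ring
        _ ≤ C := h5
    have h7 : t ^ n / t ^ (d + 1) = 1 / t ^ (d + 1 - n) := by
      rw [div_eq_div_iff (by positivity) (by positivity), ← pow_add, one_mul]; congr 1; omega
    have h8 : w ^ (d + 1 - n) * rexp (-(√(b / 8) * (t * w))) ≤
        t ^ n / t ^ (d + 1) * (C * decay d t ξ) := by
      rw [h7, one_div_mul_eq_div, le_div_iff₀ (by positivity)]
      linarith
    have h9 : (2 : ℝ) ^ n ≤ 2 ^ (d + 1) := pow_le_pow_right₀ (by norm_num) hn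
    calc _ ≤ 2 ^ (d + 1) * (c * ((d + 1).factorial * 2 ^ (d + 2) * (24 / b) ^ (d + 1)) *
          (t ^ n / t ^ (d + 1) * (C * decay d t ξ))) := by gcongr
      _ = _ := by rw [hB]; ring

theorem norm_fourierE_le (h : EuclideanSpace ℝ (Fin d) → ℂ) (ξ : EuclideanSpace ℝ (Fin d)) :
    ‖fourierE h ξ‖ ≤ ∫ z, ‖h z‖ := by
  refine (norm_integral_le_integral_norm _).trans_eq ?_
  simp_rw [norm_mul, norm_exp_neg_I_inner, one_mul]

theorem exists_norm_slice_le (φ : SchwartzMap (EuclideanSpace ℝ (Fin d) × ℝ) ℂ) :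
    ∃ K : ℝ, 0 ≤ K ∧ ∀ z y, ‖φ (z, y)‖ ≤ K * decay d 1 z := by
  refine ⟨2 ^ (d + 1) * ((Finset.Iic (d + 1, 0)).sup fun m => SchwartzMap.seminorm ℝ m.1 m.2) φ,
    by positivity, fun z y => ?_⟩
  have h := SchwartzMap.one_add_le_sup_seminorm_apply (𝕜 := ℝ) (m := (d + 1, 0)) (k := d + 1)
    (n := 0) le_rfl le_rfl φ (z, y)
  rw [norm_iteratedFDeriv_zero] at h
  rw [decay, ← div_eq_mul_inv, le_div_iff₀ (by positivity), mul_comm]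
  refine le_trans ?_ h
  gcongr
  rw [one_mul]
  exact le_max_left ‖z‖ ‖y‖

theorem integrable_slice (φ : SchwartzMap (EuclideanSpace ℝ (Fin d) × ℝ) ℂ) (y : ℝ) :
    Integrable fun z => φ (z, y) := by
  obtain ⟨K, -, hK⟩ := exists_norm_slice_le φ
  have hc := φ.continuous
  exact ((integrable_decay one_pos).const_mul K).mono'
    (Continuous.aestronglyMeasurable (by fun_prop)) (Filter.Eventually.of_forall fun z => hK z y)

theorem exists_norm_fourierE_slice_le (φ : SchwartzMap (EuclideanSpace ℝ (Fin d) × ℝ) ℂ) :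
    ∃ F : ℝ, 0 ≤ F ∧ ∀ ξ y, ‖fourierE (fun z => φ (z, y)) ξ‖ ≤ F := by
  obtain ⟨K, hK0, hK⟩ := exists_norm_slice_le φ
  refine ⟨∫ z, K * decay d 1 z, integral_nonneg fun z => mul_nonneg hK0
      (decay_nonneg zero_le_one z),
    fun ξ y => (norm_fourierE_le _ _).trans ?_⟩
  exact integral_mono (integrable_slice φ y).norm ((integrable_decay one_pos).const_mul K)
    fun z => hK z y

theorem measurable_fourierE_slice (φ : SchwartzMap (EuclideanSpace ℝ (Fin d) × ℝ) ℂ) :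
    Measurable fun p : EuclideanSpace ℝ (Fin d) × ℝ => fourierE (fun z => φ (z, p.2)) p.1 := by
  have hc := φ.continuous
  exact (Continuous.stronglyMeasurable
    (f := fun p : (EuclideanSpace ℝ (Fin d) × ℝ) × EuclideanSpace ℝ (Fin d) =>
      Complex.exp (-Complex.I * (⟪p.2, p.1.1⟫ : ℂ)) * φ (p.2, p.1.2))
      (by fun_prop)).integral_prod_right' (ν := volume) |>.measurable

theorem hasDerivAt_fourierE_slice (φ : SchwartzMap (EuclideanSpace ℝ (Fin d) × ℝ) ℂ)
    (ξ : EuclideanSpace ℝ (Fin d)) (y : ℝ) :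
    HasDerivAt (fun y => fourierE (fun z => φ (z, y)) ξ)
      (fourierE (fun z => LineDeriv.lineDerivOp ((0, 1) : EuclideanSpace ℝ (Fin d) × ℝ) φ (z, y))
          ξ) y := by
  set ψ := LineDeriv.lineDerivOp ((0, 1) : EuclideanSpace ℝ (Fin d) × ℝ) φ with hψ
  obtain ⟨K, -, hK⟩ := exists_norm_slice_le ψ
  have hc := φ.continuous
  have hc' := ψ.continuous
  refine (hasDerivAt_integral_of_dominated_loc_of_deriv_le (bound := fun z => K * decay d 1 z)
    (F := fun y z => Complex.exp (-Complex.I * (⟪z, ξ⟫ : ℂ)) * φ (z, y))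
    (F' := fun y z => Complex.exp (-Complex.I * (⟪z, ξ⟫ : ℂ)) * ψ (z, y)) (s := Set.univ)
    Filter.univ_mem (Filter.Eventually.of_forall fun y =>
      Continuous.aestronglyMeasurable (by fun_prop)) ?_
    (Continuous.aestronglyMeasurable (by fun_prop)) ?_ ((integrable_decay one_pos).const_mul K)
        ?_).2
  · exact (integrable_slice φ y).bdd_mul (c := 1) (Continuous.aestronglyMeasurable (by fun_prop))
      (Filter.Eventually.of_forall fun z => (norm_exp_neg_I_inner z ξ).le)
  · refine Filter.Eventually.of_forall fun z y _ => ?_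
    rw [norm_mul, norm_exp_neg_I_inner, one_mul]
    exact hK z y
  · refine Filter.Eventually.of_forall fun z y _ => HasDerivAt.const_mul _ ?_
    rw [hψ, SchwartzMap.lineDerivOp_apply_eq_fderiv]
    have h1 : HasDerivAt (fun y : ℝ => (z, y)) ((0, 1) : EuclideanSpace ℝ (Fin d) × ℝ) y :=
      (hasDerivAt_const y z).prodMk (hasDerivAt_id y)
    exact φ.differentiableAt.hasFDerivAt.comp_hasDerivAt y h1

theorem fourierE_slice_deriv (φ : SchwartzMap (EuclideanSpace ℝ (Fin d) × ℝ) ℂ) (j : Fin d)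
    (ξ : EuclideanSpace ℝ (Fin d)) (y : ℝ) :
    fourierE (fun z => LineDeriv.lineDerivOp
      ((EuclideanSpace.single j 1, 0) : EuclideanSpace ℝ (Fin d) × ℝ) φ (z, y)) ξ =
      Complex.I * ξ j * fourierE (fun z => φ (z, y)) ξ := by
  set ψ := LineDeriv.lineDerivOp ((EuclideanSpace.single j 1, 0) : EuclideanSpace ℝ (Fin d) × ℝ) φ
    with hψ
  have hbdd : ∀ h : EuclideanSpace ℝ (Fin d) → ℂ, Integrable h →
      Integrable fun z => Complex.exp (-Complex.I * (⟪z, ξ⟫ : ℂ)) * h z := fun h hh =>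
    hh.bdd_mul (c := 1) (Continuous.aestronglyMeasurable (by fun_prop))
      (Filter.Eventually.of_forall fun z => (norm_exp_neg_I_inner z ξ).le)
  have hd1 : ∀ z, HasFDerivAt (fun z : EuclideanSpace ℝ (Fin d) => φ (z, y))
      ((fderiv ℝ φ (z, y)).comp (ContinuousLinearMap.inl ℝ _ _)) z := fun z =>
    φ.differentiableAt.hasFDerivAt.comp z (hasFDerivAt_prodMk_left z y)
  have e1 : ∀ z, fderiv ℝ (fun z : EuclideanSpace ℝ (Fin d) => φ (z, y)) z
      (EuclideanSpace.single j 1) = ψ (z, y) := by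
    intro z
    rw [(hd1 z).fderiv, hψ, SchwartzMap.lineDerivOp_apply_eq_fderiv]; rfl
  have hd2 : ∀ z, HasFDerivAt (fun z : EuclideanSpace ℝ (Fin d) =>
      Complex.exp (-Complex.I * (⟪z, ξ⟫ : ℂ)))
      (Complex.exp (-Complex.I * (⟪z, ξ⟫ : ℂ)) • ((-Complex.I) •
        (Complex.ofRealCLM.comp (innerSL ℝ ξ)))) z := by
    intro z
    have h1 : HasFDerivAt (fun z : EuclideanSpace ℝ (Fin d) => (⟪z, ξ⟫ : ℂ))
        (Complex.ofRealCLM.comp (innerSL ℝ ξ)) z := by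
      have := (Complex.ofRealCLM.comp (innerSL ℝ ξ)).hasFDerivAt (x := z)
      refine this.congr_of_eventuallyEq (Filter.Eventually.of_forall fun w => ?_)
      simp [real_inner_comm]
    exact (h1.const_mul (-Complex.I)).cexp
  have e2 : ∀ z, fderiv ℝ (fun z : EuclideanSpace ℝ (Fin d) =>
      Complex.exp (-Complex.I * (⟪z, ξ⟫ : ℂ))) z (EuclideanSpace.single j 1) =
      Complex.exp (-Complex.I * (⟪z, ξ⟫ : ℂ)) * (-Complex.I * ξ j) := by
    intro z
    rw [(hd2 z).fderiv]
    simp [EuclideanSpace.inner_single_right]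
  have e3 : ∀ z, Complex.exp (-Complex.I * (⟪z, ξ⟫ : ℂ)) * (-Complex.I * ξ j) * φ (z, y) =
      -(Complex.I * ξ j) * (Complex.exp (-Complex.I * (⟪z, ξ⟫ : ℂ)) * φ (z, y)) := fun z => by ring
  have h := integral_mul_fderiv_eq_neg_fderiv_mul_of_integrable (μ := volume) (𝕜 := ℂ)
    (f := fun z : EuclideanSpace ℝ (Fin d) => Complex.exp (-Complex.I * (⟪z, ξ⟫ : ℂ)))
    (g := fun z => φ (z, y)) (v := EuclideanSpace.single j 1) ?_ ?_ ?_
    (fun z _ => (hd2 z).differentiableAt) (fun z _ => (hd1 z).differentiableAt)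
  · simp_rw [e1, e2, e3] at h
    rw [integral_const_mul] at h
    rw [fourierE, h, fourierE]; ring
  · simp_rw [e2, e3]
    exact (hbdd _ (integrable_slice φ y)).const_mul _
  · simp_rw [e1]; exact hbdd _ (integrable_slice ψ y)
  · exact hbdd _ (integrable_slice φ y)

theorem norm_exp_neg_mul (A : ℂ) (y : ℝ) : ‖Complex.exp (-A * y)‖ = rexp (-(A.re * y)) := by
  rw [Complex.norm_exp, Complex.re_mul_ofReal, Complex.neg_re, neg_mul]

theorem integrableOn_pow_mul_exp_neg (n : ℕ) {a : ℝ} (ha : 0 < a) :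
    IntegrableOn (fun r : ℝ => r ^ n * rexp (-(a * r))) (Set.Ioi 0) := by
  obtain ⟨C, hC, h⟩ := exists_pow_mul_exp_neg_le n (half_pos ha)
  have h1 := (integrableOn_exp_mul_Ioi (a := -(a / 2)) (by linarith) 0).const_mul C
  refine Integrable.mono' h1 (Continuous.aestronglyMeasurable (by fun_prop)) ?_
  filter_upwards [ae_restrict_mem measurableSet_Ioi] with r hr
  have hr : 0 < r := hr
  rw [norm_of_nonneg (by positivity), show -(a * r) = -(a / 2 * r) + -(a / 2) * r by ring, exp_add,
    ← mul_assoc]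
  gcongr
  refine le_trans ?_ (h r hr.le)
  gcongr
  linarith

theorem integrableOn_pow_mul_cexp_neg (n : ℕ) {A : ℂ} (hA : 0 < A.re) :
    IntegrableOn (fun r : ℝ => (r : ℂ) ^ n * Complex.exp (-A * r)) (Set.Ioi 0) := by
  refine Integrable.mono' (integrableOn_pow_mul_exp_neg n hA)
    (Continuous.aestronglyMeasurable (by fun_prop)) ?_
  filter_upwards [ae_restrict_mem measurableSet_Ioi] with r hr
  have hr : 0 < r := hr
  rw [norm_mul, norm_exp_neg_mul, norm_pow, Complex.norm_real, norm_of_nonneg hr.le]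

theorem hasDerivAt_cexp_neg_mul (A : ℂ) (y : ℝ) :
    HasDerivAt (fun y : ℝ => Complex.exp (-A * y)) (-A * Complex.exp (-A * y)) y := by
  have h : HasDerivAt (fun y : ℝ => -A * (y : ℂ)) (-A) y := by
    simpa using (Complex.ofRealCLM.hasDerivAt (x := y)).const_mul (-A)
  simpa [mul_comm] using h.cexp

theorem integral_pow_mul_cexp_neg (n : ℕ) {A : ℂ} (hA : 0 < A.re) :
    ∫ r : ℝ in Set.Ioi 0, (r : ℂ) ^ n * Complex.exp (-A * r) = n.factorial / A ^ (n + 1) := by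
  have hA0 : A ≠ 0 := by rintro rfl; simp at hA
  induction n with
  | zero =>
    simp only [pow_zero, one_mul]
    rw [integral_exp_mul_complex_Ioi (by simpa using hA)]
    field_simp
    simp
  | succ n ih =>
    have hder : ∀ r : ℝ, HasDerivAt (fun r : ℝ => (r : ℂ) ^ (n + 1) * Complex.exp (-A * r))
        ((n + 1) * ((r : ℂ) ^ n * Complex.exp (-A * r)) -
          A * ((r : ℂ) ^ (n + 1) * Complex.exp (-A * r))) r := by
      intro r
      have h1 : HasDerivAt (fun r : ℝ => (r : ℂ) ^ (n + 1)) ((n + 1) * (r : ℂ) ^ n) r := by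
        have := (Complex.ofRealCLM.hasDerivAt (x := r)).fun_pow (n + 1)
        simpa using this
      refine (h1.mul (hasDerivAt_cexp_neg_mul A r)).congr_deriv ?_
      ring
    have i1 := (integrableOn_pow_mul_cexp_neg n hA).const_mul (n + 1 : ℂ)
    have i2 := (integrableOn_pow_mul_cexp_neg (n + 1) hA).const_mul A
    have hlim : Filter.Tendsto (fun r : ℝ => (r : ℂ) ^ (n + 1) * Complex.exp (-A * r))
        Filter.atTop (nhds 0) := by
      rw [tendsto_zero_iff_norm_tendsto_zero]
      have h2 := (tendsto_pow_mul_exp_neg_atTop_nhds_zero (n + 1)).comp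
        (Filter.tendsto_id.const_mul_atTop hA)
      have h3 := h2.const_mul ((A.re ^ (n + 1))⁻¹)
      rw [mul_zero] at h3
      refine h3.congr' ?_
      filter_upwards [Filter.eventually_ge_atTop 0] with r hr
      rw [norm_mul, norm_exp_neg_mul, norm_pow, Complex.norm_real, norm_of_nonneg hr]
      simp only [Function.comp_apply, id_eq, mul_pow]
      field_simp
    have h := integral_Ioi_of_hasDerivAt_of_tendsto (a := 0) (hder
        0).continuousAt.continuousWithinAt
      (fun r _ => hder r) (i1.sub i2) hlim
    rw [integral_sub i1 i2, integral_const_mul, integral_const_mul, ih] at h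
    simp only [Complex.ofReal_zero, ne_eq, Nat.add_eq_zero_iff, one_ne_zero, and_false,
      not_false_eq_true, zero_pow, zero_mul, sub_zero] at h
    rw [sub_eq_zero] at h
    rw [← mul_right_inj' hA0, ← h, Nat.factorial_succ]
    push_cast
    field_simp
    ring

/-- The components of `(|ν|^{1/2} f, ∇f)`. -/
noncomputable def dataComp (ν : ℂ) (f : SchwartzMap (EuclideanSpace ℝ (Fin d) × ℝ) ℂ) :
    Fin d ⊕ Bool → SchwartzMap (EuclideanSpace ℝ (Fin d) × ℝ) ℂ
  | .inl j => LineDeriv.lineDerivOp ((EuclideanSpace.single j 1, 0) : EuclideanSpace ℝ (Fin d) × ℝ)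
      f
  | .inr false => √‖ν‖ • f
  | .inr true => LineDeriv.lineDerivOp ((0, 1) : EuclideanSpace ℝ (Fin d) × ℝ) f

/-- The unimodular coefficients in the divergence identity for the trace. -/
noncomputable def dataCoef (ν : ℂ) (ς : ℝ) : Fin d ⊕ Bool → ℂ
  | .inl _ => -1
  | .inr false => ν / ‖ν‖
  | .inr true => ς

theorem norm_dataCoef_le (ν : ℂ) {ς : ℝ} (hς : ς = 1 ∨ ς = -1) (l : Fin d ⊕ Bool) :
    ‖dataCoef ν ς l‖ ≤ 1 := by
  match l with
  | .inl _ => simp [dataCoef]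
  | .inr false => simpa [dataCoef] using div_self_le_one _
  | .inr true => rcases hς with rfl | rfl <;> simp [dataCoef]

theorem fourierE_const_mul (r : ℂ) (h : EuclideanSpace ℝ (Fin d) → ℂ)
    (ξ : EuclideanSpace ℝ (Fin d)) : fourierE (fun z => r * h z) ξ = r * fourierE h ξ := by
  rw [fourierE, fourierE, ← integral_const_mul]
  congr 1; ext z; ring

/-- Exponentially weighted half-line integral of the partial Fourier transform. -/
noncomputable def halfLine (A : ℂ) (ς : ℝ) (φ : SchwartzMap (EuclideanSpace ℝ (Fin d) × ℝ) ℂ)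
    (ξ : EuclideanSpace ℝ (Fin d)) : ℂ :=
  ∫ y : ℝ in Set.Ioi 0, Complex.exp (-A * y) * fourierE (fun z => φ (z, ς * y)) ξ

theorem integrableOn_halfLine {A : ℂ} (hA : 0 < A.re) (ς : ℝ)
    (φ : SchwartzMap (EuclideanSpace ℝ (Fin d) × ℝ) ℂ) (ξ : EuclideanSpace ℝ (Fin d)) :
    IntegrableOn (fun y : ℝ => Complex.exp (-A * y) * fourierE (fun z => φ (z, ς * y)) ξ)
      (Set.Ioi 0) := by
  obtain ⟨F, -, hF⟩ := exists_norm_fourierE_slice_le φ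
  have h := integrableOn_pow_mul_cexp_neg 0 hA
  simp only [pow_zero, one_mul] at h
  refine Integrable.mul_bdd (c := F) h ?_ (Filter.Eventually.of_forall fun y => hF ξ (ς * y))
  exact ((measurable_fourierE_slice φ).comp
    (measurable_const.prodMk (measurable_const_mul ς) : Measurable fun y : ℝ =>
        (ξ, ς * y))).aestronglyMeasurable

theorem fourierE_trace_eq {A : ℂ} (hA : 0 < A.re) (ς : ℝ)
    (f : SchwartzMap (EuclideanSpace ℝ (Fin d) × ℝ) ℂ) (ξ : EuclideanSpace ℝ (Fin d)) :
    fourierE (fun z => f (z, 0)) ξ = A * halfLine A ς f ξ -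
      ς * halfLine A ς (LineDeriv.lineDerivOp ((0, 1) : EuclideanSpace ℝ (Fin d) × ℝ) f) ξ := by
  set fN := LineDeriv.lineDerivOp ((0, 1) : EuclideanSpace ℝ (Fin d) × ℝ) f with hfN
  have hder : ∀ y : ℝ, HasDerivAt
      (fun y : ℝ => Complex.exp (-A * y) * fourierE (fun z => f (z, ς * y)) ξ)
      (ς * (Complex.exp (-A * y) * fourierE (fun z => fN (z, ς * y)) ξ) -
        A * (Complex.exp (-A * y) * fourierE (fun z => f (z, ς * y)) ξ)) y := by
    intro y
    have h1 : HasDerivAt (fun y : ℝ => ς * y) ς y := by simpa using (hasDerivAt_id y).const_mul ς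
    have h2 := (hasDerivAt_fourierE_slice f ξ (ς * y)).scomp y h1
    have h3 := (hasDerivAt_cexp_neg_mul A y).mul h2
    refine h3.congr_deriv ?_
    rw [Complex.real_smul, Function.comp_apply]
    ring
  have i1 := (integrableOn_halfLine hA ς fN ξ).const_mul (ς : ℂ)
  have i2 := (integrableOn_halfLine hA ς f ξ).const_mul A
  have hlim : Filter.Tendsto
      (fun y : ℝ => Complex.exp (-A * y) * fourierE (fun z => f (z, ς * y)) ξ)
      Filter.atTop (nhds 0) := by
    obtain ⟨F, hF0, hF⟩ := exists_norm_fourierE_slice_le f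
    have h4 : Filter.Tendsto (fun y : ℝ => rexp (-(A.re * y)) * F) Filter.atTop (nhds 0) := by
      have := (tendsto_exp_neg_atTop_nhds_zero.comp
        (Filter.tendsto_id.const_mul_atTop hA)).mul_const F
      simpa using this
    refine squeeze_zero_norm (fun y => ?_) h4
    rw [norm_mul, norm_exp_neg_mul]
    gcongr
    exact hF ξ _
  have h := integral_Ioi_of_hasDerivAt_of_tendsto (a := 0) (hder 0).continuousAt.continuousWithinAt
    (fun r _ => hder r) (i1.sub i2) hlim
  rw [integral_sub i1 i2, integral_const_mul, integral_const_mul] at h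
  simp only [Complex.ofReal_zero, mul_zero, Complex.exp_zero, one_mul, zero_sub] at h
  rw [halfLine, halfLine, ← neg_inj, ← h]
  ring

theorem rootA_re_ge {b : ℝ} (hb0 : 0 < b) (hb1 : b ≤ 1) {ν : ℂ} (hν : ν ≠ 0)
    (hb : b * ‖ν‖ ≤ ‖ν‖ + ν.re) (hd : 1 ≤ d) (ξ : EuclideanSpace ℝ (Fin d)) :
    √(b / 8) * weight ν ξ ≤ (rootA ν ξ).re := by
  have hw := weight_pos hν ξ
  have h := le_re_rootLine hb0 hb1 hν hb ξ ⟨0, hd⟩ (z := ((0 : ℝ) : ℂ)) (by simp; positivity)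
  rwa [← rootA_add_single, single_zero, add_zero] at h

theorem rootA_sq (ν : ℂ) (ξ : EuclideanSpace ℝ (Fin d)) :
    rootA ν ξ ^ 2 = ν + ∑ j, (ξ j : ℂ) ^ 2 := by
  rw [rootA, cpow_half_sq, ← Complex.ofReal_pow, EuclideanSpace.norm_sq_eq]
  simp

theorem sum_dataCoef_mul_halfLine {ν : ℂ} (hν : ν ≠ 0) (ς : ℝ)
    (f : SchwartzMap (EuclideanSpace ℝ (Fin d) × ℝ) ℂ) (ξ : EuclideanSpace ℝ (Fin d))
    (hA : 0 < (rootA ν ξ).re) :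
    ∑ l, dataCoef ν ς l * (sym ν l ξ * halfLine (rootA ν ξ) ς (dataComp ν f l) ξ) =
      rootA ν ξ * fourierE (fun z => f (z, 0)) ξ := by
  have h1 : ∀ j, halfLine (rootA ν ξ) ς (dataComp ν f (.inl j)) ξ =
      Complex.I * ξ j * halfLine (rootA ν ξ) ς f ξ := by
    intro j
    rw [halfLine, halfLine, ← integral_const_mul]
    congr 1; ext y
    rw [dataComp, fourierE_slice_deriv]; ring
  have h2 : halfLine (rootA ν ξ) ς (dataComp ν f (.inr false)) ξ =
      (√‖ν‖ : ℝ) * halfLine (rootA ν ξ) ς f ξ := by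
    rw [halfLine, halfLine, ← integral_const_mul]
    congr 1; ext y
    simp only [dataComp, smul_apply, Complex.real_smul]
    rw [fourierE_const_mul]; ring
  have h3 : ((√‖ν‖ : ℝ) : ℂ) ^ 2 = (‖ν‖ : ℝ) := by
    rw [← Complex.ofReal_pow, sq_sqrt (norm_nonneg _)]
  have h4 : ((‖ν‖ : ℝ) : ℂ) ≠ 0 := by simpa using hν
  rw [Fintype.sum_sum_type, Fintype.sum_bool, fourierE_trace_eq hA ς, h2]
  simp_rw [h1]
  simp only [dataCoef, sym, dataComp]
  have h5 : ∀ j, (-1 : ℂ) * (Complex.I * ξ j * (Complex.I * ξ j * halfLine (rootA ν ξ) ς f ξ)) =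
      (ξ j : ℂ) ^ 2 * halfLine (rootA ν ξ) ς f ξ := fun j => by
    linear_combination (-(ξ j : ℂ) ^ 2 * halfLine (rootA ν ξ) ς f ξ) * Complex.I_sq
  simp_rw [h5]
  rw [← Finset.sum_mul]
  have h6 : ν / (‖ν‖ : ℝ) * (((√‖ν‖ : ℝ) : ℂ) * (((√‖ν‖ : ℝ) : ℂ) * halfLine (rootA ν ξ) ς f ξ)) =
      ν * halfLine (rootA ν ξ) ς f ξ := by
    rw [← mul_assoc _ _ (halfLine _ _ _ _), ← sq, h3]; field_simp
  rw [h6]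
  linear_combination (-halfLine (rootA ν ξ) ς f ξ) * rootA_sq ν ξ

/-- The integrand in the divergence representation of the boundary operator. -/
noncomputable def traceKernel (ν : ℂ) (a : EuclideanSpace ℝ (Fin d) → ℂ) (i k l : Fin d ⊕ Bool)
    (φ : SchwartzMap (EuclideanSpace ℝ (Fin d) × ℝ) ℂ) (ς x : ℝ) (w : ℝ × ℝ)
    (ξ : EuclideanSpace ℝ (Fin d)) : ℂ :=
  a ξ * kernelSymbol ν i k l (x + w.1 + w.2) ξ * fourierE (fun z => φ (z, ς * w.1)) ξ

theorem kernelSymbol_add (ν : ℂ) (i k l : Fin d ⊕ Bool) (x y r : ℝ)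
    (ξ : EuclideanSpace ℝ (Fin d)) :
    kernelSymbol ν i k l (x + y + r) ξ = kernelSymbol ν i k l x ξ *
      (Complex.exp (-rootA ν ξ * y) * Complex.exp (-rootA ν ξ * r)) := by
  rw [kernelSymbol, kernelSymbol, ← Complex.exp_add]
  rw [mul_assoc _ (Complex.exp _) (Complex.exp _), ← Complex.exp_add]
  congr 2
  push_cast; ring

theorem integral_traceKernel (ν : ℂ) (a : EuclideanSpace ℝ (Fin d) → ℂ) (i k l : Fin d ⊕ Bool)
    (φ : SchwartzMap (EuclideanSpace ℝ (Fin d) × ℝ) ℂ) (ς x : ℝ)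
    (ξ : EuclideanSpace ℝ (Fin d)) (hA : 0 < (rootA ν ξ).re) :
    ∫ w : ℝ × ℝ, (w.2 : ℂ) ^ (d - 1) * traceKernel ν a i k l φ ς x w ξ
        ∂((volume.restrict (Set.Ioi 0)).prod (volume.restrict (Set.Ioi 0))) =
      a ξ * sym ν i ξ * sym ν k ξ * Complex.exp (-rootA ν ξ * x) * ((d - 1).factorial / rootA ν ξ) *
        (sym ν l ξ * halfLine (rootA ν ξ) ς φ ξ) := by
  have h1 : ∀ w : ℝ × ℝ, (w.2 : ℂ) ^ (d - 1) * traceKernel ν a i k l φ ς x w ξ =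
      (a ξ * kernelSymbol ν i k l x ξ) *
        ((fun y : ℝ => Complex.exp (-rootA ν ξ * y) * fourierE (fun z => φ (z, ς * y)) ξ) w.1 *
        (fun r : ℝ => (r : ℂ) ^ (d - 1) * Complex.exp (-rootA ν ξ * r)) w.2) := by
    intro w
    rw [traceKernel, kernelSymbol_add]; ring
  have h2 := integral_prod_mul (μ := volume.restrict (Set.Ioi (0 : ℝ)))
    (ν := volume.restrict (Set.Ioi (0 : ℝ)))
    (fun y : ℝ => Complex.exp (-rootA ν ξ * y) * fourierE (fun z => φ (z, ς * y)) ξ)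
    (fun r : ℝ => (r : ℂ) ^ (d - 1) * Complex.exp (-rootA ν ξ * r))
  rw [integral_congr_ae (Filter.Eventually.of_forall h1), integral_const_mul, h2,
      integral_pow_mul_cexp_neg _ hA, ← halfLine,
    kernelSymbol]
  have hA0 : rootA ν ξ ≠ 0 := by intro h; simp [h] at hA
  field_simp
  ring

theorem ae_pos_prod : ∀ᵐ w : ℝ × ℝ
    ∂((volume.restrict (Set.Ioi 0)).prod (volume.restrict (Set.Ioi 0))), 0 < w.1 ∧ 0 < w.2 := by
  rw [Measure.prod_restrict]
  exact ae_restrict_mem (measurableSet_Ioi.prod measurableSet_Ioi)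

theorem norm_traceKernel_le {b : ℝ} (hb0 : 0 < b) (hb1 : b ≤ 1) {ν : ℂ} (hν : ν ≠ 0)
    (hb : b * ‖ν‖ ≤ ‖ν‖ + ν.re) (hd : 1 ≤ d) (a : EuclideanSpace ℝ (Fin d) → ℂ)
    (i k l : Fin d ⊕ Bool) {φ : SchwartzMap (EuclideanSpace ℝ (Fin d) × ℝ) ℂ} {F : ℝ}
    (hF : ∀ ξ y, ‖fourierE (fun z => φ (z, y)) ξ‖ ≤ F) (ς x : ℝ) {w : ℝ × ℝ} (h1 : 0 < w.1)
    (h2 : 0 < w.2) (ξ : EuclideanSpace ℝ (Fin d)) :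
    ‖traceKernel ν a i k l φ ς x w ξ‖ ≤ ‖a ξ * kernelSymbol ν i k l x ξ‖ *
      (rexp (-(√(b / 8) * √‖ν‖ * w.1)) * rexp (-(√(b / 8) * √‖ν‖ * w.2)) * F) := by
  have hA : √(b / 8) * √‖ν‖ ≤ (rootA ν ξ).re := by
    refine le_trans ?_ (rootA_re_ge hb0 hb1 hν hb hd ξ)
    gcongr
    exact le_add_of_nonneg_right (norm_nonneg _)
  rw [traceKernel, kernelSymbol_add, ← mul_assoc, mul_assoc (a ξ * _), norm_mul (a ξ * _),
      norm_mul _ (fourierE _ _),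
    norm_mul (Complex.exp _), norm_exp_neg_mul, norm_exp_neg_mul]
  gcongr
  exact hF ξ _

theorem integrable_exp_mul_traceKernel {b : ℝ} (hb0 : 0 < b) (hb1 : b ≤ 1) {ν : ℂ} (hν : ν ≠ 0)
    (hb : b * ‖ν‖ ≤ ‖ν‖ + ν.re) (hd : 1 ≤ d) {a : EuclideanSpace ℝ (Fin d) → ℂ} (am : Measurable a)
    (i k l : Fin d ⊕ Bool) (φ : SchwartzMap (EuclideanSpace ℝ (Fin d) × ℝ) ℂ) (ς x : ℝ)
    (hi : Integrable fun ξ => a ξ * kernelSymbol ν i k l x ξ) (x' : EuclideanSpace ℝ (Fin d)) :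
    Integrable (fun p : EuclideanSpace ℝ (Fin d) × (ℝ × ℝ) =>
      Complex.exp (Complex.I * (⟪x', p.1⟫ : ℂ)) *
        ((p.2.2 : ℂ) ^ (d - 1) * traceKernel ν a i k l φ ς x p.2 p.1))
      (volume.prod ((volume.restrict (Set.Ioi 0)).prod (volume.restrict (Set.Ioi 0)))) := by
  obtain ⟨F, hF0, hF⟩ := exists_norm_fourierE_slice_le φ
  have hκ : 0 < √(b / 8) * √‖ν‖ := by
    have := norm_pos_iff.2 hν
    positivity
  have j1 := integrableOn_pow_mul_exp_neg 0 hκ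
  have j2 := integrableOn_pow_mul_exp_neg (d - 1) hκ
  simp only [pow_zero, one_mul] at j1
  have j3 := hi.norm.mul_prod ((Integrable.mul_prod j1 j2).mul_const F)
  have hA := (contDiff_rootA (d := d) hb0 hν hb 0).continuous.measurable
  have hs := fun i => (contDiff_sym (d := d) hb0 hν hb i 0).continuous.measurable
  refine j3.mono' (Measurable.aestronglyMeasurable ?_) ?_
  · have m1 : Measurable fun p : EuclideanSpace ℝ (Fin d) × (ℝ × ℝ) =>
        fourierE (fun z => φ (z, ς * p.2.1)) p.1 :=
      (measurable_fourierE_slice φ).comp (f := fun p : EuclideanSpace ℝ (Fin d) × (ℝ × ℝ) =>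
        (p.1, ς * p.2.1)) (by fun_prop)
    have hi := hs i
    have hk := hs k
    have hl := hs l
    unfold traceKernel kernelSymbol
    fun_prop
  · filter_upwards [Measure.quasiMeasurePreserving_snd.ae ae_pos_prod] with p hp
    have h1 := norm_traceKernel_le hb0 hb1 hν hb hd a i k l hF ς x hp.1 hp.2 p.1
    have h2 := hp.2
    rw [norm_mul, norm_exp_I_inner, one_mul, norm_mul, norm_pow, Complex.norm_real,
      norm_of_nonneg h2.le]
    refine (mul_le_mul_of_nonneg_left h1 (by positivity)).trans_eq ?_
    ring

/-- The boundary operator with symbol `m` acting on partially transformed data `g`. -/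
noncomputable def bdryOp (ν : ℂ) (m g : EuclideanSpace ℝ (Fin d) → ℂ)
    (p : EuclideanSpace ℝ (Fin d) × ℝ) : ℂ :=
  ∫ ξ, Complex.exp (Complex.I * (⟪p.1, ξ⟫ : ℂ)) * (m ξ * Complex.exp (-rootA ν ξ * p.2) * g ξ)

theorem bdryOp_eq {b : ℝ} (hb0 : 0 < b) (hb1 : b ≤ 1) {ν : ℂ} (hν : ν ≠ 0)
    (hb : b * ‖ν‖ ≤ ‖ν‖ + ν.re) (hd : 1 ≤ d) {a : EuclideanSpace ℝ (Fin d) → ℂ} (am : Measurable a)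
    (i k : Fin d ⊕ Bool) (f : SchwartzMap (EuclideanSpace ℝ (Fin d) × ℝ) ℂ) (ς : ℝ)
    (p : EuclideanSpace ℝ (Fin d) × ℝ)
    (hi : ∀ l, Integrable fun ξ => a ξ * kernelSymbol ν i k l p.2 ξ) :
    bdryOp ν (fun ξ => a ξ * sym ν i ξ * sym ν k ξ) (fourierE fun z => f (z, 0)) p =
      ((d - 1).factorial : ℂ)⁻¹ * ∑ l, dataCoef ν ς l *
        ∫ w : ℝ × ℝ, (w.2 : ℂ) ^ (d - 1) *
          mulOp (fun ξ => a ξ * kernelSymbol ν i k l (p.2 + w.1 + w.2) ξ)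
            (fun z => dataComp ν f l (z, ς * w.1)) p.1
          ∂((volume.restrict (Set.Ioi 0)).prod (volume.restrict (Set.Ioi 0))) := by
  set P := (volume.restrict (Set.Ioi (0 : ℝ))).prod (volume.restrict (Set.Ioi (0 : ℝ))) with hP
  have hint := fun l => integrable_exp_mul_traceKernel hb0 hb1 hν hb hd am i k l (dataComp ν f l) ς
    p.2 (hi l) p.1
  have hfac : ((d - 1).factorial : ℂ) ≠ 0 := by exact_mod_cast (d - 1).factorial_ne_zero
  have h1 : ∀ ξ, Complex.exp (Complex.I * (⟪p.1, ξ⟫ : ℂ)) * (a ξ * sym ν i ξ * sym ν k ξ *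
      Complex.exp (-rootA ν ξ * p.2) * fourierE (fun z => f (z, 0)) ξ) =
      ((d - 1).factorial : ℂ)⁻¹ * ∑ l, dataCoef ν ς l * ∫ w : ℝ × ℝ,
        Complex.exp (Complex.I * (⟪p.1, ξ⟫ : ℂ)) *
          ((w.2 : ℂ) ^ (d - 1) * traceKernel ν a i k l (dataComp ν f l) ς p.2 w ξ) ∂P := by
    intro ξ
    have hA : 0 < (rootA ν ξ).re := lt_of_lt_of_le (by have := weight_pos hν ξ; positivity)
      (rootA_re_ge hb0 hb1 hν hb hd ξ)
    have hA0 : rootA ν ξ ≠ 0 := by intro h; simp [h] at hA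
    have h2 := sum_dataCoef_mul_halfLine hν ς f ξ hA
    have h3 : ∀ l, ∫ w : ℝ × ℝ, (w.2 : ℂ) ^ (d - 1) *
        traceKernel ν a i k l (dataComp ν f l) ς p.2 w ξ ∂P = _ := fun l =>
      integral_traceKernel ν a i k l (dataComp ν f l) ς p.2 ξ hA
    simp_rw [integral_const_mul, h3]
    rw [← mul_right_inj' hfac, mul_inv_cancel_left₀ hfac]
    set X := a ξ * sym ν i ξ * sym ν k ξ * Complex.exp (-rootA ν ξ * p.2)
    have h4 : ∀ l, dataCoef ν ς l * (Complex.exp (Complex.I * (⟪p.1, ξ⟫ : ℂ)) *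
        (X * ((d - 1).factorial / rootA ν ξ) *
          (sym ν l ξ * halfLine (rootA ν ξ) ς (dataComp ν f l) ξ))) =
        (Complex.exp (Complex.I * (⟪p.1, ξ⟫ : ℂ)) * (X * ((d - 1).factorial / rootA ν ξ))) *
        (dataCoef ν ς l * (sym ν l ξ * halfLine (rootA ν ξ) ς (dataComp ν f l) ξ)) :=
      fun l => by ring
    simp_rw [h4]
    rw [← Finset.mul_sum, h2]
    field_simp
  rw [bdryOp, integral_congr_ae (Filter.Eventually.of_forall h1), integral_const_mul]
  congr 1
  rw [integral_finsetSum _ fun l _ => ((hint l).integral_prod_left).const_mul _]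
  refine Finset.sum_congr rfl fun l _ => ?_
  rw [integral_const_mul]
  congr 1
  rw [integral_integral_swap (hint l)]
  refine integral_congr_ae (Filter.Eventually.of_forall fun w => ?_)
  dsimp only
  rw [mulOp, invFourier, ← integral_const_mul]
  congr 1; ext ξ
  rw [traceKernel]; ring

theorem measurable_mulOp_traceKernel {b : ℝ} (hb0 : 0 < b) {ν : ℂ} (hν : ν ≠ 0)
    (hb : b * ‖ν‖ ≤ ‖ν‖ + ν.re) {a : EuclideanSpace ℝ (Fin d) → ℂ} (am : Measurable a)
    (i k l : Fin d ⊕ Bool) (φ : SchwartzMap (EuclideanSpace ℝ (Fin d) × ℝ) ℂ) (ς : ℝ) :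
    Measurable fun u : (EuclideanSpace ℝ (Fin d) × ℝ) × (ℝ × ℝ) =>
      mulOp (fun ξ => a ξ * kernelSymbol ν i k l (u.1.2 + u.2.1 + u.2.2) ξ)
        (fun z => φ (z, ς * u.2.1)) u.1.1 := by
  have hA := (contDiff_rootA (d := d) hb0 hν hb 0).continuous.measurable
  have hs := fun i => (contDiff_sym (d := d) hb0 hν hb i 0).continuous.measurable
  have hi := hs i
  have hk := hs k
  have hl := hs l
  have m1 : Measurable fun u : ((EuclideanSpace ℝ (Fin d) × ℝ) × (ℝ × ℝ)) ×
      EuclideanSpace ℝ (Fin d) => fourierE (fun z => φ (z, ς * u.1.2.1)) u.2 :=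
    (measurable_fourierE_slice φ).comp (f := fun u : ((EuclideanSpace ℝ (Fin d) × ℝ) × (ℝ × ℝ)) ×
      EuclideanSpace ℝ (Fin d) => (u.2, ς * u.1.2.1)) (by fun_prop)
  refine (Measurable.stronglyMeasurable
    (f := fun u : ((EuclideanSpace ℝ (Fin d) × ℝ) × (ℝ × ℝ)) × EuclideanSpace ℝ (Fin d) =>
      Complex.exp (Complex.I * (⟪u.1.1.1, u.2⟫ : ℂ)) *
        (a u.2 * kernelSymbol ν i k l (u.1.1.2 + u.1.2.1 + u.1.2.2) u.2 *
          fourierE (fun z => φ (z, ς * u.1.2.1)) u.2)) ?_).integral_prod_right'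
              (ν := volume) |>.measurable
  unfold kernelSymbol
  fun_prop

theorem exists_bdryOp_bound {b : ℝ} (hb0 : 0 < b) (hb1 : b ≤ 1) (hd : 1 ≤ d) {q : ℝ} (hq : 1 < q)
    {c : ℝ} (hc : 0 ≤ c) :
    ∃ C : ℝ, 0 ≤ C ∧ ∀ ν : ℂ, ν ≠ 0 → b * ‖ν‖ ≤ ‖ν‖ + ν.re → ∀ a, OrderNegOne d ν c a →
      ∀ (i k : Fin d ⊕ Bool) (f : SchwartzMap (EuclideanSpace ℝ (Fin d) × ℝ) ℂ) (ς : ℝ),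
        (ς = 1 ∨ ς = -1) →
        eLpNorm' (bdryOp ν (fun ξ => a ξ * sym ν i ξ * sym ν k ξ) (fourierE fun z => f (z, 0))) q
            (volume.prod (volume.restrict (Set.Ioi 0))) ≤
          ENNReal.ofReal C * ∑ l, eLpNorm' (fun p => dataComp ν f l (p.1, ς * p.2)) q
            (volume.prod (volume.restrict (Set.Ioi 0))) := by
  obtain ⟨M, hM, hsym⟩ := exists_symbolBound hb0 hb1 hd hc
  obtain ⟨C, hC, hmul⟩ := exists_mulOp_bound hd hq
  have q0 : 0 < q := by linarith
  have hB : 0 ≤ 1 / (1 - 1 / q) + q := by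
    have : 1 / q < 1 := (div_lt_one q0).2 hq
    have := div_pos one_pos (sub_pos.2 this)
    linarith
  set B := 1 / (1 - 1 / q) + q
  refine ⟨B * (C * M), by positivity, fun ν hν hb a ha i k f ς hς => ?_⟩
  have am := measurable_of_continuousOn_compl_zero ha.contDiffOn.continuousOn
  set H := volume.restrict (Set.Ioi (0 : ℝ)) with hH
  set T : Fin d ⊕ Bool → (EuclideanSpace ℝ (Fin d) × ℝ) × (ℝ × ℝ) → ℂ := fun l u =>
    mulOp (fun ξ => a ξ * kernelSymbol ν i k l (u.1.2 + u.2.1 + u.2.2) ξ)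
        (fun z => dataComp ν f l (z, ς * u.2.1)) u.1.1 with hT
  have hTm : ∀ l, Measurable (T l) := fun l =>
    measurable_mulOp_traceKernel hb0 hν hb am i k l (dataComp ν f l) ς
  set G : Fin d ⊕ Bool → (EuclideanSpace ℝ (Fin d) × ℝ) × (ℝ × ℝ) → ENNReal := fun l u =>
    ENNReal.ofReal ((u.1.2 + u.2.1 + u.2.2) ^ (d + 1)) * ‖T l u‖ₑ with hG
  have hGm : ∀ l, Measurable (G l) := fun l => by
    have := hTm l
    simp only [hG]; fun_prop
  set U : Fin d ⊕ Bool → EuclideanSpace ℝ (Fin d) × ℝ → ENNReal := fun l p =>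
    ∫⁻ w : ℝ × ℝ, ENNReal.ofReal (w.2 ^ (d - 1) / (p.2 + w.1 + w.2) ^ (d - 1 + 2)) * G l (p, w)
      ∂(H.prod H) with hU
  have hUm : ∀ l, Measurable (U l) := fun l => by
    have := hGm l
    exact Measurable.lintegral_prod_right' (f := fun u : (EuclideanSpace ℝ (Fin d) × ℝ) × (ℝ × ℝ) =>
      ENNReal.ofReal (u.2.2 ^ (d - 1) / (u.1.2 + u.2.1 + u.2.2) ^ (d - 1 + 2)) * G l u)
      (by fun_prop)
  have hpt : ∀ p : EuclideanSpace ℝ (Fin d) × ℝ, 0 < p.2 →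
      ‖bdryOp ν (fun ξ => a ξ * sym ν i ξ * sym ν k ξ) (fourierE fun z => f (z, 0)) p‖ₑ ≤
        ∑ l, U l p := by
    intro p hp
    rw [bdryOp_eq hb0 hb1 hν hb hd am i k f ς p fun l => (hsym ν hν hb a ha i k l p.2
        hp).integrable hp hd]
    rw [enorm_mul]
    have h1 : ‖((d - 1).factorial : ℂ)⁻¹‖ₑ ≤ 1 := by
      rw [← ofReal_norm, ← ENNReal.ofReal_one]
      refine ENNReal.ofReal_le_ofReal ?_
      rw [norm_inv, Complex.norm_natCast]
      exact inv_le_one_of_one_le₀ (by exact_mod_cast (d - 1).factorial_pos)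
    refine (mul_le_of_le_one_left (by simp) h1).trans ((enorm_sum_le _ _).trans ?_)
    refine Finset.sum_le_sum fun l _ => ?_
    rw [enorm_mul]
    have h2 : ‖dataCoef ν ς l‖ₑ ≤ 1 := by
      rw [← ofReal_norm, ← ENNReal.ofReal_one]
      exact ENNReal.ofReal_le_ofReal (norm_dataCoef_le ν hς l)
    refine (mul_le_of_le_one_left (by simp) h2).trans ((enorm_integral_le_lintegral_enorm _).trans
        ?_)
    refine lintegral_mono_ae ?_
    filter_upwards [ae_pos_prod] with w hw
    have hw1 := hw.1
    have hw2 := hw.2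
    have ht : 0 < p.2 + w.1 + w.2 := by positivity
    rw [enorm_mul]
    simp only [hG]
    rw [← mul_assoc, ← ENNReal.ofReal_mul (by positivity), show d - 1 + 2 = d + 1 by omega,
      div_mul_cancel₀ _ (by positivity), ← ofReal_norm, norm_pow, Complex.norm_real,
      norm_of_nonneg hw2.le]
  have hUbound : ∀ l, eLpNorm' (U l) q (volume.prod H) ≤ ENNReal.ofReal (B * (C * M)) *
      eLpNorm' (fun p => dataComp ν f l (p.1, ς * p.2)) q (volume.prod H) := by
    intro l
    have hfm : Measurable fun p : EuclideanSpace ℝ (Fin d) × ℝ =>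
        dataComp ν f l (p.1, ς * p.2) := by
      have := (dataComp ν f l).continuous
      exact Continuous.measurable (by fun_prop)
    have h1 := lintegral_halfSpace_schur (volume (α := EuclideanSpace ℝ (Fin d))) (d - 1) hq (hGm l)
      (φ := fun y => ENNReal.ofReal (C * M) ^ q * ∫⁻ z, ‖dataComp ν f l (z, ς * y)‖ₑ ^ q) ?_ ?_
    · rw [eLpNorm'_eq_lintegral_enorm, eLpNorm'_eq_lintegral_enorm]
      simp only [enorm_eq_self]
      rw [lintegral_const_mul _ (by
        exact Measurable.lintegral_prod_left' (f := fun p : EuclideanSpace ℝ (Fin d) × ℝ =>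
          ‖dataComp ν f l (p.1, ς * p.2)‖ₑ ^ q) (by fun_prop))] at h1
      have h2 : ∫⁻ y in Set.Ioi 0, ∫⁻ z, ‖dataComp ν f l (z, ς * y)‖ₑ ^ q =
          ∫⁻ p, ‖dataComp ν f l (p.1, ς * p.2)‖ₑ ^ q ∂(volume.prod H) := by
        rw [lintegral_prod_symm' _ (by fun_prop)]
      rw [h2] at h1
      refine (ENNReal.rpow_le_rpow h1 (by positivity)).trans (le_of_eq ?_)
      rw [ENNReal.mul_rpow_of_nonneg _ _ (by positivity), ENNReal.mul_rpow_of_nonneg _ _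
          (by positivity),
        ← ENNReal.rpow_mul, ← ENNReal.rpow_mul, mul_one_div_cancel q0.ne', ENNReal.rpow_one,
        ENNReal.rpow_one, ← mul_assoc, ← ENNReal.ofReal_mul hB]
    · refine Measurable.const_mul ?_ _
      exact Measurable.lintegral_prod_left' (f := fun p : EuclideanSpace ℝ (Fin d) × ℝ =>
          ‖dataComp ν f l (p.1, ς * p.2)‖ₑ ^ q) (by fun_prop)
    · intro x hx y hy r hr
      have ht : 0 < x + y + r := by positivity
      have h3 := hmul (x + y + r) ht M hM _ (hsym ν hν hb a ha i k l (x + y + r) ht)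
        (fun z => dataComp ν f l (z, ς * y)) (hfm.comp measurable_prodMk_right)
        (integrable_slice _ _)
      simp only [hG, hT]
      have hm : Measurable fun z => ‖mulOp (fun ξ => a ξ * kernelSymbol ν i k l (x + y + r) ξ)
          (fun z => dataComp ν f l (z, ς * y)) z‖ₑ ^ q :=
        ((hTm l).comp (measurable_prodMk_right.comp measurable_prodMk_right :
          Measurable fun z : EuclideanSpace ℝ (Fin d) => ((z, x), (y, r)))).enorm.pow_const q
      simp_rw [ENNReal.mul_rpow_of_nonneg _ _ q0.le]
      rw [lintegral_const_mul _ hm]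
      refine (mul_le_mul_right h3 _).trans (le_of_eq ?_)
      rw [← mul_assoc, ← ENNReal.mul_rpow_of_nonneg _ _ q0.le, ← ENNReal.ofReal_mul (by positivity),
        mul_div_cancel₀ _ (by positivity)]
  calc _ ≤ eLpNorm' (∑ l, U l) q (volume.prod H) := by
        rw [eLpNorm'_eq_lintegral_enorm, eLpNorm'_eq_lintegral_enorm]
        refine ENNReal.rpow_le_rpow (lintegral_mono_ae ?_) (by positivity)
        filter_upwards [Measure.quasiMeasurePreserving_snd.ae (ae_restrict_mem measurableSet_Ioi)]
            with p hp
        refine ENNReal.rpow_le_rpow ?_ q0.le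
        simpa using hpt p hp
    _ ≤ ∑ l, eLpNorm' (U l) q (volume.prod H) :=
        eLpNorm'_sum_le (fun l _ => (hUm l).aestronglyMeasurable) hq.le
    _ ≤ _ := by
        rw [Finset.mul_sum]
        exact Finset.sum_le_sum fun l _ => hUbound l

/-- The coordinate functionals dual to the differential symbols `sym`. -/
noncomputable def coordFun : Fin d ⊕ Bool → (EuclideanSpace ℝ (Fin d) × ℝ →L[ℝ] ℂ)
  | .inl j => Complex.ofRealCLM ∘L EuclideanSpace.proj j ∘L
      ContinuousLinearMap.fst ℝ (EuclideanSpace ℝ (Fin d)) ℝ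
  | .inr false => 0
  | .inr true => Complex.ofRealCLM ∘L ContinuousLinearMap.snd ℝ (EuclideanSpace ℝ (Fin d)) ℝ

theorem norm_coordFun_le (i : Fin d ⊕ Bool) : ‖coordFun i‖ ≤ 1 := by
  refine ContinuousLinearMap.opNorm_le_bound _ zero_le_one fun v => ?_
  rw [one_mul]
  match i with
  | .inl j =>
    simpa [coordFun] using (PiLp.norm_apply_le v.1 j).trans (norm_fst_le v)
  | .inr false => simp [coordFun]
  | .inr true => simpa [coordFun] using norm_snd_le v

theorem hasFDerivAt_cexp_phase (ν : ℂ) (ξ : EuclideanSpace ℝ (Fin d))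
    (p : EuclideanSpace ℝ (Fin d) × ℝ) :
    HasFDerivAt (fun p : EuclideanSpace ℝ (Fin d) × ℝ =>
        Complex.exp (Complex.I * (⟪p.1, ξ⟫ : ℂ)) * Complex.exp (-rootA ν ξ * p.2))
      (∑ i, (Complex.exp (Complex.I * (⟪p.1, ξ⟫ : ℂ)) * (sym ν i ξ *
        Complex.exp (-rootA ν ξ * p.2))) • coordFun i) p := by
  have hlin : ∀ p : EuclideanSpace ℝ (Fin d) × ℝ,
      Complex.I * (⟪p.1, ξ⟫ : ℂ) + -rootA ν ξ * p.2 =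
        (∑ i, sym ν i ξ • coordFun i : EuclideanSpace ℝ (Fin d) × ℝ →L[ℝ] ℂ) p := by
    intro p
    simp only [Fintype.sum_sum_type, Fintype.sum_bool, coordFun, sym]
    simp [PiLp.inner_apply, Finset.mul_sum]
    refine Finset.sum_congr rfl fun j _ => by ring
  have h1 : (fun p : EuclideanSpace ℝ (Fin d) × ℝ =>
        Complex.exp (Complex.I * (⟪p.1, ξ⟫ : ℂ)) * Complex.exp (-rootA ν ξ * p.2)) =
      fun p => Complex.exp ((∑ i, sym ν i ξ • coordFun i :
        EuclideanSpace ℝ (Fin d) × ℝ →L[ℝ] ℂ) p) := by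
    funext p
    rw [← hlin, Complex.exp_add]
  rw [h1]
  refine (ContinuousLinearMap.hasFDerivAt _).cexp.congr_fderiv ?_
  rw [← hlin, Complex.exp_add, Finset.smul_sum]
  refine Finset.sum_congr rfl fun i _ => ?_
  rw [smul_smul]
  congr 1
  ring

theorem hasFDerivAt_bdryOp {ν : ℂ} (hA : ∀ ξ : EuclideanSpace ℝ (Fin d), 0 < (rootA ν ξ).re)
    (hAm : Measurable (rootA ν : EuclideanSpace ℝ (Fin d) → ℂ))
    {m g : EuclideanSpace ℝ (Fin d) → ℂ} (hm : Measurable m) (hg : Measurable g) {F : ℝ}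
    (hF : ∀ ξ, ‖g ξ‖ ≤ F)
    (h0 : ∀ x : ℝ, 0 < x → Integrable fun ξ => m ξ * Complex.exp (-rootA ν ξ * x))
    (h1 : ∀ i, ∀ x : ℝ, 0 < x → Integrable fun ξ =>
      m ξ * sym ν i ξ * Complex.exp (-rootA ν ξ * x))
    {p : EuclideanSpace ℝ (Fin d) × ℝ} (hp : 0 < p.2) :
    HasFDerivAt (bdryOp ν m g) (∑ i, bdryOp ν (fun ξ => m ξ * sym ν i ξ) g p • coordFun i) p := by
  have hexp : ∀ p : EuclideanSpace ℝ (Fin d) × ℝ, Measurable fun ξ : EuclideanSpace ℝ (Fin d) =>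
      Complex.exp (Complex.I * (⟪p.1, ξ⟫ : ℂ)) := fun p => by fun_prop
  have hexp' : ∀ p : EuclideanSpace ℝ (Fin d) × ℝ, Measurable fun ξ : EuclideanSpace ℝ (Fin d) =>
      Complex.exp (-rootA ν ξ * p.2) := fun p => by fun_prop
  have hint : ∀ m' : EuclideanSpace ℝ (Fin d) → ℂ, ∀ p : EuclideanSpace ℝ (Fin d) × ℝ,
      (Integrable fun ξ => m' ξ * Complex.exp (-rootA ν ξ * p.2)) →
      Integrable fun ξ => Complex.exp (Complex.I * (⟪p.1, ξ⟫ : ℂ)) *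
        (m' ξ * Complex.exp (-rootA ν ξ * p.2) * g ξ) := fun m' p h =>
    integrable_exp_mul (h.mul_bdd hg.aestronglyMeasurable (Filter.Eventually.of_forall hF)) p.1
  set F' : EuclideanSpace ℝ (Fin d) × ℝ → EuclideanSpace ℝ (Fin d) →
      (EuclideanSpace ℝ (Fin d) × ℝ →L[ℝ] ℂ) := fun p ξ =>
    ∑ i, (Complex.exp (Complex.I * (⟪p.1, ξ⟫ : ℂ)) * (m ξ * sym ν i ξ *
      Complex.exp (-rootA ν ξ * p.2) * g ξ)) • coordFun i with hF'
  have hs : {p' : EuclideanSpace ℝ (Fin d) × ℝ | p.2 / 2 < p'.2} ∈ nhds p :=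
    (isOpen_lt continuous_const continuous_snd).mem_nhds (by simpa using hp)
  have hx : 0 < p.2 / 2 := by positivity
  have key := hasFDerivAt_integral_of_dominated_of_fderiv_le (𝕜 := ℝ) (μ := volume)
    (F := fun p ξ => Complex.exp (Complex.I * (⟪p.1, ξ⟫ : ℂ)) *
      (m ξ * Complex.exp (-rootA ν ξ * p.2) * g ξ)) (F' := F') (x₀ := p)
    (bound := fun ξ => ∑ i, ‖m ξ * sym ν i ξ * Complex.exp (-rootA ν ξ * (p.2 / 2 : ℝ))‖ * F)
    hs (Filter.Eventually.of_forall fun p' => by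
      have := hexp p'
      have := hexp' p'
      exact Measurable.aestronglyMeasurable (by fun_prop))
    (hint m p (h0 _ hp)) ?_ ?_ ?_ ?_
  · refine key.congr_fderiv ?_
    simp only [hF']
    rw [integral_finsetSum _ fun i _ => (hint _ p (h1 i _ hp)).smul_const _]
    refine Finset.sum_congr rfl fun i _ => ?_
    rw [integral_smul_const, bdryOp]
  · refine Finset.aestronglyMeasurable_fun_sum _ fun i _ => ?_
    exact ((hint _ p (h1 i _ hp)).smul_const _).aestronglyMeasurable
  · refine Filter.Eventually.of_forall fun ξ p' hp' => ?_
    simp only [hF']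
    refine (norm_sum_le _ _).trans (Finset.sum_le_sum fun i _ => ?_)
    rw [norm_smul, norm_mul, norm_exp_I_inner, one_mul, norm_mul]
    refine (mul_le_of_le_one_right (by positivity) (norm_coordFun_le i)).trans ?_
    rw [norm_mul _ (Complex.exp _), norm_mul _ (Complex.exp _), norm_exp_neg_mul, norm_exp_neg_mul]
    have hp2 : p.2 / 2 < p'.2 := hp'
    have := hF ξ
    have := (hA ξ).le
    gcongr
  · exact integrable_finsetSum _ fun i _ => ((h1 i _ hx).norm.mul_const F)
  · refine Filter.Eventually.of_forall fun ξ p' _ => ?_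
    have h := (hasFDerivAt_cexp_phase ν ξ p').const_mul (m ξ * g ξ)
    have e : (fun p : EuclideanSpace ℝ (Fin d) × ℝ => Complex.exp (Complex.I * (⟪p.1, ξ⟫ : ℂ)) *
      (m ξ * Complex.exp (-rootA ν ξ * p.2) * g ξ)) = fun p => m ξ * g ξ *
        (Complex.exp (Complex.I * (⟪p.1, ξ⟫ : ℂ)) * Complex.exp (-rootA ν ξ * p.2)) := by
      funext p; ring
    rw [e]
    refine h.congr_fderiv ?_
    simp only [hF']
    rw [Finset.smul_sum]
    refine Finset.sum_congr rfl fun i _ => ?_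
    rw [smul_smul]
    congr 1
    ring

theorem OrderNegOne.measurable {ν : ℂ} {c : ℝ} {a : EuclideanSpace ℝ (Fin d) → ℂ}
    (ha : OrderNegOne d ν c a) : Measurable a :=
  measurable_of_continuousOn_compl_zero ha.contDiffOn.continuousOn

theorem integrable_mul_sym_mul_sym {b : ℝ} (hb0 : 0 < b) (hb1 : b ≤ 1) {ν : ℂ} (hν : ν ≠ 0)
    (hb : b * ‖ν‖ ≤ ‖ν‖ + ν.re) (hd : 1 ≤ d) {c : ℝ} (hc : 0 ≤ c)
    {a : EuclideanSpace ℝ (Fin d) → ℂ} (ha : OrderNegOne d ν c a) (i k : Fin d ⊕ Bool)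
    {x : ℝ} (hx : 0 < x) :
    Integrable fun ξ => a ξ * sym ν i ξ * sym ν k ξ * Complex.exp (-rootA ν ξ * x) := by
  obtain ⟨M, -, hM⟩ := exists_symbolBound hb0 hb1 hd hc
  have h := (hM ν hν hb a ha i k (.inr false) x hx).integrable hx hd
  have hn : 0 < √‖ν‖ := by positivity
  have hlow : ∀ ξ : EuclideanSpace ℝ (Fin d), √(b / 8) * √‖ν‖ ≤ ‖rootA ν ξ‖ := fun ξ =>
    le_trans (by rw [weight]; gcongr; simp) ((rootA_re_ge hb0 hb1 hν hb hd ξ).trans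
      (Complex.re_le_norm _))
  have hpos : 0 < √(b / 8) * √‖ν‖ := by positivity
  have hA0 : ∀ ξ : EuclideanSpace ℝ (Fin d), rootA ν ξ ≠ 0 := fun ξ =>
    norm_pos_iff.1 (hpos.trans_le (hlow ξ))
  have hAm : Measurable (rootA ν : EuclideanSpace ℝ (Fin d) → ℂ) :=
    (contDiff_rootA hb0 hν hb 0).continuous.measurable
  have h2 := h.mul_bdd (c := (√‖ν‖ * (√(b / 8) * √‖ν‖) ^ (d - 1))⁻¹)
    (g := fun ξ => (((√‖ν‖ : ℝ) : ℂ) * rootA ν ξ ^ (d - 1))⁻¹)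
    (Measurable.aestronglyMeasurable (by fun_prop)) (Filter.Eventually.of_forall fun ξ => ?_)
  · refine h2.congr (Filter.Eventually.of_forall fun ξ => ?_)
    have h3 : ((√‖ν‖ : ℝ) : ℂ) ≠ 0 := by exact_mod_cast hn.ne'
    have h4 := hA0 ξ
    simp only [kernelSymbol]
    have h5 : sym ν (.inr false) ξ = ((√‖ν‖ : ℝ) : ℂ) := rfl
    rw [h5]
    field_simp
  · rw [norm_inv, norm_mul, norm_pow, Complex.norm_real, norm_of_nonneg hn.le]
    gcongr
    exact hlow ξ

theorem bdryOp_mul_sym_inr_false (ν : ℂ) (m g : EuclideanSpace ℝ (Fin d) → ℂ)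
    (p : EuclideanSpace ℝ (Fin d) × ℝ) :
    bdryOp ν (fun ξ => m ξ * sym ν (.inr false) ξ) g p = (√‖ν‖ : ℝ) * bdryOp ν m g p := by
  rw [bdryOp, bdryOp, ← integral_const_mul]
  congr 1
  ext ξ
  simp only [sym]
  ring

theorem integrable_of_mul_sym {ν : ℂ} (hν : ν ≠ 0) {m : EuclideanSpace ℝ (Fin d) → ℂ} {x : ℝ}
    (h : Integrable fun ξ => m ξ * sym ν (.inr false) ξ * Complex.exp (-rootA ν ξ * x)) :
    Integrable fun ξ => m ξ * Complex.exp (-rootA ν ξ * x) := by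
  have hn : ((√‖ν‖ : ℝ) : ℂ) ≠ 0 := by
    have : 0 < √‖ν‖ := by positivity
    exact_mod_cast this.ne'
  refine (h.const_mul (((√‖ν‖ : ℝ) : ℂ))⁻¹).congr (Filter.Eventually.of_forall fun ξ => ?_)
  simp only [sym]
  field_simp

theorem norm_sum_smul_coordFun_le (z : Fin d ⊕ Bool → ℂ) :
    ‖∑ i, z i • coordFun i‖ ≤ ∑ i, ‖z i‖ :=
  (norm_sum_le _ _).trans (Finset.sum_le_sum fun i _ => by
    rw [norm_smul]
    exact mul_le_of_le_one_right (norm_nonneg _) (norm_coordFun_le i))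

/-- Pointwise size of the weighted derivatives of the boundary operator. -/
noncomputable def bdrySize (ν : ℂ) (a g : EuclideanSpace ℝ (Fin d) → ℂ)
    (p : EuclideanSpace ℝ (Fin d) × ℝ) : ℝ :=
  ∑ i, ∑ k, ‖bdryOp ν (fun ξ => a ξ * sym ν i ξ * sym ν k ξ) g p‖

theorem le_sum_univ_of_nonneg {ι : Type*} [Fintype ι] (i : ι) (w : ι → ℝ) (h : ∀ i, 0 ≤ w i) :
    w i ≤ ∑ i, w i :=
  Finset.single_le_sum (fun i _ => h i) (Finset.mem_univ i)

theorem norm_bdryOp_le_bdrySize (ν : ℂ) (a g : EuclideanSpace ℝ (Fin d) → ℂ)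
    (p : EuclideanSpace ℝ (Fin d) × ℝ) : ‖ν‖ * ‖bdryOp ν a g p‖ ≤ bdrySize ν a g p := by
  have h : ‖ν‖ * ‖bdryOp ν a g p‖ =
      ‖bdryOp ν (fun ξ => a ξ * sym ν (.inr false) ξ * sym ν (.inr false) ξ) g p‖ := by
    rw [bdryOp_mul_sym_inr_false ν (fun ξ => a ξ * sym ν (.inr false) ξ),
      bdryOp_mul_sym_inr_false, norm_mul, norm_mul, ← mul_assoc, Complex.norm_real,
      norm_of_nonneg (sqrt_nonneg _), mul_self_sqrt (norm_nonneg _)]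
  rw [h]
  exact (le_sum_univ_of_nonneg (.inr false)
    (fun k => ‖bdryOp ν (fun ξ => a ξ * sym ν (.inr false) ξ * sym ν k ξ) g p‖)
    fun _ => norm_nonneg _).trans (le_sum_univ_of_nonneg (.inr false)
      (fun i => ∑ k, ‖bdryOp ν (fun ξ => a ξ * sym ν i ξ * sym ν k ξ) g p‖)
      fun _ => Finset.sum_nonneg fun _ _ => norm_nonneg _)

theorem norm_fderiv_bdryOp_le {b : ℝ} (hb0 : 0 < b) (hb1 : b ≤ 1) {ν : ℂ} (hν : ν ≠ 0)
    (hb : b * ‖ν‖ ≤ ‖ν‖ + ν.re) (hd : 1 ≤ d) {c : ℝ} (hc : 0 ≤ c)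
    {a : EuclideanSpace ℝ (Fin d) → ℂ} (ha : OrderNegOne d ν c a)
    {g : EuclideanSpace ℝ (Fin d) → ℂ} (hg : Measurable g) {F : ℝ} (hF : ∀ ξ, ‖g ξ‖ ≤ F)
    {p : EuclideanSpace ℝ (Fin d) × ℝ} (hp : 0 < p.2) :
    √‖ν‖ * ‖fderiv ℝ (bdryOp ν a g) p‖ ≤ bdrySize ν a g p ∧
      ‖fderiv ℝ (fderiv ℝ (bdryOp ν a g)) p‖ ≤ bdrySize ν a g p := by
  have hA : ∀ ξ : EuclideanSpace ℝ (Fin d), 0 < (rootA ν ξ).re := fun ξ =>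
    (mul_pos (by positivity) (weight_pos hν ξ)).trans_le (rootA_re_ge hb0 hb1 hν hb hd ξ)
  have hAm : Measurable (rootA ν : EuclideanSpace ℝ (Fin d) → ℂ) :=
    (contDiff_rootA hb0 hν hb 0).continuous.measurable
  have i2 := fun (i k : Fin d ⊕ Bool) (x : ℝ) (hx : 0 < x) =>
    integrable_mul_sym_mul_sym hb0 hb1 hν hb hd hc ha i k hx
  have i1 := fun (i : Fin d ⊕ Bool) (x : ℝ) (hx : 0 < x) =>
    integrable_of_mul_sym hν (i2 i (.inr false) x hx)
  have i0 := fun (x : ℝ) (hx : 0 < x) => integrable_of_mul_sym hν (i1 (.inr false) x hx)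
  have d1 : ∀ {p : EuclideanSpace ℝ (Fin d) × ℝ}, 0 < p.2 → HasFDerivAt (bdryOp ν a g)
      (∑ i, bdryOp ν (fun ξ => a ξ * sym ν i ξ) g p • coordFun i) p := fun hp =>
    hasFDerivAt_bdryOp hA hAm ha.measurable hg hF i0 i1 hp
  have d2 := fun i : Fin d ⊕ Bool => hasFDerivAt_bdryOp hA hAm
    (ha.measurable.mul (contDiff_sym hb0 hν hb i 0).continuous.measurable) hg hF (i1 i) (i2 i) hp
  constructor
  · rw [(d1 hp).fderiv]
    refine (mul_le_mul_of_nonneg_left (norm_sum_smul_coordFun_le _) (sqrt_nonneg _)).trans ?_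
    rw [Finset.mul_sum]
    refine Finset.sum_le_sum fun i _ => ?_
    have h : √‖ν‖ * ‖bdryOp ν (fun ξ => a ξ * sym ν i ξ) g p‖ =
        ‖bdryOp ν (fun ξ => a ξ * sym ν i ξ * sym ν (.inr false) ξ) g p‖ := by
      rw [bdryOp_mul_sym_inr_false ν (fun ξ => a ξ * sym ν i ξ), norm_mul, Complex.norm_real,
        norm_of_nonneg (sqrt_nonneg _)]
    rw [h]
    exact le_sum_univ_of_nonneg (.inr false)
      (fun k => ‖bdryOp ν (fun ξ => a ξ * sym ν i ξ * sym ν k ξ) g p‖) fun _ => norm_nonneg _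
  · have he : fderiv ℝ (bdryOp ν a g) =ᶠ[nhds p] fun p =>
        ∑ i, bdryOp ν (fun ξ => a ξ * sym ν i ξ) g p • coordFun i := by
      filter_upwards [(isOpen_lt continuous_const continuous_snd).mem_nhds hp] with p' hp'
        using (d1 hp').fderiv
    have hsum := HasFDerivAt.fun_sum (u := Finset.univ) fun i _ => (d2 i).smul_const (coordFun i)
    rw [he.fderiv_eq]
    refine (congrArg norm hsum.fderiv).trans_le ?_
    refine (norm_sum_le _ _).trans (Finset.sum_le_sum fun i _ => ?_)
    refine le_trans (ContinuousLinearMap.opNorm_le_bound _ (norm_nonneg _) fun v => ?_)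
      (norm_sum_smul_coordFun_le _)
    rw [ContinuousLinearMap.smulRight_apply, norm_smul]
    exact (mul_le_of_le_one_right (norm_nonneg _) (norm_coordFun_le i)).trans
      (ContinuousLinearMap.le_opNorm _ v)

theorem measurable_bdryOp {ν : ℂ} (hAm : Measurable (rootA ν : EuclideanSpace ℝ (Fin d) → ℂ))
    {m g : EuclideanSpace ℝ (Fin d) → ℂ} (hm : Measurable m) (hg : Measurable g) :
    Measurable (bdryOp ν m g) := by
  have h : Measurable fun w : (EuclideanSpace ℝ (Fin d) × ℝ) × EuclideanSpace ℝ (Fin d) =>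
      Complex.exp (Complex.I * (⟪w.1.1, w.2⟫ : ℂ)) *
        (m w.2 * Complex.exp (-rootA ν w.2 * w.1.2) * g w.2) := by fun_prop
  exact (StronglyMeasurable.integral_prod_right' (ν := volume) h.stronglyMeasurable).measurable

theorem eLpNorm'_sum_sum_le {α ι : Type*} [MeasurableSpace α] [Fintype ι] {μ : Measure α}
    {w : ι → ι → α → ℝ} (hw : ∀ i k, Measurable (w i k)) {q : ℝ} (hq : 1 ≤ q) {B : ENNReal}
    (hB : ∀ i k, eLpNorm' (w i k) q μ ≤ B) :
    eLpNorm' (fun p => ∑ i, ∑ k, w i k p) q μ ≤ Fintype.card ι * (Fintype.card ι * B) := by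
  have e : (fun p => ∑ i, ∑ k, w i k p) = ∑ i, ∑ k, w i k := by
    funext p; simp
  rw [e]
  have h1 := eLpNorm'_sum_le (μ := μ) (f := fun i => ∑ k, w i k) (s := Finset.univ)
    (fun i _ => Finset.aestronglyMeasurable_sum _ fun k _ => (hw i k).aestronglyMeasurable) hq
  have h2 : ∀ i, eLpNorm' (∑ k, w i k) q μ ≤ Fintype.card ι * B := by
    intro i
    have h3 := eLpNorm'_sum_le (μ := μ) (f := w i) (s := Finset.univ)
      (fun k _ => (hw i k).aestronglyMeasurable) hq
    refine h3.trans ((Finset.sum_le_sum fun k _ => hB i k).trans (le_of_eq ?_))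
    simp
  refine h1.trans ((Finset.sum_le_sum fun i _ => h2 i).trans (le_of_eq ?_))
  simp

theorem exists_bdrySize_bound {b : ℝ} (hb0 : 0 < b) (hb1 : b ≤ 1) (hd : 1 ≤ d) {q : ℝ}
    (hq : 1 < q) {c : ℝ} (hc : 0 ≤ c) :
    ∃ C : ℝ, 0 ≤ C ∧ ∀ ν : ℂ, ν ≠ 0 → b * ‖ν‖ ≤ ‖ν‖ + ν.re → ∀ a, OrderNegOne d ν c a →
      ∀ (f : SchwartzMap (EuclideanSpace ℝ (Fin d) × ℝ) ℂ) (ς : ℝ), (ς = 1 ∨ ς = -1) →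
        eLpNorm' (bdrySize ν a (fourierE fun z => f (z, 0))) q
          (volume.prod (volume.restrict (Set.Ioi 0))) ≤
        ENNReal.ofReal C * ∑ l, eLpNorm' (fun p => dataComp ν f l (p.1, ς * p.2)) q
          (volume.prod (volume.restrict (Set.Ioi 0))) := by
  obtain ⟨C, hC, h⟩ := exists_bdryOp_bound (d := d) hb0 hb1 hd hq hc
  refine ⟨Fintype.card (Fin d ⊕ Bool) * (Fintype.card (Fin d ⊕ Bool) * C), by positivity,
    fun ν hν hb a ha f ς hς => ?_⟩
  have hAm : Measurable (rootA ν : EuclideanSpace ℝ (Fin d) → ℂ) :=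
    (contDiff_rootA hb0 hν hb 0).continuous.measurable
  have hsm : ∀ i, Measurable (sym ν i : EuclideanSpace ℝ (Fin d) → ℂ) := fun i =>
    (contDiff_sym hb0 hν hb i 0).continuous.measurable
  set g : EuclideanSpace ℝ (Fin d) → ℂ := fourierE fun z => f (z, 0) with hg
  have hgm : Measurable g := measurable_fourierE
    (f.continuous.measurable.comp measurable_prodMk_right)
  have hm : ∀ i k, Measurable fun p => ‖bdryOp ν (fun ξ => a ξ * sym ν i ξ * sym ν k ξ) g p‖ :=
    fun i k => (measurable_bdryOp hAm ((ha.measurable.mul (hsm i)).mul (hsm k)) hgm).norm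
  have h2 := eLpNorm'_sum_sum_le (μ := volume.prod (volume.restrict (Set.Ioi (0 : ℝ)))) hm hq.le
    fun i k => (eLpNorm'_norm.trans_le (h ν hν hb a ha i k f ς hς))
  refine h2.trans (le_of_eq ?_)
  rw [ENNReal.ofReal_mul (by positivity), ENNReal.ofReal_mul (by positivity),
    ENNReal.ofReal_natCast, mul_assoc, mul_assoc]

theorem LqNorm_nonneg {α E : Type*} [MeasurableSpace α] [NormedAddCommGroup E] (μ : Measure α)
    (q : ℝ) (f : α → E) : 0 ≤ LqNorm μ q f :=
  rpow_nonneg (integral_nonneg fun _ => rpow_nonneg (norm_nonneg _) _) _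

theorem ofReal_LqNorm {α E : Type*} [MeasurableSpace α] [NormedAddCommGroup E] {μ : Measure α}
    {q : ℝ} (hq : 0 < q) {f : α → E} (hf : Integrable (fun x => ‖f x‖ ^ q) μ) :
    ENNReal.ofReal (LqNorm μ q f) = eLpNorm' f q μ := by
  have h := ofReal_integral_norm_eq_lintegral_enorm hf
  have h1 : ∀ x, ‖‖f x‖ ^ q‖ = ‖f x‖ ^ q := fun x =>
    norm_of_nonneg (rpow_nonneg (norm_nonneg _) _)
  have h2 : ∀ x, ‖‖f x‖ ^ q‖ₑ = ‖f x‖ₑ ^ q := fun x => by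
    rw [Real.enorm_rpow_of_nonneg (norm_nonneg _) hq.le, enorm_norm]
  simp only [h1, h2] at h
  rw [eLpNorm'_eq_lintegral_enorm, ← h, LqNorm,
    ENNReal.ofReal_rpow_of_nonneg (integral_nonneg fun _ => rpow_nonneg (norm_nonneg _) _)
      (by positivity)]

theorem ofReal_LqNorm_le {α E : Type*} [MeasurableSpace α] [NormedAddCommGroup E] (μ : Measure α)
    {q : ℝ} (hq : 0 < q) (f : α → E) : ENNReal.ofReal (LqNorm μ q f) ≤ eLpNorm' f q μ := by
  by_cases hf : Integrable (fun x => ‖f x‖ ^ q) μ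
  · exact (ofReal_LqNorm hq hf).le
  · rw [LqNorm, integral_undef hf, zero_rpow (by positivity)]
    simp

theorem mul_LqNorm_le {α E : Type*} [MeasurableSpace α] [NormedAddCommGroup E] {μ : Measure α}
    {q : ℝ} (hq : 0 < q) {f : α → E} {S : α → ℝ} {k B : ℝ} (hk : 0 ≤ k) (hB : 0 ≤ B)
    (h : ∀ᵐ x ∂μ, k * ‖f x‖ ≤ S x) (hS : eLpNorm' S q μ ≤ ENNReal.ofReal B) :
    k * LqNorm μ q f ≤ B := by
  rw [← ENNReal.ofReal_le_ofReal_iff hB, ENNReal.ofReal_mul hk]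
  refine le_trans ?_ hS
  have h1 := eLpNorm'_const_smul (μ := μ) (f := fun x => ‖f x‖) k hq
  rw [eLpNorm'_norm (f := f)] at h1
  refine (mul_le_mul_right (ofReal_LqNorm_le μ hq f) _).trans ?_
  rw [← Real.enorm_of_nonneg hk, ← h1]
  refine eLpNorm'_mono_ae hq.le ?_
  filter_upwards [h] with x hx
  have : k * ‖f x‖ ≤ ‖S x‖ := hx.trans (le_norm_self _)
  simpa [norm_of_nonneg hk, abs_of_nonneg hk] using this

theorem volume_restrict_pos_snd :
    (volume : Measure (EuclideanSpace ℝ (Fin d) × ℝ)).restrict {p | 0 < p.2} =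
      volume.prod (volume.restrict (Set.Ioi 0)) := by
  rw [← Measure.restrict_univ (μ := (volume : Measure (EuclideanSpace ℝ (Fin d)))),
    Measure.prod_restrict, ← Measure.volume_eq_prod]
  congr 1
  ext p
  simp

theorem measurePreserving_reflect {ς : ℝ} (hς : ς = 1 ∨ ς = -1) :
    MeasurePreserving (fun p : EuclideanSpace ℝ (Fin d) × ℝ => (p.1, ς * p.2))
      (volume.prod (volume.restrict (Set.Ioi 0))) (volume.restrict {p | 0 < ς * p.2}) := by
  have h1 : MeasurePreserving (fun y : ℝ => ς * y) volume volume := by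
    rcases hς with rfl | rfl
    · simpa using! MeasurePreserving.id (volume : Measure ℝ)
    · simpa using Measure.measurePreserving_neg (volume : Measure ℝ)
  have h2 : MeasurePreserving (fun p : EuclideanSpace ℝ (Fin d) × ℝ => (p.1, ς * p.2))
      volume volume := (MeasurePreserving.id _).prod h1
  have h3 := h2.restrict_preimage (s := {p | 0 < ς * p.2})
    (measurableSet_lt measurable_const (by fun_prop))
  rw [← volume_restrict_pos_snd]
  have e : (fun p : EuclideanSpace ℝ (Fin d) × ℝ => (p.1, ς * p.2)) ⁻¹' {p | 0 < ς * p.2} =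
      {p | 0 < p.2} := by
    ext p
    rcases hς with rfl | rfl <;> simp
  rwa [e] at h3

theorem integrable_norm_rpow_schwartz {E F : Type*} [NormedAddCommGroup E] [NormedSpace ℝ E]
    [NormedAddCommGroup F] [NormedSpace ℝ F] [MeasurableSpace E] [BorelSpace E]
    [SecondCountableTopology E] (f : SchwartzMap E F) {q : ℝ} (hq : 0 < q) (μ : Measure E)
    [μ.HasTemperateGrowth] : Integrable (fun x => ‖f x‖ ^ q) μ := by
  have h := (f.memLp (ENNReal.ofReal q) μ).integrable_norm_rpow (by simpa using hq)
    ENNReal.ofReal_ne_top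
  rwa [ENNReal.toReal_ofReal hq.le] at h

theorem eLpNorm'_dataComp_le {q : ℝ} (hq : 0 < q) (ν : ℂ)
    (f : SchwartzMap (EuclideanSpace ℝ (Fin d) × ℝ) ℂ) {ς : ℝ} (hς : ς = 1 ∨ ς = -1)
    (l : Fin d ⊕ Bool) :
    eLpNorm' (fun p => dataComp ν f l (p.1, ς * p.2)) q
        (volume.prod (volume.restrict (Set.Ioi 0))) ≤
      ENNReal.ofReal (√‖ν‖ * LqNorm (volume.restrict {p | 0 < ς * p.2}) q (fun p => f p) +
        LqNorm (volume.restrict {p | 0 < ς * p.2}) q (fun p => fderiv ℝ (fun p' => f p') p)) := by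
  have : (volume : Measure (EuclideanSpace ℝ (Fin d) × ℝ)).IsAddHaarMeasure := by
    rw [Measure.volume_eq_prod]
    infer_instance
  have hm := measurePreserving_reflect (d := d) hς
  set μ : Measure (EuclideanSpace ℝ (Fin d) × ℝ) := volume.restrict {p | 0 < ς * p.2}
  have e : eLpNorm' (fun p => dataComp ν f l (p.1, ς * p.2)) q
      (volume.prod (volume.restrict (Set.Ioi 0))) = eLpNorm' (dataComp ν f l) q μ := by
    rw [eLpNorm'_eq_lintegral_enorm, eLpNorm'_eq_lintegral_enorm,
      ← hm.lintegral_comp (f := fun p => ‖dataComp ν f l p‖ₑ ^ q)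
        ((dataComp ν f l).continuous.measurable.enorm.pow_const q)]
  have i1 : Integrable (fun p => ‖f p‖ ^ q) μ :=
    (integrable_norm_rpow_schwartz f hq volume).restrict
  have i2 : Integrable (fun p => ‖fderiv ℝ (fun p' => f p') p‖ ^ q) μ :=
    (integrable_norm_rpow_schwartz (SchwartzMap.fderivCLM ℝ _ _ f) hq volume).restrict
  rw [e, ENNReal.ofReal_add (mul_nonneg (sqrt_nonneg _) (LqNorm_nonneg _ _ _))
    (LqNorm_nonneg _ _ _), ENNReal.ofReal_mul (sqrt_nonneg _),
    ofReal_LqNorm hq i1, ofReal_LqNorm hq i2]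
  have hdir : ∀ v : EuclideanSpace ℝ (Fin d) × ℝ, ‖v‖ = 1 →
      eLpNorm' (fun p => fderiv ℝ (fun p' => f p') p v) q μ ≤
        eLpNorm' (fun p => fderiv ℝ (fun p' => f p') p) q μ := by
    intro v hv
    refine eLpNorm'_mono_ae hq.le (Filter.Eventually.of_forall fun p => ?_)
    simpa [hv] using (fderiv ℝ (fun p' => f p') p).le_opNorm v
  match l with
  | .inl j =>
    refine le_trans (le_of_eq_of_le ?_ (hdir (EuclideanSpace.single j 1, 0) ?_)) le_add_self
    · rfl
    · simp [Prod.norm_def]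
  | .inr true =>
    refine le_trans (le_of_eq_of_le ?_ (hdir (0, 1) ?_)) le_add_self
    · rfl
    · simp [Prod.norm_def]
  | .inr false =>
    refine le_trans (le_of_eq ?_) le_self_add
    rw [← Real.enorm_of_nonneg (sqrt_nonneg _), ← eLpNorm'_const_smul _ hq]
    rfl

theorem sector_bound {σ : ℝ} (hσ : σ ∈ Set.Ioo 0 (π / 2)) {z : ℂ} (hz : |z.arg| < π - σ) :
    (1 - cos σ) * ‖z‖ ≤ ‖z‖ + z.re := by
  have h : cos (π - σ) ≤ cos |z.arg| :=
    cos_le_cos_of_nonneg_of_le_pi (abs_nonneg _) (by linarith [hσ.1]) hz.le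
  rw [cos_pi_sub, cos_abs] at h
  rw [← Complex.norm_mul_cos_arg z]
  nlinarith [norm_nonneg z]

theorem orderNegOne_of_bound {lam : ℂ} (hlam : lam ≠ 0) {ρ : ℝ} (hρ : 0 < ρ) {c : ℝ} (hc : 0 ≤ c)
    {l : EuclideanSpace ℝ (Fin d) → ℂ} (hl : ContDiffOn ℝ (⊤ : ℕ∞) l {0}ᶜ)
    (hb : ∀ ξ : EuclideanSpace ℝ (Fin d), ξ ≠ 0 → ∀ n : ℕ, n ≤ d + 1 →
      ‖iteratedFDeriv ℝ n l ξ‖ ≤ c * (‖lam‖ ^ ((1 : ℝ) / 2) + ‖ξ‖) ^ (-1 - (n : ℝ))) :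
    OrderNegOne d (ρ * lam) (c * (√ρ + 1) ^ (d + 2)) l := by
  refine ⟨hl, fun ξ hξ n hn => (hb ξ hξ n hn).trans ?_⟩
  have hρ0 : (ρ : ℂ) ≠ 0 := by exact_mod_cast hρ.ne'
  have hw := weight_pos (d := d) (mul_ne_zero hρ0 hlam) ξ
  have hs : 0 < √‖lam‖ := by positivity
  rw [← sqrt_eq_rpow, show -1 - (n : ℝ) = -((n + 1 : ℕ) : ℝ) by push_cast; ring,
    rpow_neg (by positivity), rpow_natCast, mul_div_assoc]
  refine mul_le_mul_of_nonneg_left ?_ hc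
  rw [inv_le_comm₀ (by positivity) (by positivity), inv_div]
  have h1 : weight (↑ρ * lam) ξ ≤ (√ρ + 1) * (√‖lam‖ + ‖ξ‖) := by
    rw [weight, norm_mul, Complex.norm_real, norm_of_nonneg hρ.le, sqrt_mul hρ.le]
    nlinarith [norm_nonneg ξ, sqrt_nonneg ρ, mul_nonneg (sqrt_nonneg ρ) (norm_nonneg ξ)]
  rw [div_le_iff₀ (by positivity)]
  calc weight (↑ρ * lam) ξ ^ (n + 1) ≤ ((√ρ + 1) * (√‖lam‖ + ‖ξ‖)) ^ (n + 1) := by gcongr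
    _ = (√‖lam‖ + ‖ξ‖) ^ (n + 1) * (√ρ + 1) ^ (n + 1) := by rw [mul_pow, mul_comm]
    _ ≤ _ := mul_le_mul_of_nonneg_left
      (pow_le_pow_right₀ (by linarith [sqrt_nonneg ρ]) (by omega)) (by positivity)

theorem exists_poissonOp_bound (hd : 1 ≤ d) {q : ℝ} (hq : 1 < q) {σ : ℝ}
    (hσ : σ ∈ Set.Ioo 0 (π / 2)) {ρ : ℝ} (hρ : 0 < ρ) {c : ℝ} (hc : 0 < c) :
    ∃ C : ℝ, 0 ≤ C ∧
      ∀ lam : ℂ, lam ≠ 0 → |lam.arg| < π - σ →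
      ∀ l : EuclideanSpace ℝ (Fin d) → ℂ,
        ContDiffOn ℝ (⊤ : ℕ∞) l {0}ᶜ →
        (∀ ξ : EuclideanSpace ℝ (Fin d), ξ ≠ 0 → ∀ n : ℕ, n ≤ d + 1 →
          ‖iteratedFDeriv ℝ n l ξ‖ ≤
            c * (‖lam‖ ^ ((1 : ℝ) / 2) + ‖ξ‖) ^ (-1 - (n : ℝ))) →
      ∀ f : SchwartzMap (EuclideanSpace ℝ (Fin d) × ℝ) ℂ,
      ∀ L : EuclideanSpace ℝ (Fin d) × ℝ → ℂ,
        (∀ p : EuclideanSpace ℝ (Fin d) × ℝ,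
          L p = (((2 * π) ^ d : ℝ) : ℂ)⁻¹ *
            ∫ ξ : EuclideanSpace ℝ (Fin d),
              Complex.exp (Complex.I * (⟪p.1, ξ⟫ : ℂ)) * l ξ *
                Complex.exp (-(((ρ : ℂ) * lam + (‖ξ‖ : ℂ) ^ 2) ^ ((1 : ℂ) / 2)) * (p.2 : ℂ)) *
                (∫ z : EuclideanSpace ℝ (Fin d),
                  Complex.exp (-Complex.I * (⟪z, ξ⟫ : ℂ)) * f (z, 0))) →
      ∀ ς : ℝ, (ς = 1 ∨ ς = -1) →
        ‖lam‖ *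
            LqNorm (volume.restrict {p : EuclideanSpace ℝ (Fin d) × ℝ | 0 < p.2}) q L +
          ‖lam‖ ^ ((1 : ℝ) / 2) *
            LqNorm (volume.restrict {p : EuclideanSpace ℝ (Fin d) × ℝ | 0 < p.2}) q
              (fun p => fderiv ℝ L p) +
          LqNorm (volume.restrict {p : EuclideanSpace ℝ (Fin d) × ℝ | 0 < p.2}) q
            (fun p => iteratedFDeriv ℝ 2 L p) ≤
        C * (‖lam‖ ^ ((1 : ℝ) / 2) *
            LqNorm (volume.restrict {p : EuclideanSpace ℝ (Fin d) × ℝ | 0 < ς * p.2}) q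
              (fun p => f p) +
          LqNorm (volume.restrict {p : EuclideanSpace ℝ (Fin d) × ℝ | 0 < ς * p.2}) q
            (fun p => fderiv ℝ (fun p' => f p') p)) := by
  have q0 : 0 < q := by linarith
  have hcos0 : 0 ≤ cos σ := cos_nonneg_of_mem_Icc ⟨by linarith [hσ.1, pi_pos], hσ.2.le⟩
  have hcos1 : cos σ < 1 := by
    simpa using cos_lt_cos_of_nonneg_of_le_pi le_rfl (by linarith [hσ.2, pi_pos]) hσ.1
  have hb0 : 0 < 1 - cos σ := by linarith
  have hb1 : 1 - cos σ ≤ 1 := by linarith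
  have hc' : 0 ≤ c * (√ρ + 1) ^ (d + 2) := by positivity
  obtain ⟨C, hC, h⟩ := exists_bdrySize_bound hb0 hb1 hd hq hc'
  set m : ℝ := ((Fintype.card (Fin d ⊕ Bool) : ℕ) : ℝ) with hm
  refine ⟨(ρ⁻¹ + (√ρ)⁻¹ + 1) * (C * (m * (√ρ + 1))), by positivity,
    fun lam hlam harg l hl hlb f L hL ς hς => ?_⟩
  have hρ0 : (ρ : ℂ) ≠ 0 := by exact_mod_cast hρ.ne'
  set ν : ℂ := ρ * lam with hν_def
  have hν : ν ≠ 0 := mul_ne_zero hρ0 hlam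
  have hb : (1 - cos σ) * ‖ν‖ ≤ ‖ν‖ + ν.re := by
    refine sector_bound hσ ?_
    rwa [hν_def, Complex.arg_real_mul _ hρ]
  have hnorm : ‖ν‖ = ρ * ‖lam‖ := by
    rw [hν_def, norm_mul, Complex.norm_real, norm_of_nonneg hρ.le]
  have hsqrt : √‖ν‖ = √ρ * √‖lam‖ := by rw [hnorm, sqrt_mul hρ.le]
  have ha : OrderNegOne d ν _ l := orderNegOne_of_bound hlam hρ hc.le hl hlb
  rw [← sqrt_eq_rpow]
  set g : EuclideanSpace ℝ (Fin d) → ℂ := fourierE fun z => f (z, 0) with hg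
  have hgm : Measurable g := measurable_fourierE
    (f.continuous.measurable.comp measurable_prodMk_right)
  obtain ⟨F, -, hF⟩ := exists_norm_fourierE_slice_le f
  have hgF : ∀ ξ, ‖g ξ‖ ≤ F := fun ξ => hF ξ 0
  set κ : ℂ := (((2 * π) ^ d : ℝ) : ℂ)⁻¹ with hκ
  have hκ1 : ‖κ‖ ≤ 1 := by
    rw [hκ, norm_inv, Complex.norm_real, norm_of_nonneg (by positivity)]
    exact inv_le_one_of_one_le₀ (one_le_pow₀ (by linarith [pi_gt_three]))
  have hLB : L = κ • bdryOp ν l g := by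
    funext p
    rw [hL, Pi.smul_apply, smul_eq_mul, bdryOp]
    congr 2
    ext ξ
    rw [hg, fourierE, rootA]
    ring
  have hD1 : fderiv ℝ L = κ • fderiv ℝ (bdryOp ν l g) := by
    rw [hLB, fderiv_const_smul_field]
  have hD2 : ∀ p, ‖iteratedFDeriv ℝ 2 L p‖ = ‖κ‖ * ‖fderiv ℝ (fderiv ℝ (bdryOp ν l g)) p‖ := by
    intro p
    have h2 : fderiv ℝ (κ • fderiv ℝ (bdryOp ν l g)) p =
        κ • fderiv ℝ (fderiv ℝ (bdryOp ν l g)) p :=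
      congrFun (fderiv_const_smul_field (f := fderiv ℝ (bdryOp ν l g)) κ) p
    rw [← norm_iteratedFDeriv_fderiv, norm_iteratedFDeriv_one, hD1, h2, norm_smul]
  set X := LqNorm (volume.restrict {p : EuclideanSpace ℝ (Fin d) × ℝ | 0 < ς * p.2}) q
    (fun p => f p) with hX
  set Y := LqNorm (volume.restrict {p : EuclideanSpace ℝ (Fin d) × ℝ | 0 < ς * p.2}) q
    (fun p => fderiv ℝ (fun p' => f p') p) with hY
  have hX0 : 0 ≤ X := LqNorm_nonneg _ _ _
  have hY0 : 0 ≤ Y := LqNorm_nonneg _ _ _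
  set B : ℝ := C * (m * (√‖ν‖ * X + Y)) with hB
  have hB0 : 0 ≤ B := by positivity
  have hS : eLpNorm' (bdrySize ν l g) q
      (volume.restrict {p : EuclideanSpace ℝ (Fin d) × ℝ | 0 < p.2}) ≤ ENNReal.ofReal B := by
    rw [volume_restrict_pos_snd]
    refine (h ν hν hb l ha f ς hς).trans ?_
    rw [hB, ENNReal.ofReal_mul hC, ENNReal.ofReal_mul (by positivity), hm, ENNReal.ofReal_natCast]
    refine mul_le_mul_right ?_ _
    refine (Finset.sum_le_sum fun l _ => eLpNorm'_dataComp_le q0 ν f hς l).trans (le_of_eq ?_)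
    rw [Finset.sum_const, Finset.card_univ, nsmul_eq_mul]
  have hpos : ∀ᵐ p ∂(volume.restrict {p : EuclideanSpace ℝ (Fin d) × ℝ | 0 < p.2}), 0 < p.2 :=
    ae_restrict_mem (measurableSet_lt measurable_const measurable_snd)
  have b0 := mul_LqNorm_le (f := L) q0 (norm_nonneg ν) hB0 (by
    refine Filter.Eventually.of_forall fun p => ?_
    rw [hLB, Pi.smul_apply, norm_smul]
    exact (mul_le_mul_of_nonneg_left (mul_le_of_le_one_left (norm_nonneg _) hκ1)
      (norm_nonneg _)).trans (norm_bdryOp_le_bdrySize ν l g p)) hS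
  have b1 := mul_LqNorm_le (f := fun p => fderiv ℝ L p) q0 (sqrt_nonneg ‖ν‖) hB0 (by
    filter_upwards [hpos] with p hp
    rw [hD1, Pi.smul_apply, norm_smul]
    exact (mul_le_mul_of_nonneg_left (mul_le_of_le_one_left (norm_nonneg _) hκ1)
      (sqrt_nonneg _)).trans (norm_fderiv_bdryOp_le hb0 hb1 hν hb hd hc' ha hgm hgF hp).1) hS
  have b2 := mul_LqNorm_le (f := fun p => iteratedFDeriv ℝ 2 L p) q0 zero_le_one hB0 (by
    filter_upwards [hpos] with p hp
    rw [hD2, one_mul]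
    refine le_trans ?_ (norm_fderiv_bdryOp_le hb0 hb1 hν hb hd hc' ha hgm hgF hp).2
    exact mul_le_of_le_one_left (by positivity) hκ1) hS
  have hsρ : 0 < √ρ := sqrt_pos.2 hρ
  rw [hnorm, mul_assoc, ← le_inv_mul_iff₀ hρ] at b0
  rw [hsqrt, mul_assoc, ← le_inv_mul_iff₀ hsρ] at b1
  rw [one_mul] at b2
  have hB1 : B ≤ C * (m * (√ρ + 1)) * (√‖lam‖ * X + Y) := by
    rw [hB, hsqrt, mul_assoc C, mul_assoc m]
    refine mul_le_mul_of_nonneg_left (mul_le_mul_of_nonneg_left ?_ (by positivity)) hC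
    nlinarith [mul_nonneg (sqrt_nonneg ‖lam‖) hX0, mul_nonneg hsρ.le hY0]
  calc _ ≤ (ρ⁻¹ + (√ρ)⁻¹ + 1) * B := by linarith
    _ ≤ (ρ⁻¹ + (√ρ)⁻¹ + 1) * (C * (m * (√ρ + 1)) * (√‖lam‖ * X + Y)) :=
      mul_le_mul_of_nonneg_left hB1 (by positivity)
    _ = _ := by ring
end

/-- Lemma 2.6(2) (operator `L₁(λ)`, estimate (2.7)): the operator built from the symbol
`ℓ(ξ')` (of order `-1`) and the kernel `e^{-A(ξ')x_N}` applied to the boundary trace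
`f̂(ξ', 0)` satisfies
`|λ|‖Lf‖_{L^q(ℝ^N_+)} + |λ|^{1/2}‖∇Lf‖_{L^q(ℝ^N_+)} + ‖D²Lf‖_{L^q(ℝ^N_+)}
  ≤ C(|λ|^{1/2}‖f‖_{L^q(ℝ^N_ς)} + ‖∇f‖_{L^q(ℝ^N_ς)})`, uniformly in `λ`, `ℓ`, `f`. -/
theorem stmt_18 (N : ℕ) (hN : 2 ≤ N) (q : ℝ) (hq : 1 < q) (σ : ℝ)
    (hσ : σ ∈ Set.Ioo 0 (π / 2)) (ρp ρm : ℝ) (hρp : 0 < ρp) (hρm : 0 < ρm)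
    (c : ℝ) (hc : 0 < c) :
    ∃ C : ℝ, 0 < C ∧
      ∀ lam : ℂ, lam ≠ 0 → |lam.arg| < π - σ →
      ∀ ρa : ℝ, (ρa = ρp ∨ ρa = ρm) →
      ∀ l : EuclideanSpace ℝ (Fin (N - 1)) → ℂ,
        ContDiffOn ℝ (⊤ : ℕ∞) l {0}ᶜ →
        (∀ ξ : EuclideanSpace ℝ (Fin (N - 1)), ξ ≠ 0 → ∀ n : ℕ, n ≤ N + 1 →
          ‖iteratedFDeriv ℝ n l ξ‖ ≤
            c * (‖lam‖ ^ ((1 : ℝ) / 2) + ‖ξ‖) ^ (-1 - (n : ℝ))) →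
      ∀ f : SchwartzMap (EuclideanSpace ℝ (Fin (N - 1)) × ℝ) ℂ,
      ∀ L : EuclideanSpace ℝ (Fin (N - 1)) × ℝ → ℂ,
        (∀ p : EuclideanSpace ℝ (Fin (N - 1)) × ℝ,
          L p = (((2 * π) ^ (N - 1) : ℝ) : ℂ)⁻¹ *
            ∫ ξ : EuclideanSpace ℝ (Fin (N - 1)),
              Complex.exp (Complex.I * (⟪p.1, ξ⟫ : ℂ)) * l ξ *
                Complex.exp (-(((ρa : ℂ) * lam + (‖ξ‖ : ℂ) ^ 2) ^ ((1 : ℂ) / 2)) * (p.2 : ℂ)) *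
                (∫ z : EuclideanSpace ℝ (Fin (N - 1)),
                  Complex.exp (-Complex.I * (⟪z, ξ⟫ : ℂ)) * f (z, 0))) →
      ∀ ς : ℝ, (ς = 1 ∨ ς = -1) →
        ‖lam‖ *
            LqNorm (volume.restrict {p : EuclideanSpace ℝ (Fin (N - 1)) × ℝ | 0 < p.2}) q L +
          ‖lam‖ ^ ((1 : ℝ) / 2) *
            LqNorm (volume.restrict {p : EuclideanSpace ℝ (Fin (N - 1)) × ℝ | 0 < p.2}) q
              (fun p => fderiv ℝ L p) +
          LqNorm (volume.restrict {p : EuclideanSpace ℝ (Fin (N - 1)) × ℝ | 0 < p.2}) q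
            (fun p => iteratedFDeriv ℝ 2 L p) ≤
        C * (‖lam‖ ^ ((1 : ℝ) / 2) *
            LqNorm (volume.restrict {p : EuclideanSpace ℝ (Fin (N - 1)) × ℝ | 0 < ς * p.2}) q
              (fun p => f p) +
          LqNorm (volume.restrict {p : EuclideanSpace ℝ (Fin (N - 1)) × ℝ | 0 < ς * p.2}) q
            (fun p => fderiv ℝ (fun p' => f p') p)) := by
  have hd : 1 ≤ N - 1 := by omega
  obtain ⟨Cp, hCp, hp⟩ := exists_poissonOp_bound hd hq hσ hρp hc
  obtain ⟨Cm, hCm, hm⟩ := exists_poissonOp_bound hd hq hσ hρm hc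
  refine ⟨Cp + Cm + 1, by positivity, fun lam hlam harg ρa hρa l hl hlb f L hL ς hς => ?_⟩
  have hlb' := fun ξ hξ n (hn : n ≤ N - 1 + 1) => hlb ξ hξ n (by omega)
  have hR : 0 ≤ ‖lam‖ ^ ((1 : ℝ) / 2) *
      LqNorm (volume.restrict {p : EuclideanSpace ℝ (Fin (N - 1)) × ℝ | 0 < ς * p.2}) q
        (fun p => f p) +
      LqNorm (volume.restrict {p : EuclideanSpace ℝ (Fin (N - 1)) × ℝ | 0 < ς * p.2}) q
        (fun p => fderiv ℝ (fun p' => f p') p) :=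
    add_nonneg (mul_nonneg (by positivity) (LqNorm_nonneg _ _ _)) (LqNorm_nonneg _ _ _)
  rcases hρa with rfl | rfl
  · exact (hp lam hlam harg l hl hlb' f L hL ς hς).trans
      (mul_le_mul_of_nonneg_right (by linarith) hR)
  · exact (hm lam hlam harg l hl hlb' f L hL ς hς).trans
      (mul_le_mul_of_nonneg_right (by linarith) hR)
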